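/- arXiv:1702.08854 — 7 statements merged into one kernel-verified Lean document; each statement's English description precedes it below -/
import Mathlib

section
/- There exists a constant C > 0 such that for every integer n ≥ 2 the following holds: if M is an n-variable positive definite integral quadratic form that is represented by I_r for some positive integer r, then M is represented by I_g for some positive integer g ≤ C·n^{11}·e^{(4+2√2)√n + 2(ln n)²}. -/
open scoped Matrix

/-- `M` (the Gram matrix of an `n`-variable integral quadratic form) is represented by `I_r`,
i.e. the form is a sum of `r` squares of integral linear forms. -/
def RepBySquares (n r : ℕ) (M : Matrix (Fin n) (Fin n) ℤ) : Prop :=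
  ∃ A : Matrix (Fin r) (Fin n) ℤ, M = Aᵀ * A

/-! ### Closure properties of `RepBySquares` -/

namespace RepBySquares

variable {n r s : ℕ} {M N : Matrix (Fin n) (Fin n) ℤ}

lemma of_fintype {σ : Type*} [Fintype σ] (A : Matrix σ (Fin n) ℤ) :
    RepBySquares n (Fintype.card σ) (Aᵀ * A) := by
  refine ⟨A.submatrix (Fintype.equivFin σ).symm id, ?_⟩
  rw [Matrix.transpose_submatrix, Matrix.submatrix_mul_equiv]
  simp

lemma zero : RepBySquares n r 0 := ⟨0, by simp⟩

lemma add (hM : RepBySquares n r M) (hN : RepBySquares n s N) :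
    RepBySquares n (r + s) (M + N) := by
  obtain ⟨A, rfl⟩ := hM
  obtain ⟨B, rfl⟩ := hN
  have h := of_fintype (Matrix.fromRows A B)
  rwa [Fintype.card_sum, Fintype.card_fin, Fintype.card_fin, Matrix.transpose_fromRows,
    Matrix.fromCols_mul_fromRows] at h

lemma mono (hM : RepBySquares n r M) (hrs : r ≤ s) : RepBySquares n s M := by
  obtain ⟨t, rfl⟩ := Nat.exists_eq_add_of_le hrs
  simpa using hM.add (zero (r := t))

lemma conj {m : ℕ} (hM : RepBySquares n r M) (V : Matrix (Fin n) (Fin m) ℤ) :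
    RepBySquares m r (Vᵀ * M * V) := by
  obtain ⟨A, rfl⟩ := hM
  exact ⟨A * V, by simp only [Matrix.transpose_mul, Matrix.mul_assoc]⟩

lemma sum {σ : Type*} (t : Finset σ) (F : σ → Matrix (Fin n) (Fin n) ℤ)
    (hF : ∀ p ∈ t, RepBySquares n r (F p)) : RepBySquares n (t.card * r) (∑ p ∈ t, F p) := by
  classical
  induction t using Finset.induction_on with
  | empty => simpa using zero
  | insert p t hp ih =>
    rw [Finset.sum_insert hp, Finset.card_insert_of_notMem hp, add_mul, one_mul, add_comm (F p)]
    exact (ih fun q hq => hF q (Finset.mem_insert_of_mem hq)).add (hF p (Finset.mem_insert_self _ _))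

/-- A nonnegative integer multiple of the square of a linear form is a sum of four squares. -/
lemma four {c : ℤ} (hc : 0 ≤ c) (u : Fin n → ℤ) :
    RepBySquares n 4 (c • Matrix.vecMulVec u u) := by
  lift c to ℕ using hc
  obtain ⟨a, b, d, e, h⟩ := Nat.sum_four_squares c
  refine ⟨Matrix.of ![fun i => a * u i, fun i => b * u i, fun i => d * u i, fun i => e * u i], ?_⟩
  ext i j
  simp [Matrix.mul_apply, Fin.sum_univ_four, Matrix.vecMulVec_apply, ← h]
  ring

end RepBySquares

/-- A diagonally dominant integral symmetric matrix is a sum of `4 n² + 4 n` squares. -/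
lemma repBySquares_of_diagDominant {n : ℕ} (E : Matrix (Fin n) (Fin n) ℤ) (hE : E.IsSymm)
    (hd : ∀ j, ∑ k ∈ Finset.univ.erase j, |E j k| ≤ E j j) :
    RepBySquares n (4 * n ^ 2 + 4 * n) E := by
  let g : Fin n → Fin n → ℤ := fun j k => if j < k then |E j k| else 0
  let h : Fin n → Fin n → ℤ := fun j k => if j < k then E j k else 0
  let u : Fin n → Fin n → Fin n → ℤ := fun j k a =>
    (Pi.single j 1 : Fin n → ℤ) a + (SignType.sign (E j k) : ℤ) * (Pi.single k 1 : Fin n → ℤ) a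
  let d : Fin n → ℤ := fun j => E j j - ∑ k ∈ Finset.univ.erase j, |E j k|
  have key : E = (∑ p : Fin n × Fin n, g p.1 p.2 • Matrix.vecMulVec (u p.1 p.2) (u p.1 p.2)) +
      ∑ j, d j • Matrix.vecMulVec (Pi.single j 1 : Fin n → ℤ) (Pi.single j 1) := by
    ext a b
    let δ : Fin n → Fin n → ℤ := fun j a => (Pi.single j 1 : Fin n → ℤ) a
    have hδ : ∀ j a, δ j a = if j = a then 1 else 0 := fun j a => by
      simp [δ, Pi.single_apply, eq_comm]
    have hterm : ∀ j k, (g j k • Matrix.vecMulVec (u j k) (u j k)) a b =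
        δ j a * (δ j b * g j k) + δ k a * (δ k b * g j k) +
          δ j a * (δ k b * h j k) + δ k a * (δ j b * h j k) := by
      intro j k
      have h1 : g j k * (SignType.sign (E j k) : ℤ) = h j k := by
        simp only [g, h]; split_ifs
        · exact abs_mul_sign (E j k)
        · simp
      have h2 : h j k * (SignType.sign (E j k) : ℤ) = g j k := by
        simp only [g, h]; split_ifs
        · exact self_mul_sign (E j k)
        · simp
      have h3 : (g j k • Matrix.vecMulVec (u j k) (u j k)) a b =
        g j k * ((δ j a + (SignType.sign (E j k) : ℤ) * δ k a) *
          (δ j b + (SignType.sign (E j k) : ℤ) * δ k b)) := by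
        simp [Matrix.vecMulVec_apply, u, δ]
      rw [h3]
      linear_combination (δ j a * δ k b + δ k a * δ j b +
        δ k a * δ k b * (SignType.sign (E j k) : ℤ)) * h1 + δ k a * δ k b * h2
    have hdiag : ∀ j, (d j • Matrix.vecMulVec (Pi.single j 1 : Fin n → ℤ) (Pi.single j 1)) a b =
        δ j a * (δ j b * d j) := by
      intro j
      simp only [Matrix.smul_apply, Matrix.vecMulVec_apply, smul_eq_mul, δ]; ring
    rw [Matrix.add_apply, Matrix.sum_apply, Matrix.sum_apply, Fintype.sum_prod_type]
    simp only [hterm, hdiag, Finset.sum_add_distrib, hδ, ite_mul, one_mul, zero_mul,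
      Finset.sum_ite_irrel, Finset.sum_const_zero, Finset.sum_ite_eq', Finset.mem_univ, if_true]
    by_cases hab : a = b
    · subst hab
      have hs : ∑ k ∈ Finset.univ.erase a, |E a k| = (∑ k, g a k) + ∑ k, g k a := by
        rw [← Finset.sum_add_distrib, ← Finset.sum_erase (a := a) Finset.univ
          (f := fun k => g a k + g k a) (by simp only [g, lt_irrefl, if_false, add_zero])]
        refine Finset.sum_congr rfl fun k hk => ?_
        rcases lt_or_gt_of_ne (Finset.ne_of_mem_erase hk) with h' | h' <;>
          simp [g, h', h'.not_gt, hE.apply a k]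
      simp only [h, d, hs, if_true, lt_irrefl, if_false]
      ring
    · rcases lt_or_gt_of_ne hab with h' | h' <;> simp [h, h', h'.not_gt, hab, hE.apply a b]
  rw [key]
  have h1 := RepBySquares.sum (r := 4) Finset.univ
    (fun p : Fin n × Fin n => g p.1 p.2 • Matrix.vecMulVec (u p.1 p.2) (u p.1 p.2))
    fun p _ => RepBySquares.four (by simp only [g]; split_ifs <;> positivity) _
  have h2 := RepBySquares.sum (r := 4) Finset.univ
    (fun j : Fin n => d j • Matrix.vecMulVec (Pi.single j 1 : Fin n → ℤ) (Pi.single j 1))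
    fun j _ => RepBySquares.four (by have := hd j; simp only [d]; linarith) _
  refine (h1.add h2).mono (le_of_eq ?_)
  simp [Finset.card_univ]; ring

/-! ### Splitting off a short vector -/

/-- Integral matrices whose rows are orthogonal to a nonzero vector factor through a lattice
of smaller rank. -/
lemma exists_factor_of_mulVec_eq_zero {n : ℕ} {v : Fin n → ℤ} (hv : v ≠ 0) :
    ∃ m < n, ∃ B : Matrix (Fin m) (Fin n) ℤ, ∀ {σ : Type}
      (A : Matrix σ (Fin n) ℤ), A *ᵥ v = 0 → ∃ C : Matrix σ (Fin m) ℤ, A = C * B := by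
  let W : Submodule ℤ (Fin n → ℤ) := LinearMap.ker (dotProductBilin ℤ ℤ v)
  have hW : ∀ w, w ∈ W ↔ v ⬝ᵥ w = 0 := fun w => by simp [W, dotProductBilin]
  obtain ⟨m, ⟨b⟩⟩ := W.nonempty_basis_of_pid (Pi.basisFun ℤ (Fin n))
  have hli : LinearIndependent ℤ fun i => (b i : Fin n → ℤ) :=
    b.linearIndependent.map' W.subtype W.ker_subtype
  have hmn : m ≤ n := by simpa using hli.fintype_card_le_finrank
  have hne : m ≠ n := by
    rintro rfl
    have h0 : (Matrix.of fun i j => (b i : Fin m → ℤ) j) *ᵥ v = 0 := by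
      ext i
      rw [Matrix.mulVec, dotProduct_comm]
      exact (hW _).1 (b i).2
    obtain ⟨w, hw, hw0⟩ := Matrix.exists_vecMul_eq_zero_iff.2
      (Matrix.exists_mulVec_eq_zero_iff.1 ⟨v, hv, h0⟩)
    refine hw (funext (Fintype.linearIndependent_iff.1 hli w ?_))
    rw [← hw0]
    ext j
    simp [Matrix.vecMul, dotProduct]
  refine ⟨m, lt_of_le_of_ne hmn hne, Matrix.of fun i => (b i : Fin n → ℤ), fun A hA => ?_⟩
  have hmem : ∀ s, A s ∈ W := fun s => by
    rw [hW, dotProduct_comm]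
    exact congrFun hA s
  refine ⟨Matrix.of fun s i => b.repr ⟨A s, hmem s⟩ i, ?_⟩
  ext s j
  have := congrArg (fun w : W => (w : Fin n → ℤ) j) (b.sum_repr ⟨A s, hmem s⟩)
  simp only [AddSubmonoidClass.coe_finsetSum, Finset.sum_apply] at this
  rw [← this]
  simp [Matrix.mul_apply]

lemma sq_sum_split {n r : ℕ} (A : Matrix (Fin r) (Fin n) ℤ) (p : Fin r → Prop)
    [DecidablePred p] :
    Aᵀ * A = (A.submatrix (Subtype.val : {s // p s} → Fin r) id)ᵀ *
        A.submatrix (Subtype.val : {s // p s} → Fin r) id +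
      (A.submatrix (Subtype.val : {s // ¬ p s} → Fin r) id)ᵀ *
        A.submatrix (Subtype.val : {s // ¬ p s} → Fin r) id := by
  ext i j
  simp only [Matrix.mul_apply, Matrix.add_apply, Matrix.transpose_apply, Matrix.submatrix_apply,
    id]
  exact (Fintype.sum_subtype_add_sum_subtype p fun s => A s i * A s j).symm

/-- If every form of large minimum is a sum of `q` squares, peeling off short vectors bounds
the number of squares needed by any sum of squares. -/
lemma repBySquares_of_large_min {N T q : ℕ}
    (hlarge : ∀ n ≤ N, ∀ (r : ℕ) (A : Matrix (Fin r) (Fin n) ℤ),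
      (∀ x : Fin n → ℤ, x ≠ 0 → (T : ℤ) ≤ x ⬝ᵥ (Aᵀ * A) *ᵥ x) → RepBySquares n q (Aᵀ * A)) :
    ∀ n ≤ N, ∀ (r : ℕ) (A : Matrix (Fin r) (Fin n) ℤ),
      RepBySquares n (n * T + q) (Aᵀ * A) := by
  intro n
  induction n using Nat.strong_induction_on with
  | _ n ih =>
    intro hn r A
    by_cases h : ∀ x : Fin n → ℤ, x ≠ 0 → (T : ℤ) ≤ x ⬝ᵥ (Aᵀ * A) *ᵥ x
    · exact (hlarge n hn r A h).mono (Nat.le_add_left _ _)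
    push Not at h
    obtain ⟨v, hv, hvT⟩ := h
    obtain ⟨m, hm, B, hB⟩ := exists_factor_of_mulVec_eq_zero hv
    rw [sq_sum_split A fun s => (A *ᵥ v) s ≠ 0]
    set A₁ := A.submatrix (Subtype.val : {s // (A *ᵥ v) s ≠ 0} → Fin r) id
    set A₂ := A.submatrix (Subtype.val : {s // ¬ (A *ᵥ v) s ≠ 0} → Fin r) id with hA₂
    have hcard : Fintype.card {s // (A *ᵥ v) s ≠ 0} ≤ T := by
      rw [Fintype.card_subtype]
      have h1 : v ⬝ᵥ (Aᵀ * A) *ᵥ v = ∑ s, (A *ᵥ v) s ^ 2 := by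
        rw [← Matrix.mulVec_mulVec, Matrix.dotProduct_mulVec, Matrix.vecMul_transpose]
        simp [dotProduct, sq]
      have h2 : ((Finset.univ.filter fun s => (A *ᵥ v) s ≠ 0).card : ℤ)
          ≤ ∑ s, (A *ᵥ v) s ^ 2 := by
        rw [Finset.card_filter, Nat.cast_sum]
        refine Finset.sum_le_sum fun s _ => ?_
        split_ifs with hs
        · have := Int.one_le_abs hs
          rw [← sq_abs]; push_cast; nlinarith
        · simpa using sq_nonneg _
      have : ((Finset.univ.filter fun s => (A *ᵥ v) s ≠ 0).card : ℤ) ≤ T := by linarith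
      exact_mod_cast this
    obtain ⟨C, hC⟩ := hB A₂ (by
      ext s
      have := s.2
      push Not at this
      exact this)
    have h2 : RepBySquares n (m * T + q) (A₂ᵀ * A₂) := by
      obtain ⟨C', hC'⟩ := RepBySquares.of_fintype C
      have := (ih m hm (hm.le.trans hn) _ C').conj B
      rw [← hC'] at this
      rw [hC, Matrix.transpose_mul]
      simpa only [Matrix.mul_assoc] using this
    refine (((RepBySquares.of_fintype A₁).mono hcard).add h2).mono ?_
    have : (m + 1) * T ≤ n * T := Nat.mul_le_mul_right _ hm
    linarith

/-! ### Reduction of unipotent matrices (Seysen) -/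

/-- Upper triangular matrices with ones on the diagonal. -/
def UnitUpper {n : ℕ} {R : Type*} [Zero R] [One R] (P : Matrix (Fin n) (Fin n) R) : Prop :=
  (∀ i, P i i = 1) ∧ ∀ i j, j < i → P i j = 0

/-- The block matrix with diagonal blocks `A`, `D` and upper right block `B`. -/
def blockUpper {R : Type*} [Zero R] {a b : ℕ} (A : Matrix (Fin a) (Fin a) R)
    (B : Matrix (Fin a) (Fin b) R) (D : Matrix (Fin b) (Fin b) R) :
    Matrix (Fin (a + b)) (Fin (a + b)) R :=
  (Matrix.fromBlocks A B 0 D).submatrix finSumFinEquiv.symm finSumFinEquiv.symm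

section blockUpper

variable {R : Type*} {a b : ℕ}

lemma blockUpper_mul [Ring R] (A A' : Matrix (Fin a) (Fin a) R) (B B' : Matrix (Fin a) (Fin b) R)
    (D D' : Matrix (Fin b) (Fin b) R) :
    blockUpper A B D * blockUpper A' B' D' =
      blockUpper (A * A') (A * B' + B * D') (D * D') := by
  simp [blockUpper, Matrix.submatrix_mul_equiv, Matrix.fromBlocks_multiply]

lemma blockUpper_one [Ring R] : blockUpper (1 : Matrix (Fin a) (Fin a) R) 0
    (1 : Matrix (Fin b) (Fin b) R) = 1 := by
  simp [blockUpper, Matrix.fromBlocks_one]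

lemma blockUpper_map {S : Type*} [Ring R] [Ring S] (f : R →+* S) (A : Matrix (Fin a) (Fin a) R)
    (B : Matrix (Fin a) (Fin b) R) (D : Matrix (Fin b) (Fin b) R) :
    (blockUpper A B D).map f = blockUpper (A.map f) (B.map f) (D.map f) := by
  simp [blockUpper, ← Matrix.submatrix_map, Matrix.fromBlocks_map]

lemma unitUpper_blockUpper [Ring R] {A : Matrix (Fin a) (Fin a) R}
    {D : Matrix (Fin b) (Fin b) R} (hA : UnitUpper A) (B : Matrix (Fin a) (Fin b) R)
    (hD : UnitUpper D) : UnitUpper (blockUpper A B D) := by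
  refine ⟨fun i => ?_, fun i j => ?_⟩
  · induction i using Fin.addCases <;> simp [blockUpper, hA.1, hD.1]
  · induction i using Fin.addCases with
    | left i => induction j using Fin.addCases with
      | left j =>
        exact fun h => by simpa [blockUpper] using hA.2 i j (Fin.lt_def.2 (Fin.lt_def.1 h))
      | right j => intro h; simp [Fin.lt_def] at h; omega
    | right i => induction j using Fin.addCases with
      | left j => simp [blockUpper]
      | right j => simpa [blockUpper] using hD.2 i j

lemma UnitUpper.exists_blockUpper [Ring R] {P : Matrix (Fin (a + b)) (Fin (a + b)) R}
    (hP : UnitUpper P) : ∃ A B D, UnitUpper A ∧ UnitUpper D ∧ P = blockUpper A B D := by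
  refine ⟨P.submatrix (Fin.castAdd b) (Fin.castAdd b), P.submatrix (Fin.castAdd b) (Fin.natAdd a),
    P.submatrix (Fin.natAdd a) (Fin.natAdd a), ⟨fun i => hP.1 _, fun i j h => hP.2 _ _ ?_⟩,
    ⟨fun i => hP.1 _, fun i j h => hP.2 _ _ ?_⟩, ?_⟩
  · exact Fin.lt_def.2 (Fin.lt_def.1 h)
  · exact Fin.lt_def.2 (Nat.add_lt_add_left (Fin.lt_def.1 h) a)
  · ext i j
    induction i using Fin.addCases with
    | left i => induction j using Fin.addCases <;> simp [blockUpper]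
    | right i => induction j using Fin.addCases with
      | left j => simpa [blockUpper] using hP.2 _ _ (by simp [Fin.lt_def]; omega)
      | right j => simp [blockUpper]

lemma abs_blockUpper_le {A : Matrix (Fin a) (Fin a) ℝ} {B : Matrix (Fin a) (Fin b) ℝ}
    {D : Matrix (Fin b) (Fin b) ℝ} {S : ℝ} (hS : 0 ≤ S) (hA : ∀ i j, |A i j| ≤ S)
    (hB : ∀ i j, |B i j| ≤ S) (hD : ∀ i j, |D i j| ≤ S) (i j : Fin (a + b)) :
    |blockUpper A B D i j| ≤ S := by
  induction i using Fin.addCases <;> induction j using Fin.addCases <;>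
    simp [blockUpper, hA, hB, hD, hS]

end blockUpper

lemma abs_mul_apply_le {l m n : ℕ} {A : Matrix (Fin l) (Fin m) ℝ} {B : Matrix (Fin m) (Fin n) ℝ}
    {s t : ℝ} (hs : 0 ≤ s) (hA : ∀ i j, |A i j| ≤ s) (hB : ∀ i j, |B i j| ≤ t) (i : Fin l)
    (j : Fin n) : |(A * B) i j| ≤ m * (s * t) := by
  rw [Matrix.mul_apply]
  refine (Finset.abs_sum_le_sum_abs _ _).trans ?_
  refine (Finset.sum_le_card_nsmul _ _ (s * t) fun k _ => ?_).trans (by simp)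
  rw [abs_mul]
  exact mul_le_mul (hA _ _) (hB _ _) (abs_nonneg _) hs

/-- Integral column operations make a unipotent matrix and its inverse simultaneously small. -/
lemma UnitUpper.exists_reduced (k : ℕ) : ∀ n ≤ 2 ^ k, ∀ P : Matrix (Fin n) (Fin n) ℝ,
    UnitUpper P → ∃ X Y : Matrix (Fin n) (Fin n) ℤ, ∃ Q R : Matrix (Fin n) (Fin n) ℝ,
      X * Y = 1 ∧ Q = P * X.map (Int.castRingHom ℝ) ∧ Q * R = 1 ∧ UnitUpper Q ∧ UnitUpper R ∧
      (∀ i j, |Q i j| ≤ 2 ^ k ^ 2) ∧ ∀ i j, |R i j| ≤ 2 ^ k ^ 2 := by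
  induction k with
  | zero =>
    intro n hn P hP
    have hP1 : P = 1 := by
      ext i j
      obtain rfl : i = j := Fin.ext (by omega)
      simp [hP.1]
    have h1 : ∀ i j : Fin n, |(1 : Matrix (Fin n) (Fin n) ℝ) i j| ≤ 2 ^ 0 ^ 2 := fun i j => by
      rw [Matrix.one_apply]; split_ifs <;> simp
    subst hP1
    exact ⟨1, 1, 1, 1, by simp, by simp, by simp, hP, hP, h1, h1⟩
  | succ k ih =>
    intro n hn P hP
    obtain ⟨a, b, rfl, ha, hb⟩ : ∃ a b, n = a + b ∧ a ≤ 2 ^ k ∧ b ≤ 2 ^ k :=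
      ⟨n / 2, n - n / 2, by omega, by rw [pow_succ] at hn; omega, by rw [pow_succ] at hn; omega⟩
    obtain ⟨A, B, D, hA, hD, rfl⟩ := hP.exists_blockUpper
    obtain ⟨X₁, Y₁, Q₁, R₁, hXY₁, hQ₁, hQR₁, uQ₁, uR₁, bQ₁, bR₁⟩ := ih a ha A hA
    obtain ⟨X₂, Y₂, Q₂, R₂, hXY₂, hQ₂, hQR₂, uQ₂, uR₂, bQ₂, bR₂⟩ := ih b hb D hD
    let K : Matrix (Fin a) (Fin b) ℝ := R₁ * B * X₂.map (Int.castRingHom ℝ)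
    let Z : Matrix (Fin a) (Fin b) ℤ := K.map fun x => -round x
    let F : Matrix (Fin a) (Fin b) ℝ := Z.map (Int.castRingHom ℝ) + K
    have hF : ∀ i j, |F i j| ≤ 1 := fun i j => by
      have : F i j = K i j - round (K i j) := by simp [F, Z]; ring
      rw [this]
      exact (abs_sub_round _).trans (by norm_num)
    have hpow : (2 : ℝ) ^ k * 2 ^ k ^ 2 ≤ 2 ^ (k + 1) ^ 2 := by
      rw [← pow_add]
      exact pow_le_pow_right₀ one_le_two (by nlinarith)
    have hle : (2 : ℝ) ^ k ^ 2 ≤ 2 ^ (k + 1) ^ 2 :=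
      pow_le_pow_right₀ one_le_two (Nat.pow_le_pow_left (Nat.le_succ k) 2)
    have ha' : (a : ℝ) ≤ 2 ^ k := by exact_mod_cast ha
    have hb' : (b : ℝ) ≤ 2 ^ k := by exact_mod_cast hb
    refine ⟨blockUpper X₁ (X₁ * Z) X₂, blockUpper Y₁ (-(Z * Y₂)) Y₂, blockUpper Q₁ (Q₁ * F) Q₂,
      blockUpper R₁ (-(F * R₂)) R₂, ?_, ?_, ?_, unitUpper_blockUpper uQ₁ _ uQ₂,
      unitUpper_blockUpper uR₁ _ uR₂, abs_blockUpper_le (by positivity) ?_ ?_ ?_,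
      abs_blockUpper_le (by positivity) ?_ ?_ ?_⟩
    · simp [blockUpper_mul, hXY₁, hXY₂, ← blockUpper_one, Matrix.mul_assoc]
    · rw [blockUpper_map, blockUpper_mul, ← hQ₁, ← hQ₂, Matrix.map_mul, ← Matrix.mul_assoc, ← hQ₁]
      congr 1
      simp only [F, K, Matrix.mul_add, ← Matrix.mul_assoc, hQR₁, Matrix.one_mul]
    · simp [blockUpper_mul, hQR₁, hQR₂, ← blockUpper_one, Matrix.mul_assoc]
    · exact fun i j => (bQ₁ i j).trans hle
    · refine fun i j => (abs_mul_apply_le (by positivity) bQ₁ hF i j).trans ?_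
      rw [mul_one]
      exact (mul_le_mul_of_nonneg_right ha' (by positivity)).trans hpow
    · exact fun i j => (bQ₂ i j).trans hle
    · exact fun i j => (bR₁ i j).trans hle
    · refine fun i j => ?_
      rw [Matrix.neg_apply, abs_neg]
      refine (abs_mul_apply_le zero_le_one hF bR₂ i j).trans ?_
      rw [one_mul]
      exact (mul_le_mul_of_nonneg_right hb' (by positivity)).trans hpow
    · exact fun i j => (bR₂ i j).trans hle

/-! ### Rounding a triangular square root -/

lemma abs_sum_le_mul {n : ℕ} {κ c : ℝ} (hn : (n : ℝ) ≤ κ) (hc : 0 ≤ c) {f : Fin n → ℝ}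
    (hf : ∀ a, |f a| ≤ c) : |∑ a, f a| ≤ κ * c := by
  refine (Finset.abs_sum_le_sum_abs _ _).trans
    ((Finset.sum_le_card_nsmul _ _ c fun a _ => hf a).trans ?_)
  simpa using mul_le_mul_of_nonneg_right hn hc

/-- A form `Pᵀ D P` in which `P` and `P⁻¹` are small and the entries of `D` are large and do not
drop quickly is a sum of few squares. -/
lemma repBySquares_of_reduced {n : ℕ} (G : Matrix (Fin n) (Fin n) ℤ)
    {P R : Matrix (Fin n) (Fin n) ℝ} {D : Fin n → ℝ} {κ : ℝ} (hκ : 1 ≤ κ) (hn : (n : ℝ) ≤ κ)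
    (uP : UnitUpper P) (uR : UnitUpper R) (hPR : P * R = 1) (bP : ∀ i j, |P i j| ≤ κ)
    (bR : ∀ i j, |R i j| ≤ κ) (hG : G.map (Int.castRingHom ℝ) = Pᵀ * Matrix.diagonal D * P)
    (hD : ∀ i j, j ≤ i → D j ≤ κ * D i) (hT : ∀ i, 1024 * κ ^ 38 ≤ D i) :
    RepBySquares n (n + (4 * n ^ 2 + 4 * n)) G := by
  have hκ0 : 0 < κ := by linarith
  have hD0 : ∀ i, 0 < D i := fun i => lt_of_lt_of_le (by positivity) (hT i)
  have hD1 : ∀ i, 1 ≤ D i := fun i => by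
    have := one_le_pow₀ hκ (n := 38)
    linarith [hT i]
  obtain ⟨ε, hε⟩ : ∃ ε : ℝ, ε = 1 / (4 * κ ^ 15) := ⟨_, rfl⟩
  have hε0 : 0 < ε := by rw [hε]; positivity
  have hε15 : ε * κ ^ 15 = 1 / 4 := by rw [hε]; field_simp
  have hε6 : ε * κ ^ 6 ≤ 1 / 4 := by
    rw [← hε15]; exact mul_le_mul_of_nonneg_left (pow_le_pow_right₀ hκ (by norm_num)) hε0.le
  have hε4 : ε * κ ^ 4 ≤ 1 / 4 := by
    rw [← hε15]; exact mul_le_mul_of_nonneg_left (pow_le_pow_right₀ hκ (by norm_num)) hε0.le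
  obtain ⟨W, hW⟩ : ∃ W, W = Rᵀ * Matrix.diagonal (fun j => ε * D j) * R := ⟨_, rfl⟩
  have hWapp : ∀ a b, W a b = ∑ j, R j a * (ε * D j) * R j b := fun a b => by
    rw [hW, Matrix.mul_apply]; simp [Matrix.mul_diagonal]
  have hWs : ∀ a b, W a b = W b a := fun a b => by
    rw [hWapp, hWapp]; exact Finset.sum_congr rfl fun j _ => by ring
  have bW : ∀ a b, |W a b| ≤ ε * κ ^ 4 * D a := fun a b => by
    have hDa := hD0 a
    rw [hWapp]
    refine (abs_sum_le_mul hn (c := κ * (ε * (κ * D a)) * κ) (by positivity) fun j => ?_).trans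
      (le_of_eq (by ring))
    rcases lt_or_ge a j with h | h
    · rw [uR.2 _ _ h]; simp; positivity
    · rw [abs_mul, abs_mul, abs_of_pos (mul_pos hε0 (hD0 j))]
      have := hD a j h
      have := hD0 j
      gcongr
      exacts [bR _ _, bR _ _]
  obtain ⟨d, hd⟩ : ∃ d : Fin n → ℝ, ∀ a, d a = D a - W a a := ⟨_, fun _ => rfl⟩
  have hd_lower : ∀ a, D a / 2 ≤ d a := fun a => by
    have := (abs_le.1 (bW a a)).2
    have := mul_le_mul_of_nonneg_right hε4 (hD0 a).le
    rw [hd]; linarith [hD0 a]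
  have hd_upper : ∀ a, d a ≤ 3 / 2 * D a := fun a => by
    have := (abs_le.1 (bW a a)).1
    have := mul_le_mul_of_nonneg_right hε4 (hD0 a).le
    rw [hd]; linarith [hD0 a]
  have hd0 : ∀ a, 0 < d a := fun a => by linarith [hd_lower a, hD0 a]
  obtain ⟨N, hN⟩ : ∃ N : Matrix (Fin n) (Fin n) ℝ, ∀ a b, N a b = if a < b then W a b else 0 :=
    ⟨Matrix.of fun a b => if a < b then W a b else 0, fun _ _ => rfl⟩
  obtain ⟨M, hM⟩ : ∃ M, M = N * P := ⟨_, rfl⟩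
  have M_zero : ∀ a k, k ≤ a → M a k = 0 := fun a k h => by
    rw [hM, Matrix.mul_apply]
    refine Finset.sum_eq_zero fun b _ => ?_
    rw [hN]
    split_ifs with hab
    · rw [uP.2 _ _ (h.trans_lt hab), mul_zero]
    · rw [zero_mul]
  have bM : ∀ a k, |M a k| ≤ ε * κ ^ 6 * D a := fun a k => by
    have hDa := hD0 a
    rw [hM, Matrix.mul_apply]
    refine (abs_sum_le_mul hn (c := ε * κ ^ 4 * D a * κ) (by positivity) fun b => ?_).trans
      (le_of_eq (by ring))
    rw [abs_mul]
    gcongr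
    · rw [hN]
      split_ifs
      · exact bW _ _
      · simp; positivity
    · exact bP _ _
  obtain ⟨C, hC⟩ : ∃ C, C = Matrix.diagonal d * P - M := ⟨_, rfl⟩
  have hCapp : ∀ a k, C a k = d a * P a k - M a k := fun a k => by
    rw [hC]; simp [Matrix.diagonal_mul]
  have bC : ∀ a k, |C a k| ≤ 2 * κ * D a := fun a k => by
    have hDa := hD0 a
    have hda := hd0 a
    have h1 : |d a * P a k| ≤ 3 / 2 * D a * κ := by
      rw [abs_mul, abs_of_pos hda]
      gcongr
      exacts [hd_upper a, bP _ _]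
    have h2 := mul_le_mul_of_nonneg_right hε6 hDa.le
    have h3 := bM a k
    rw [hCapp]
    have := abs_sub (d a * P a k) (M a k)
    nlinarith
  obtain ⟨B, hB⟩ : ∃ B : Matrix (Fin n) (Fin n) ℝ, ∀ a k, B a k = C a k / √(d a) :=
    ⟨Matrix.of fun a k => C a k / √(d a), fun _ _ => rfl⟩
  have B_zero : ∀ a k, k < a → B a k = 0 := fun a k h => by
    rw [hB, hCapp, uP.2 _ _ h, M_zero _ _ h.le]; simp
  have bB : ∀ a k, |B a k| ≤ 3 * κ * √(D a) := fun a k => by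
    have hDa := hD0 a
    refine abs_le_of_sq_le_sq ?_ (by positivity)
    rw [hB, div_pow, mul_pow, Real.sq_sqrt (hd0 a).le, Real.sq_sqrt hDa.le, div_le_iff₀ (hd0 a)]
    have h1 : C a k ^ 2 ≤ (2 * κ * D a) ^ 2 := sq_le_sq' (by linarith [(abs_le.1 (bC a k)).1])
      (abs_le.1 (bC a k)).2
    have h2 : (3 * κ) ^ 2 * D a * (D a / 2) ≤ (3 * κ) ^ 2 * D a * d a :=
      mul_le_mul_of_nonneg_left (hd_lower a) (by positivity)
    nlinarith [sq_nonneg (κ * D a)]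
  obtain ⟨Y, hY⟩ : ∃ Y, Y = Mᵀ * Matrix.diagonal (fun a => (d a)⁻¹) * M := ⟨_, rfl⟩
  have hYapp : ∀ j k, Y j k = ∑ a, M a j * (d a)⁻¹ * M a k := fun a b => by
    rw [hY, Matrix.mul_apply]; simp [Matrix.mul_diagonal]
  have hid : G.map (Int.castRingHom ℝ) = Bᵀ * B + Matrix.diagonal (fun j => ε * D j) - Y := by
    have hBB : Bᵀ * B = Cᵀ * Matrix.diagonal (fun a => (d a)⁻¹) * C := by
      ext j k
      rw [Matrix.mul_apply, Matrix.mul_apply]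
      refine Finset.sum_congr rfl fun a _ => ?_
      rw [Matrix.mul_diagonal, Matrix.transpose_apply, Matrix.transpose_apply, hB, hB]
      have h0 := (hd0 a).ne'
      have h1 : √(d a) ≠ 0 := (Real.sqrt_pos.2 (hd0 a)).ne'
      field_simp
      rw [Real.sq_sqrt (hd0 a).le]
      ring
    have hRP : R * P = 1 := mul_eq_one_comm.1 hPR
    have hdd : Matrix.diagonal d * Matrix.diagonal (fun a => (d a)⁻¹) = 1 := by
      rw [Matrix.diagonal_mul_diagonal, ← Matrix.diagonal_one]
      congr 1; ext a; exact mul_inv_cancel₀ (hd0 a).ne'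
    have hdd' : Matrix.diagonal (fun a => (d a)⁻¹) * Matrix.diagonal d = 1 :=
      mul_eq_one_comm.1 hdd
    have hsplit : Matrix.diagonal D = Matrix.diagonal d - N - Nᵀ + W := by
      ext a b
      simp only [Matrix.add_apply, Matrix.sub_apply, Matrix.transpose_apply, hN]
      rcases lt_trichotomy a b with h | h | h
      · simp [h.ne, h, h.not_gt]
      · subst h; simp [hd]
      · simp [h.ne', h, h.not_gt, hWs a b]
    have hPW : Pᵀ * W * P = Matrix.diagonal (fun j => ε * D j) := by
      have : Pᵀ * W * P = (R * P)ᵀ * Matrix.diagonal (fun j => ε * D j) * (R * P) := by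
        rw [hW, Matrix.transpose_mul]; simp only [Matrix.mul_assoc]
      rw [this, hRP]; simp
    have hCC : Cᵀ * Matrix.diagonal (fun a => (d a)⁻¹) * C =
        Pᵀ * Matrix.diagonal d * P - Pᵀ * M - Mᵀ * P + Y := by
      have h1 : Cᵀ * Matrix.diagonal (fun a => (d a)⁻¹) =
          Pᵀ - Mᵀ * Matrix.diagonal (fun a => (d a)⁻¹) := by
        rw [hC, Matrix.transpose_sub, Matrix.transpose_mul, Matrix.diagonal_transpose,
          Matrix.sub_mul, Matrix.mul_assoc, hdd, Matrix.mul_one]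
      rw [h1, hC, Matrix.sub_mul, Matrix.mul_sub, Matrix.mul_sub, hY,
        ← Matrix.mul_assoc (Mᵀ * _) (Matrix.diagonal d) P, Matrix.mul_assoc Mᵀ, hdd',
        Matrix.mul_one, ← Matrix.mul_assoc]
      abel
    rw [hG, hBB, hCC, hsplit, Matrix.mul_add, Matrix.mul_sub, Matrix.mul_sub, Matrix.add_mul,
      Matrix.sub_mul, Matrix.sub_mul, hPW, hM, Matrix.transpose_mul]
    simp only [Matrix.mul_assoc]
    abel
  let Z : Matrix (Fin n) (Fin n) ℤ := B.map round
  have hGs : ∀ i j, G i j = G j i := fun i j => by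
    have h : (G.map (Int.castRingHom ℝ))ᵀ = G.map (Int.castRingHom ℝ) := by
      rw [hG]; simp [Matrix.transpose_mul, Matrix.mul_assoc]
    have := congrFun (congrFun h j) i
    simpa using this
  let E : Matrix (Fin n) (Fin n) ℤ := G - Zᵀ * Z
  have hErr : ∀ j k, |(E j k : ℝ) - Matrix.diagonal (fun j => ε * D j) j k| ≤
      κ * (2 * ε ^ 2 * κ ^ 13 * D j) + κ * (4 * κ ^ 2 * √(D j)) := by
    intro j k
    have hE1 : (E j k : ℝ) - Matrix.diagonal (fun j => ε * D j) j k =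
        -Y j k + ∑ a, (B a j * B a k - (Z a j : ℝ) * Z a k) := by
      have h1 := congrFun (congrFun hid j) k
      simp only [Matrix.map_apply, Matrix.add_apply, Matrix.sub_apply, Int.coe_castRingHom,
        Matrix.mul_apply, Matrix.transpose_apply] at h1
      simp only [E, Matrix.sub_apply, Matrix.mul_apply, Matrix.transpose_apply, Int.cast_sub,
        Int.cast_sum, Int.cast_mul, h1, Finset.sum_sub_distrib]
      ring
    have hDj := hD0 j
    rw [hE1]
    refine (abs_add_le _ _).trans (add_le_add ?_ ?_)
    · rw [abs_neg, hYapp]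
      refine abs_sum_le_mul hn (by positivity) fun a => ?_
      rcases le_or_gt j a with h | h
      · rw [M_zero _ _ h]; simp; positivity
      · have hDa := hD0 a
        have hda := hd0 a
        rw [abs_mul, abs_mul, abs_of_pos (inv_pos.2 hda)]
        have h2 : (d a)⁻¹ ≤ 2 / D a := by
          rw [inv_le_comm₀ hda (by positivity), inv_div]; exact hd_lower a
        calc |M a j| * (d a)⁻¹ * |M a k|
            ≤ (ε * κ ^ 6 * D a) * (2 / D a) * (ε * κ ^ 6 * D a) := by
              gcongr
              exacts [bM _ _, bM _ _]
          _ = 2 * ε ^ 2 * κ ^ 12 * D a := by field_simp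
          _ ≤ 2 * ε ^ 2 * κ ^ 12 * (κ * D j) :=
              mul_le_mul_of_nonneg_left (hD j a h.le) (by positivity)
          _ = 2 * ε ^ 2 * κ ^ 13 * D j := by ring
    · refine abs_sum_le_mul hn (by positivity) fun a => ?_
      rcases lt_or_ge j a with h | h
      · simp only [Z, Matrix.map_apply, B_zero _ _ h]; simp; positivity
      · have hDa := hD0 a
        have h1 := abs_sub_round (B a j)
        have h2 := abs_sub_round (B a k)
        have h3 : |(round (B a j) : ℝ)| ≤ 3 * κ * √(D a) + 1 / 2 := by
          have := abs_sub_abs_le_abs_sub (round (B a j) : ℝ) (B a j)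
          rw [abs_sub_comm] at this
          linarith [bB a j]
        have h4 : √(D a) ≤ κ * √(D j) := by
          rw [Real.sqrt_le_left (by positivity), mul_pow, Real.sq_sqrt hDj.le]
          have := hD j a h
          nlinarith
        have h5 : 1 ≤ √(D a) := Real.one_le_sqrt.2 (hD1 a)
        have h6 : B a j * B a k - (Z a j : ℝ) * Z a k =
            (B a j - round (B a j)) * B a k + round (B a j) * (B a k - round (B a k)) := by
          simp only [Z, Matrix.map_apply]; ring
        rw [h6]
        refine (abs_add_le _ _).trans ?_
        rw [abs_mul, abs_mul]
        have h7 : |B a j - round (B a j)| * |B a k| ≤ 1 / 2 * (3 * κ * √(D a)) := by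
          gcongr
          exact bB _ _
        have h8 : |(round (B a j) : ℝ)| * |B a k - round (B a k)| ≤
            (3 * κ * √(D a) + 1 / 2) * (1 / 2) := by
          gcongr
        nlinarith
  have hrow : ∀ j, κ * (κ * (2 * ε ^ 2 * κ ^ 13 * D j) + κ * (4 * κ ^ 2 * √(D j))) ≤ ε * D j := by
    intro j
    have hDj := hD0 j
    have h1 : 32 * κ ^ 19 ≤ √(D j) := by
      refine Real.le_sqrt_of_sq_le ((le_of_eq ?_).trans (hT j)); ring
    have h2 : 4 * κ ^ 4 * √(D j) ≤ ε * D j / 2 := by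
      have h3 : ε * κ ^ 15 * (32 * κ ^ 4) * √(D j) ≤ ε * D j := by
        have : D j = √(D j) * √(D j) := (Real.mul_self_sqrt hDj.le).symm
        calc ε * κ ^ 15 * (32 * κ ^ 4) * √(D j) = ε * ((32 * κ ^ 19) * √(D j)) := by ring
          _ ≤ ε * (√(D j) * √(D j)) := by gcongr
          _ = ε * D j := by rw [← this]
      rw [hε15] at h3
      linarith
    have h3 : 2 * ε ^ 2 * κ ^ 15 * D j = ε * D j / 2 := by
      calc 2 * ε ^ 2 * κ ^ 15 * D j = 2 * ε * D j * (ε * κ ^ 15) := by ring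
        _ = _ := by rw [hε15]; ring
    linarith
  have hErep : RepBySquares n (4 * n ^ 2 + 4 * n) E := by
    refine repBySquares_of_diagDominant E (Matrix.IsSymm.ext fun i j => ?_) fun j => ?_
    · simp only [E, Matrix.sub_apply, Matrix.mul_apply, Matrix.transpose_apply, hGs i j]
      congr 1
      exact Finset.sum_congr rfl fun a _ => mul_comm _ _
    · have h1 : ((∑ k ∈ Finset.univ.erase j, |E j k| : ℤ) : ℝ) +
          |(E j j : ℝ) - ε * D j| ≤ ε * D j := by
        have h2 : ((∑ k ∈ Finset.univ.erase j, |E j k| : ℤ) : ℝ) + |(E j j : ℝ) - ε * D j| =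
            ∑ k, |(E j k : ℝ) - Matrix.diagonal (fun j => ε * D j) j k| := by
          rw [← Finset.sum_erase_add _ _ (Finset.mem_univ j)]
          push_cast
          congr 1
          · refine Finset.sum_congr rfl fun k hk => ?_
            rw [Matrix.diagonal_apply_ne _ (Finset.ne_of_mem_erase hk).symm, sub_zero]
          · rw [Matrix.diagonal_apply_eq]
        have hDj := hD0 j
        rw [h2]
        refine (le_abs_self _).trans ((abs_sum_le_mul hn (by positivity) fun k => ?_).trans (hrow j))
        rw [abs_abs]
        exact hErr j k
      have h3 := (abs_le.1 (le_refl |(E j j : ℝ) - ε * D j|)).1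
      have : ((∑ k ∈ Finset.univ.erase j, |E j k| : ℤ) : ℝ) ≤ E j j := by linarith
      exact_mod_cast this
  have hZ : RepBySquares n n (Zᵀ * Z) := ⟨Z, rfl⟩
  simpa [E] using hZ.add hErep

/-! ### Hermite-Korkin-Zolotarev reduction -/

/-- A positive definite form attains its minimum on the nonzero integral vectors. -/
lemma exists_shortest {n : ℕ} (hn : 0 < n) {G : Matrix (Fin n) (Fin n) ℝ}
    (hpos : ∀ x : Fin n → ℝ, x ≠ 0 → 0 < x ⬝ᵥ G *ᵥ x) :
    ∃ v : Fin n → ℤ, v ≠ 0 ∧ ∀ x : Fin n → ℤ, x ≠ 0 →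
      (fun i => (v i : ℝ)) ⬝ᵥ G *ᵥ (fun i => (v i : ℝ)) ≤
        (fun i => (x i : ℝ)) ⬝ᵥ G *ᵥ (fun i => (x i : ℝ)) := by
  have : Nonempty (Fin n) := ⟨⟨0, hn⟩⟩
  let q : (Fin n → ℝ) → ℝ := fun x => x ⬝ᵥ G *ᵥ x
  have hq : Continuous q := by
    simp only [q, dotProduct, Matrix.mulVec]
    fun_prop
  obtain ⟨u, hu, hmin⟩ := (isCompact_sphere (0 : Fin n → ℝ) 1).exists_isMinOn
    (NormedSpace.sphere_nonempty.2 zero_le_one) hq.continuousOn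
  have hu1 : ‖u‖ = 1 := by simpa using hu
  have hqu : 0 < q u := hpos u (by rintro rfl; simp at hu1)
  have hlow : ∀ x, q u * ‖x‖ ^ 2 ≤ q x := fun x => by
    rcases eq_or_ne x 0 with rfl | hx
    · simp [q]
    · have hx0 : ‖x‖ ≠ 0 := norm_ne_zero_iff.2 hx
      have h1 : q u ≤ q (‖x‖⁻¹ • x) := hmin (by simp [norm_smul, hx0])
      have h2 : q (‖x‖⁻¹ • x) = (‖x‖ ^ 2)⁻¹ * q x := by
        simp [q, Matrix.mulVec_smul, sq, mul_assoc]
      rw [h2] at h1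
      calc q u * ‖x‖ ^ 2 ≤ (‖x‖ ^ 2)⁻¹ * q x * ‖x‖ ^ 2 := by gcongr
        _ = q x := by field_simp
  let c : (Fin n → ℤ) → Fin n → ℝ := fun x i => (x i : ℝ)
  let w : Fin n → ℤ := Pi.single ⟨0, hn⟩ 1
  have hw : w ≠ 0 := by simp [w]
  let S : Set (Fin n → ℤ) := {x | x ≠ 0 ∧ q (c x) ≤ q (c w)}
  have hfin : S.Finite := by
    obtain ⟨K, hK⟩ := exists_nat_ge (q (c w) / q u + 1)
    refine (Set.finite_Icc (fun _ => -(K : ℤ)) (fun _ => (K : ℤ))).subset fun x hx => ?_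
    have h1 : q u * ‖c x‖ ^ 2 ≤ q (c w) := (hlow _).trans hx.2
    have h2 : ‖c x‖ ^ 2 ≤ q (c w) / q u := by rw [le_div_iff₀ hqu]; linarith
    have h3 : ‖c x‖ ≤ K := by nlinarith [sq_nonneg (‖c x‖ - 1)]
    have h4 : ∀ i, |x i| ≤ (K : ℤ) := fun i => by
      have : |(x i : ℝ)| ≤ K := (norm_le_pi_norm (c x) i).trans h3
      exact_mod_cast this
    exact ⟨fun i => (abs_le.1 (h4 i)).1, fun i => (abs_le.1 (h4 i)).2⟩
  obtain ⟨v, hv, hvmin⟩ := S.exists_min_image (fun x => q (c x)) hfin ⟨w, hw, le_rfl⟩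
  refine ⟨v, hv.1, fun x hx => ?_⟩
  rcases le_total (q (c x)) (q (c w)) with h | h
  · exact hvmin x ⟨hx, h⟩
  · exact hv.2.trans h

/-- Every nonzero integral vector is an integral multiple of the first column of a unimodular
matrix. -/
lemma exists_unimodular_smul_col {n : ℕ} [NeZero n] {v : Fin n → ℤ} (hv : v ≠ 0) :
    ∃ X Y : Matrix (Fin n) (Fin n) ℤ, X * Y = 1 ∧ ∃ k : ℤ, v = k • fun i => X i 0 := by
  obtain ⟨m, s⟩ := (ℤ ∙ v).smithNormalForm (Pi.basisFun ℤ (Fin n))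
  obtain rfl : m = 1 := by
    have h1 := (LinearEquiv.toSpanNonzeroSingleton ℤ (Fin n → ℤ) v hv).finrank_eq
    have h2 := Module.finrank_eq_card_basis s.bN
    rw [← h1] at h2
    simpa using h2.symm
  let b := s.bM.reindex (Equiv.swap (s.f 0) 0)
  refine ⟨(Pi.basisFun ℤ (Fin n)).toMatrix b, b.toMatrix (Pi.basisFun ℤ (Fin n)),
    Module.Basis.toMatrix_mul_toMatrix_flip _ _, ?_⟩
  let v' : ℤ ∙ v := ⟨v, Submodule.mem_span_singleton_self v⟩
  refine ⟨s.bN.repr v' 0 * s.a 0, ?_⟩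
  have h := congrArg (Subtype.val) (s.bN.sum_repr v')
  rw [Fin.sum_univ_one, Submodule.coe_smul, s.snf] at h
  rw [mul_smul]
  refine h.symm.trans ?_
  congr 2
  ext i
  simp [b, Module.Basis.toMatrix_apply]

lemma dotProduct_transpose_mul_mul {n : ℕ} {S : Type*} [CommRing S] (A G : Matrix (Fin n) (Fin n) S)
    (x : Fin n → S) :
    x ⬝ᵥ (Aᵀ * G * A) *ᵥ x = (A *ᵥ x) ⬝ᵥ G *ᵥ (A *ᵥ x) := by
  rw [← Matrix.mulVec_mulVec, ← Matrix.mulVec_mulVec, Matrix.dotProduct_mulVec,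
    Matrix.vecMul_transpose]

lemma dotProduct_transpose_diagonal_mul {n : ℕ} (P : Matrix (Fin n) (Fin n) ℝ) (D x : Fin n → ℝ) :
    x ⬝ᵥ (Pᵀ * Matrix.diagonal D * P) *ᵥ x = ∑ l, D l * (P *ᵥ x) l ^ 2 := by
  rw [dotProduct_transpose_mul_mul]
  simp only [dotProduct, Matrix.mulVec_diagonal]
  exact Finset.sum_congr rfl fun l _ => by ring

lemma mulVec_intCast {m n : ℕ} (X : Matrix (Fin m) (Fin n) ℤ) (x : Fin n → ℤ) :
    X.map (Int.castRingHom ℝ) *ᵥ (fun i => (x i : ℝ)) = fun i => ((X *ᵥ x) i : ℝ) := by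
  ext i; simp [Matrix.mulVec, dotProduct]

lemma blockUpper_transpose_mul_mul {a b : ℕ} (A A' : Matrix (Fin a) (Fin a) ℝ)
    (D D' : Matrix (Fin b) (Fin b) ℝ) :
    (blockUpper A 0 D)ᵀ * blockUpper A' 0 D' * blockUpper A 0 D =
      blockUpper (Aᵀ * A' * A) 0 (Dᵀ * D' * D) := by
  simp [blockUpper, Matrix.transpose_submatrix, Matrix.fromBlocks_transpose,
    Matrix.submatrix_mul_equiv, Matrix.fromBlocks_multiply]

/-- Completing the square in the first variable. -/
lemma exists_schur {n : ℕ} {G : Matrix (Fin (1 + n)) (Fin (1 + n)) ℝ} (hG : G.IsSymm)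
    (ha : G 0 0 ≠ 0) : ∃ (c : Matrix (Fin 1) (Fin n) ℝ) (G' : Matrix (Fin n) (Fin n) ℝ),
      G'.IsSymm ∧ G = (blockUpper 1 c 1)ᵀ * blockUpper (Matrix.diagonal fun _ => G 0 0) 0 G' *
        blockUpper 1 c 1 := by
  have hs : ∀ i j, G i j = G j i := fun i j => hG.apply j i
  refine ⟨Matrix.of fun _ j => G 0 (Fin.natAdd 1 j) / G 0 0,
    Matrix.of fun i j => G (Fin.natAdd 1 i) (Fin.natAdd 1 j) -
      G 0 (Fin.natAdd 1 i) * G 0 (Fin.natAdd 1 j) / G 0 0, ?_, ?_⟩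
  · ext i j
    simp [hs (Fin.natAdd 1 i), mul_comm]
  · simp only [blockUpper, Matrix.transpose_submatrix, Matrix.fromBlocks_transpose,
      Matrix.submatrix_mul_equiv, Matrix.fromBlocks_multiply]
    have h0 : ∀ i : Fin 1, Fin.castAdd n i = 0 := fun i => by ext; simp
    ext i j
    induction i using Fin.addCases with
    | left i => induction j using Fin.addCases with
      | left j =>
        obtain rfl := Subsingleton.elim i j
        simp
        simp [h0]
      | right j => simp; simp [h0]; field_simp
    | right i => induction j using Fin.addCases with
      | left j => simp; simp [h0, hs _ 0]; field_simp
      | right j => simp [Matrix.mul_apply]; field_simp; ring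

/-- Hermite-Korkin-Zolotarev reduction: in a suitable basis every Gram-Schmidt norm is the
minimum of the corresponding projected lattice. -/
lemma exists_hkz (n : ℕ) : ∀ G : Matrix (Fin n) (Fin n) ℝ, G.IsSymm →
    (∀ x : Fin n → ℝ, x ≠ 0 → 0 < x ⬝ᵥ G *ᵥ x) →
    ∃ X Y : Matrix (Fin n) (Fin n) ℤ, ∃ (P : Matrix (Fin n) (Fin n) ℝ) (D : Fin n → ℝ),
      X * Y = 1 ∧ UnitUpper P ∧ (∀ i, 0 < D i) ∧
      (X.map (Int.castRingHom ℝ))ᵀ * G * X.map (Int.castRingHom ℝ) =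
        Pᵀ * Matrix.diagonal D * P ∧
      ∀ (j : Fin n) (x : Fin n → ℤ), (∃ l, j ≤ l ∧ x l ≠ 0) →
        D j ≤ ∑ l, if j ≤ l then D l * (P *ᵥ fun i => (x i : ℝ)) l ^ 2 else 0 := by
  induction n with
  | zero =>
    intro G _ _
    exact ⟨1, 1, 1, 0, by simp, ⟨fun i => i.elim0, fun i => i.elim0⟩, fun i => i.elim0,
      by ext i; exact i.elim0, fun i => i.elim0⟩
  | succ n ih =>
    rw [add_comm n 1]
    intro G hG hpos
    obtain ⟨v, hv, hmin⟩ := exists_shortest (by omega) hpos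
    obtain ⟨X, Y, hXY, k, hk⟩ := exists_unimodular_smul_col hv
    let Xr := X.map (Int.castRingHom ℝ)
    let Yr := Y.map (Int.castRingHom ℝ)
    have hYXr : Yr * Xr = 1 := by
      rw [← Matrix.map_mul, mul_eq_one_comm.1 hXY, Matrix.map_one _ (map_zero _) (map_one _)]
    let G₁ := Xrᵀ * G * Xr
    have hinj : ∀ x, Xr *ᵥ x = 0 → x = 0 := fun x hx => by
      have : Yr *ᵥ (Xr *ᵥ x) = x := by rw [Matrix.mulVec_mulVec, hYXr, Matrix.one_mulVec]
      rw [← this, hx, Matrix.mulVec_zero]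
    have hpos₁ : ∀ x, x ≠ 0 → 0 < x ⬝ᵥ G₁ *ᵥ x := fun x hx => by
      rw [dotProduct_transpose_mul_mul]
      exact hpos _ fun h => hx (hinj x h)
    have hG₁ : G₁.IsSymm := by
      simp only [G₁, Matrix.IsSymm, Matrix.transpose_mul, Matrix.transpose_transpose, hG.eq,
        Matrix.mul_assoc]
    have h00 : ∀ H : Matrix (Fin (1 + n)) (Fin (1 + n)) ℝ,
        (Pi.single 0 1 : Fin (1 + n) → ℝ) ⬝ᵥ H *ᵥ Pi.single 0 1 = H 0 0 := fun H => by
      simp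
    have ha : 0 < G₁ 0 0 := by
      rw [← h00 G₁]; exact hpos₁ _ (by simp)
    have hamin : ∀ x : Fin (1 + n) → ℤ, x ≠ 0 →
        G₁ 0 0 ≤ (fun i => (x i : ℝ)) ⬝ᵥ G *ᵥ fun i => (x i : ℝ) := by
      intro x hx
      refine le_trans ?_ (hmin x hx)
      have hk0 : k ≠ 0 := by rintro rfl; simp at hk; exact hv hk
      have hv' : (fun i => (v i : ℝ)) = (k : ℝ) • (Xr *ᵥ Pi.single 0 1) := by
        ext i; simp [hk, Xr]
      have h1 : (fun i => (v i : ℝ)) ⬝ᵥ G *ᵥ (fun i => (v i : ℝ)) = (k : ℝ) ^ 2 * G₁ 0 0 := by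
        rw [hv', ← h00 G₁, dotProduct_transpose_mul_mul]
        simp only [Matrix.mulVec_smul, smul_dotProduct, dotProduct_smul, smul_eq_mul]
        ring
      rw [h1]
      have h2 : (1 : ℝ) ≤ (k : ℝ) ^ 2 := by
        exact_mod_cast (Int.one_le_abs hk0).trans (by rw [← sq_abs]; nlinarith [Int.one_le_abs hk0])
      nlinarith
    obtain ⟨c, G', hG', hdec⟩ := exists_schur hG₁ ha.ne'
    have hpos' : ∀ y, y ≠ 0 → 0 < y ⬝ᵥ G' *ᵥ y := by
      intro y hy
      let z : Fin (1 + n) → ℝ := Fin.addCases 0 y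
      have h1 : blockUpper 1 c 1 *ᵥ (blockUpper 1 (-c) 1 *ᵥ z) = z := by
        rw [Matrix.mulVec_mulVec, blockUpper_mul]
        simp [blockUpper_one]
      have h2 : z ⬝ᵥ blockUpper (Matrix.diagonal fun _ => G₁ 0 0) 0 G' *ᵥ z = y ⬝ᵥ G' *ᵥ y := by
        simp [z, dotProduct, Matrix.mulVec, Fin.sum_univ_add, blockUpper]
      rw [← h2, ← h1, ← dotProduct_transpose_mul_mul, ← hdec]
      refine hpos₁ _ fun h => hy ?_
      rw [h, Matrix.mulVec_zero] at h1
      ext i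
      simpa [z] using (congrFun h1 (Fin.natAdd 1 i)).symm
    obtain ⟨X', Y', P', D', hXY', uP', hD', hdec', hmin'⟩ := ih G' hG' hpos'
    let D : Fin (1 + n) → ℝ := Fin.addCases (fun _ => G₁ 0 0) D'
    let Xr' := X'.map (Int.castRingHom ℝ)
    let P : Matrix (Fin (1 + n)) (Fin (1 + n)) ℝ := blockUpper 1 (c * Xr') P'
    let V := X * blockUpper 1 0 X'
    have hVW : V * (blockUpper 1 0 Y' * Y) = 1 := by
      have : blockUpper (1 : Matrix (Fin 1) (Fin 1) ℤ) 0 X' * blockUpper 1 0 Y' = 1 := by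
        simp [blockUpper_mul, hXY', blockUpper_one]
      rw [Matrix.mul_assoc, ← Matrix.mul_assoc _ _ Y, this, Matrix.one_mul, hXY]
    have hV : (V.map (Int.castRingHom ℝ))ᵀ * G * V.map (Int.castRingHom ℝ) =
        Pᵀ * Matrix.diagonal D * P := by
      have h1 : V.map (Int.castRingHom ℝ) = Xr * blockUpper 1 0 Xr' := by
        rw [Matrix.map_mul, blockUpper_map, Matrix.map_one _ (map_zero _) (map_one _),
          Matrix.map_zero _ (map_zero _)]
      have hdiag : Matrix.diagonal D =
          blockUpper (Matrix.diagonal fun _ => G₁ 0 0) 0 (Matrix.diagonal D') := by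
        ext i j
        induction i using Fin.addCases <;> induction j using Fin.addCases <;>
          simp [D, blockUpper, Matrix.diagonal_apply, Fin.ext_iff]
        all_goals omega
      have h2 : blockUpper 1 c 1 * blockUpper 1 0 Xr' =
          blockUpper 1 0 Xr' * blockUpper 1 (c * Xr') 1 := by
        simp [blockUpper_mul]
      have h3 : P = blockUpper 1 0 P' * blockUpper 1 (c * Xr') 1 := by
        simp [P, blockUpper_mul]
      calc (V.map (Int.castRingHom ℝ))ᵀ * G * V.map (Int.castRingHom ℝ)
          = (blockUpper 1 0 Xr')ᵀ * G₁ * blockUpper 1 0 Xr' := by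
            rw [h1]; simp only [G₁, Matrix.transpose_mul, Matrix.mul_assoc]
        _ = (blockUpper 1 c 1 * blockUpper 1 0 Xr')ᵀ *
              blockUpper (Matrix.diagonal fun _ => G₁ 0 0) 0 G' *
              (blockUpper 1 c 1 * blockUpper 1 0 Xr') := by
            conv_lhs => rw [hdec]
            simp only [Matrix.transpose_mul, Matrix.mul_assoc]
        _ = (blockUpper 1 (c * Xr') 1)ᵀ * ((blockUpper 1 0 Xr')ᵀ *
              blockUpper (Matrix.diagonal fun _ => G₁ 0 0) 0 G' * blockUpper 1 0 Xr') *
              blockUpper 1 (c * Xr') 1 := by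
            rw [h2]; simp only [Matrix.transpose_mul, Matrix.mul_assoc]
        _ = (blockUpper 1 (c * Xr') 1)ᵀ * ((blockUpper 1 0 P')ᵀ * Matrix.diagonal D *
              blockUpper 1 0 P') * blockUpper 1 (c * Xr') 1 := by
            rw [hdiag, blockUpper_transpose_mul_mul, blockUpper_transpose_mul_mul, hdec']
        _ = Pᵀ * Matrix.diagonal D * P := by
            rw [h3]; simp only [Matrix.transpose_mul, Matrix.mul_assoc]
    refine ⟨V, blockUpper 1 0 Y' * Y, P, D, hVW,
      unitUpper_blockUpper ⟨fun i => by simp, fun i j h => by omega⟩ _ uP', fun i => ?_, hV,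
      fun j x hx => ?_⟩
    · induction i using Fin.addCases <;> simp [D, ha, hD']
    · induction j using Fin.addCases with
      | left j =>
        have hj : ∀ l, Fin.castAdd n j ≤ l := fun l => by simp [Fin.le_def]
        simp only [hj, if_true]
        rw [← dotProduct_transpose_diagonal_mul, ← hV, dotProduct_transpose_mul_mul,
          mulVec_intCast]
        have hDj : D (Fin.castAdd n j) = G₁ 0 0 := by simp [D]
        rw [hDj]
        refine hamin _ fun h => ?_
        obtain ⟨l, -, hl⟩ := hx
        have : (blockUpper 1 0 Y' * Y) *ᵥ (V *ᵥ x) = x := by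
          rw [Matrix.mulVec_mulVec, mul_eq_one_comm.1 hVW, Matrix.one_mulVec]
        rw [h, Matrix.mulVec_zero] at this
        exact hl (by rw [← this]; rfl)
      | right j =>
        have hP : ∀ l, (P *ᵥ fun i => (x i : ℝ)) (Fin.natAdd 1 l) =
            (P' *ᵥ fun i => (x (Fin.natAdd 1 i) : ℝ)) l := fun l => by
          simp [P, Matrix.mulVec, dotProduct, Fin.sum_univ_add, blockUpper]
        obtain ⟨l, hl, hxl⟩ := hx
        rw [Fin.sum_univ_add]
        have := hmin' j (fun i => x (Fin.natAdd 1 i)) (by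
          induction l using Fin.addCases with
          | left l => simp [Fin.le_def] at hl
          | right l => exact ⟨l, by simpa only [Fin.le_def, Fin.val_natAdd, Nat.add_le_add_iff_left] using hl, hxl⟩)
        have hc : ∀ i : Fin 1, ¬ Fin.natAdd 1 j ≤ Fin.castAdd n i := fun i => by
          simp [Fin.le_def]
        simpa [hP, D, hc] using this

/-! ### Minkowski's theorem and the decay of reduced bases -/

/-- Minkowski's bound for the minimum of a form of determinant `(det M) ^ 2`. -/
lemma pow_le_of_le_sum_sq {m : ℕ} (hm : 0 < m) {M : Matrix (Fin m) (Fin m) ℝ} (hM : 0 < M.det)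
    {a : ℝ} (ha : 0 ≤ a)
    (hmin : ∀ x : Fin m → ℤ, x ≠ 0 → a ≤ ∑ i, (M *ᵥ fun j => (x j : ℝ)) i ^ 2) :
    a ^ m ≤ (m : ℝ) ^ m * M.det ^ 2 := by
  have : NeZero m := ⟨hm.ne'⟩
  have : Nonempty (Fin m) := ⟨0⟩
  let t : ℝ := M.det ^ (m : ℝ)⁻¹
  have ht : 0 < t := Real.rpow_pos_of_pos hM _
  have htm : t ^ m = M.det := Real.rpow_inv_natCast_pow hM.le hm.ne'
  let f := Matrix.toLin' M
  have hf : LinearMap.det f ≠ 0 := by simpa [f] using hM.ne'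
  let b := Pi.basisFun ℝ (Fin m)
  let s : Set (Fin m → ℝ) := f ⁻¹' Metric.closedBall 0 t
  have hcpt : IsCompact s :=
    (f.equivOfDetNeZero hf).toContinuousLinearEquiv.toHomeomorph.isCompact_preimage.2
      (isCompact_closedBall 0 t)
  have hvol : MeasureTheory.volume (ZSpan.fundamentalDomain b) *
      2 ^ Module.finrank ℝ (Fin m → ℝ) ≤ MeasureTheory.volume s := by
    rw [MeasureTheory.Measure.addHaar_preimage_linearMap _ hf,
      Real.volume_pi_closedBall _ ht.le, ← ENNReal.ofReal_mul (abs_nonneg _),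
      ZSpan.fundamentalDomain_pi_basisFun, MeasureTheory.volume_pi_pi]
    have h1 : |(LinearMap.det f)⁻¹| * (2 * t) ^ Fintype.card (Fin m) = 2 ^ m := by
      simp only [f, LinearMap.det_toLin', Fintype.card_fin, mul_pow, htm]
      rw [abs_of_pos (inv_pos.2 hM)]
      field_simp
    rw [h1]
    simp [ENNReal.ofReal_pow]
  have : DiscreteTopology (Submodule.span ℤ (Set.range b)).toAddSubgroup :=
    inferInstanceAs (DiscreteTopology (Submodule.span ℤ (Set.range b)))
  have : Countable (Submodule.span ℤ (Set.range b)).toAddSubgroup :=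
    inferInstanceAs (Countable (Submodule.span ℤ (Set.range b)))
  obtain ⟨⟨x, hx⟩, hx0, hxs⟩ :=
    MeasureTheory.exists_ne_zero_mem_lattice_of_measure_mul_two_pow_le_measure
      (ZSpan.isAddFundamentalDomain' b MeasureTheory.volume) (s := s)
      (fun x hx => by simpa [s] using hx)
      ((convex_closedBall 0 t).linear_preimage f) hcpt hvol
  obtain ⟨z, hz⟩ := Classical.skolem.1 ((b.mem_span_iff_repr_mem ℤ x).1 hx)
  have hzx : (fun j => (z j : ℝ)) = x := by
    ext j
    simpa [b] using hz j
  have h1 := hmin z (by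
    rintro rfl
    refine hx0 (Subtype.ext ?_)
    change x = 0
    rw [← hzx]; ext; simp)
  rw [hzx] at h1
  have h2 : ∀ i, (M *ᵥ x) i ^ 2 ≤ t ^ 2 := fun i => by
    have h3 : ‖M *ᵥ x‖ ≤ t := by simpa [s, f] using hxs
    exact sq_le_sq' (abs_le.1 ((norm_le_pi_norm _ i).trans h3)).1
      (abs_le.1 ((norm_le_pi_norm _ i).trans h3)).2
  have h3 : a ≤ m * t ^ 2 := by
    refine h1.trans ((Finset.sum_le_sum fun i _ => h2 i).trans ?_)
    simp
  calc a ^ m ≤ (m * t ^ 2) ^ m := by gcongr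
    _ = (m : ℝ) ^ m * M.det ^ 2 := by rw [mul_pow, ← pow_mul, mul_comm 2, pow_mul, htm]

/-- Minkowski's bound for the intervals of a Hermite-Korkin-Zolotarev reduced basis. -/
lemma hkz_pow_le {n : ℕ} {P : Matrix (Fin n) (Fin n) ℝ} {D : Fin n → ℝ} (uP : UnitUpper P)
    (hD : ∀ i, 0 < D i) {j m : ℕ} (hm : 0 < m) (hjm : j + m ≤ n)
    (hmin : ∀ x : Fin n → ℤ, (∃ l : Fin n, j ≤ l ∧ x l ≠ 0) →
      D ⟨j, by omega⟩ ≤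
        ∑ l : Fin n, if j ≤ l then D l * (P *ᵥ fun i => (x i : ℝ)) l ^ 2 else 0) :
    D ⟨j, by omega⟩ ^ m ≤ (m : ℝ) ^ m * ∏ k : Fin m, D ⟨j + k, by omega⟩ := by
  let f : Fin m → Fin n := fun k => ⟨j + k, by omega⟩
  have hf : Function.Injective f := fun k l h => by simpa [f, Fin.ext_iff] using h
  let M : Matrix (Fin m) (Fin m) ℝ :=
    Matrix.of fun k l => √(D (f k)) * P (f k) (f l)
  have hdet : M.det = ∏ k, √(D (f k)) := by
    rw [Matrix.det_of_isUpperTriangular]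
    · simp [M, uP.1]
    · intro k l hkl
      have h : f l < f k := Nat.add_lt_add_left hkl j
      simp only [M, Matrix.of_apply, uP.2 _ _ h, mul_zero]
  have hdet2 : M.det ^ 2 = ∏ k, D (f k) := by
    rw [hdet, ← Finset.prod_pow]
    exact Finset.prod_congr rfl fun k _ => Real.sq_sqrt (hD _).le
  rw [← hdet2]
  refine pow_le_of_le_sum_sq hm (hdet ▸ Finset.prod_pos fun k _ => Real.sqrt_pos.2 (hD _))
    (hD _).le fun x hx => ?_
  obtain ⟨k, hk⟩ := Function.ne_iff.1 hx
  let y : Fin n → ℤ := Function.extend f x 0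
  have hy : ∀ l, y (f l) = x l := fun l => hf.extend_apply _ _ _
  have hy0 : ∀ l, (¬ ∃ a, f a = l) → y l = 0 := fun l h => Function.extend_apply' _ _ _ h
  have hsum : ∀ l, (P *ᵥ fun i => (y i : ℝ)) l = ∑ a, P l (f a) * x a := fun l => by
    refine (Finset.sum_of_injOn f hf.injOn (fun _ _ => Finset.mem_univ _) (fun i _ hi => ?_)
      fun a _ => by simp only [hy]).symm
    simp [hy0 i (by simpa using hi)]
  refine (hmin y ⟨f k, by simp [f], by rw [hy]; exact hk⟩).trans (le_of_eq ?_)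
  refine (Finset.sum_of_injOn f hf.injOn (fun _ _ => Finset.mem_univ _) (fun l _ hl => ?_)
    fun a _ => ?_).symm
  · split_ifs with hjl
    · have hml : j + m ≤ l := by
        by_contra! h
        exact hl ⟨⟨l - j, by omega⟩, by simp, Fin.ext (by simp [f]; omega)⟩
      have h0 : (P *ᵥ fun i => (y i : ℝ)) l = 0 := by
        rw [hsum]
        refine Finset.sum_eq_zero fun a _ => ?_
        rw [uP.2 l (f a) (Fin.lt_def.2 (by simp only [f]; omega)), zero_mul]
      rw [h0]
      simp
    · rfl
  · have h1 : (M *ᵥ fun j => (x j : ℝ)) a = √(D (f a)) * (P *ᵥ fun i => (y i : ℝ)) (f a) := by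
      rw [hsum]
      simp only [M, Matrix.mulVec, dotProduct, Matrix.of_apply, Finset.mul_sum, mul_assoc]
    rw [if_pos (by simp [f]), h1, mul_pow, Real.sq_sqrt (hD _).le]

lemma mul_log_two_add_le {t : ℕ} (ht : 0 < t) :
    (t + 1) + ∑ s ∈ Finset.range t, 3 * Nat.log 2 (s + 1) ≤ t * (3 * Nat.log 2 (t + 1)) := by
  have h1 : ∀ s ∈ Finset.range t,
      3 * Nat.log 2 (s + 1) + (if s < (t + 1) / 2 then 3 else 0) ≤ 3 * Nat.log 2 (t + 1) := by
    intro s hs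
    have hs := Finset.mem_range.1 hs
    split_ifs with h
    · have h2 : Nat.log 2 (s + 1) + 1 ≤ Nat.log 2 (t + 1) := by
        rw [← Nat.log_mul_base (by norm_num) (by omega)]
        exact Nat.log_mono_right (by omega)
      omega
    · have := Nat.log_mono_right (b := 2) (show s + 1 ≤ t + 1 by omega)
      omega
  have h2 := Finset.sum_le_sum h1
  have h3 : ∑ s ∈ Finset.range t, (if s < (t + 1) / 2 then 3 else 0) = 3 * ((t + 1) / 2) := by
    rw [← Finset.sum_filter]
    have : (Finset.range t).filter (fun s => s < (t + 1) / 2) = Finset.range ((t + 1) / 2) := by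
      ext s
      simp only [Finset.mem_filter, Finset.mem_range]
      omega
    rw [this]
    simp [mul_comm]
  rw [Finset.sum_add_distrib, h3] at h2
  simp only [Finset.sum_const, Finset.card_range, smul_eq_mul] at h2
  omega

/-- A sequence in which every term is controlled by the geometric mean of the intervals starting
at it decays slowly. -/
lemma le_pow_mul_of_prod_le {N i : ℕ} {b : ℕ → ℝ} (hb : ∀ l, 0 < b l) (hN : i + 1 ≤ N)
    (h : ∀ j m, 0 < m → j + m ≤ i + 1 →
      b j ^ m ≤ (m : ℝ) ^ m * ∏ k ∈ Finset.range m, b (j + k)) (t : ℕ) (ht : t ≤ i) :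
    b (i - t) ≤ (N : ℝ) ^ (3 * Nat.log 2 (t + 1)) * b i := by
  induction t using Nat.strong_induction_on with
  | _ t ih =>
    rcases Nat.eq_zero_or_pos t with rfl | ht0
    · simp
    have hN1 : (1 : ℝ) ≤ N := by exact_mod_cast (by omega : 1 ≤ N)
    have h1 := h (i - t) (t + 1) (by omega) (by omega)
    rw [Finset.prod_range_succ', pow_succ, Nat.add_zero, ← mul_assoc] at h1
    have h2 := le_of_mul_le_mul_right h1 (hb _)
    have h3 : ∏ k ∈ Finset.range t, b (i - t + (k + 1)) = ∏ s ∈ Finset.range t, b (i - s) := by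
      rw [← Finset.prod_range_reflect]
      refine Finset.prod_congr rfl fun s hs => congrArg b ?_
      have := Finset.mem_range.1 hs
      omega
    rw [h3] at h2
    refine le_of_pow_le_pow_left₀ ht0.ne' (by have := hb i; positivity) (h2.trans ?_)
    have h4 : ∏ s ∈ Finset.range t, b (i - s) ≤
        (N : ℝ) ^ (∑ s ∈ Finset.range t, 3 * Nat.log 2 (s + 1)) * b i ^ t := by
      calc ∏ s ∈ Finset.range t, b (i - s)
          ≤ ∏ s ∈ Finset.range t, ((N : ℝ) ^ (3 * Nat.log 2 (s + 1)) * b i) :=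
            Finset.prod_le_prod (fun s _ => (hb _).le) fun s hs => by
              have := Finset.mem_range.1 hs
              exact ih s this (by omega)
        _ = _ := by rw [Finset.prod_mul_distrib, Finset.prod_pow_eq_pow_sum]; simp
    have h5 : (((t + 1 : ℕ) : ℝ)) ^ (t + 1) ≤ (N : ℝ) ^ (t + 1) := by
      gcongr
      omega
    calc ((t + 1 : ℕ) : ℝ) ^ (t + 1) * ∏ s ∈ Finset.range t, b (i - s)
        ≤ (N : ℝ) ^ (t + 1) *
            ((N : ℝ) ^ (∑ s ∈ Finset.range t, 3 * Nat.log 2 (s + 1)) * b i ^ t) := by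
          gcongr
          exact Finset.prod_nonneg fun s _ => (hb _).le
      _ = (N : ℝ) ^ ((t + 1) + ∑ s ∈ Finset.range t, 3 * Nat.log 2 (s + 1)) * b i ^ t := by ring
      _ ≤ (N : ℝ) ^ (t * (3 * Nat.log 2 (t + 1))) * b i ^ t := by
          have := (hb i).le
          gcongr
          exact mul_log_two_add_le ht0
      _ = _ := by rw [mul_pow, ← pow_mul, mul_comm t]

/-- The Gram-Schmidt norms of a Hermite-Korkin-Zolotarev reduced basis decay slowly. -/
lemma hkz_le_pow_mul {n N : ℕ} (hn : n ≤ N) {P : Matrix (Fin n) (Fin n) ℝ} {D : Fin n → ℝ}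
    (uP : UnitUpper P) (hD : ∀ i, 0 < D i)
    (hmin : ∀ (j : Fin n) (x : Fin n → ℤ), (∃ l, j ≤ l ∧ x l ≠ 0) →
      D j ≤ ∑ l, if j ≤ l then D l * (P *ᵥ fun i => (x i : ℝ)) l ^ 2 else 0)
    {i j : Fin n} (hji : j ≤ i) : D j ≤ (N : ℝ) ^ (3 * Nat.log 2 N) * D i := by
  let b : ℕ → ℝ := fun l => if h : l < n then D ⟨l, h⟩ else 1
  have hbD : ∀ l (h : l < n), b l = D ⟨l, h⟩ := fun l h => dif_pos h
  have hb : ∀ l, 0 < b l := fun l => by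
    simp only [b]; split_ifs; exacts [hD _, one_pos]
  have key := le_pow_mul_of_prod_le (N := N) (i := i) hb (i.2.trans_le hn) (fun j m hm hjm => by
    rw [hbD j (by omega), Finset.prod_range]
    refine (hkz_pow_le (j := j) uP hD hm (by omega) (hmin ⟨j, by omega⟩)).trans (le_of_eq ?_)
    congr 1
    exact Finset.prod_congr rfl fun k _ => (hbD _ _).symm) (i - j) (Nat.sub_le _ _)
  have hij : (i : ℕ) - (i - j) = j := Nat.sub_sub_self hji
  rw [hij, hbD _ j.2, hbD _ i.2] at key
  refine key.trans ?_
  have := (hD i).le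
  gcongr
  · exact_mod_cast (by omega : 1 ≤ N)
  · omega

/-! ### Sums of squares of large minimum -/

/-- A sum of squares that is positive on integral vectors is positive definite. -/
lemma dotProduct_transpose_mul_self_pos {n r : ℕ} (A : Matrix (Fin r) (Fin n) ℤ)
    (hA : ∀ x : Fin n → ℤ, x ≠ 0 → 0 < x ⬝ᵥ (Aᵀ * A) *ᵥ x) {x : Fin n → ℝ} (hx : x ≠ 0) :
    0 < x ⬝ᵥ (Aᵀ * A).map (Int.castRingHom ℝ) *ᵥ x := by
  let B := A.map (Int.castRingHom ℝ)
  have hB : (Aᵀ * A).map (Int.castRingHom ℝ) = Bᵀ * B := by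
    rw [Matrix.map_mul, Matrix.transpose_map]
  have hsq : x ⬝ᵥ (Bᵀ * B) *ᵥ x = (B *ᵥ x) ⬝ᵥ (B *ᵥ x) := by
    rw [← Matrix.mulVec_mulVec, Matrix.dotProduct_mulVec, Matrix.vecMul_transpose]
  rw [hB, hsq]
  refine lt_of_le_of_ne (Finset.sum_nonneg fun i _ => mul_self_nonneg _) fun h => ?_
  have h1 : (Aᵀ * A).map (Int.castRingHom ℝ) *ᵥ x = 0 := by
    rw [hB, ← Matrix.mulVec_mulVec, dotProduct_self_eq_zero.1 h.symm, Matrix.mulVec_zero]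
  have h2 := Matrix.exists_mulVec_eq_zero_iff.1 ⟨x, hx, h1⟩
  have h3 : (Aᵀ * A).det = 0 := by
    have : ((Int.castRingHom ℝ) (Aᵀ * A).det) = 0 := by rw [RingHom.map_det]; exact h2
    simpa using this
  obtain ⟨z, hz, hz0⟩ := Matrix.exists_mulVec_eq_zero_iff.2 h3
  have := hA z hz
  rw [hz0, dotProduct_zero] at this
  exact lt_irrefl _ this

lemma repBySquares_of_min_ge {k n r : ℕ} (hn : n ≤ 2 ^ k) (A : Matrix (Fin r) (Fin n) ℤ)
    (hA : ∀ x : Fin n → ℤ, x ≠ 0 →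
      ((1024 * (2 ^ (3 * k ^ 2)) ^ 39 : ℕ) : ℤ) ≤ x ⬝ᵥ (Aᵀ * A) *ᵥ x) :
    RepBySquares n (n + (4 * n ^ 2 + 4 * n)) (Aᵀ * A) := by
  set G := Aᵀ * A
  let Gr := G.map (Int.castRingHom ℝ)
  have hT : 0 < (1024 * (2 ^ (3 * k ^ 2)) ^ 39 : ℕ) := by positivity
  have hsymm : G.IsSymm := by simp [G, Matrix.IsSymm, Matrix.transpose_mul]
  obtain ⟨X, Y, P, D, hXY, uP, hD, hdec, hmin⟩ := exists_hkz n Gr (hsymm.map _) fun x hx =>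
    dotProduct_transpose_mul_self_pos A
      (fun x hx => lt_of_lt_of_le (by exact_mod_cast hT) (hA x hx)) hx
  obtain ⟨X', Y', Q, R, hXY', hQ, hQR, uQ, uR, bQ, bR⟩ := UnitUpper.exists_reduced k n hn P uP
  let κ : ℝ := 2 ^ (3 * k ^ 2)
  have hκ : 1 ≤ κ := one_le_pow₀ one_le_two
  have hbound : ((2 : ℝ) ^ k ^ 2) ≤ κ := pow_le_pow_right₀ one_le_two (by omega)
  have hnκ : (n : ℝ) ≤ κ := by
    refine le_trans (by exact_mod_cast hn : (n : ℝ) ≤ 2 ^ k) (pow_le_pow_right₀ one_le_two ?_)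
    nlinarith
  have hratio : ∀ i j, j ≤ i → D j ≤ κ * D i := fun i j hji => by
    have := hkz_le_pow_mul hn uP hD hmin hji
    rw [Nat.log_pow one_lt_two] at this
    refine this.trans (le_of_eq ?_)
    push_cast
    rw [← pow_mul]
    congr 2
    ring
  let V := X * X'
  have hWV : (Y' * Y) * V = 1 := by
    refine mul_eq_one_comm.1 ?_
    rw [Matrix.mul_assoc, ← Matrix.mul_assoc X', hXY', Matrix.one_mul, hXY]
  have hV : (Vᵀ * G * V).map (Int.castRingHom ℝ) = Qᵀ * Matrix.diagonal D * Q := by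
    calc (Vᵀ * G * V).map (Int.castRingHom ℝ)
        = (X'.map (Int.castRingHom ℝ))ᵀ * ((X.map (Int.castRingHom ℝ))ᵀ * Gr *
            X.map (Int.castRingHom ℝ)) * X'.map (Int.castRingHom ℝ) := by
          simp only [V, Gr, Matrix.map_mul, Matrix.transpose_mul, ← Matrix.transpose_map,
            Matrix.mul_assoc]
      _ = Qᵀ * Matrix.diagonal D * Q := by
          rw [hdec, hQ]
          simp only [Matrix.transpose_mul, Matrix.mul_assoc]
  have hD0 : ∀ i, 1024 * κ ^ 38 ≤ D i := fun i => by
    have hn0 : 0 < n := i.pos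
    let z : Fin n := ⟨0, hn0⟩
    let e : Fin n → ℤ := Pi.single z 1
    have h1 : (Vᵀ * G * V) z z = (V *ᵥ e) ⬝ᵥ G *ᵥ (V *ᵥ e) := by
      rw [← dotProduct_transpose_mul_mul]
      simp [e]
    have h2 : ((Vᵀ * G * V) z z : ℝ) = D z := by
      have h3 := congrFun₂ hV z z
      rw [Matrix.map_apply, eq_intCast] at h3
      rw [h3, Matrix.mul_apply, Finset.sum_eq_single z]
      · simp [uQ.1]
      · intro l _ hl
        rw [uQ.2 l z (Fin.lt_def.2 (Nat.pos_of_ne_zero fun h => hl (Fin.ext h))), mul_zero]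
      · simp
    have h3 : (1024 * κ ^ 39 : ℝ) ≤ D z := by
      rw [← h2, h1]
      have h5 := hA (V *ᵥ e) fun h => ?_
      · have h6 : (((1024 * (2 ^ (3 * k ^ 2)) ^ 39 : ℕ) : ℤ) : ℝ) ≤ _ := Int.cast_le.2 h5
        refine le_trans (le_of_eq ?_) h6
        push_cast
        rfl
      · have h4 : (Y' * Y) *ᵥ (V *ᵥ e) = e := by rw [Matrix.mulVec_mulVec, hWV, Matrix.one_mulVec]
        rw [h, Matrix.mulVec_zero] at h4
        have := congrFun h4 z
        simp [e] at this
    have h4 := hratio i z (Nat.zero_le _)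
    have h5 : κ * (1024 * κ ^ 38) ≤ κ * D i := by
      calc κ * (1024 * κ ^ 38) = 1024 * κ ^ 39 := by ring
        _ ≤ κ * D i := h3.trans h4
    exact le_of_mul_le_mul_left h5 (by linarith)
  have := (repBySquares_of_reduced (Vᵀ * G * V) hκ hnκ uQ uR hQR
    (fun i j => (bQ i j).trans hbound) (fun i j => (bR i j).trans hbound) hV hratio hD0).conj
      (Y' * Y)
  convert this using 1
  have hVW := mul_eq_one_comm.1 hWV
  calc G = (V * (Y' * Y))ᵀ * G * (V * (Y' * Y)) := by
        rw [hVW, Matrix.transpose_one, Matrix.one_mul, Matrix.mul_one]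
    _ = _ := by simp only [Matrix.transpose_mul, Matrix.mul_assoc]

/-- Every sum of squares in `n ≤ 2 ^ k` variables is a sum of quasi-polynomially many squares. -/
lemma repBySquares_of_sq {k n r : ℕ} (hn : n ≤ 2 ^ k) (A : Matrix (Fin r) (Fin n) ℤ) :
    RepBySquares n (n * (1024 * (2 ^ (3 * k ^ 2)) ^ 39) + (n + (4 * n ^ 2 + 4 * n)))
      (Aᵀ * A) :=
  repBySquares_of_large_min (N := n) (fun m hm r A hA =>
    (repBySquares_of_min_ge (hm.trans hn) A hA).mono (by gcongr)) n le_rfl r A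

/-- `2 ^ (117 k ^ 2)` grows more slowly than `exp √n` if `k = ⌈log₂ n⌉`. -/
lemma two_pow_clog_sq_le {n : ℕ} (hn : 2 ≤ n) :
    (((2 ^ (3 * Nat.clog 2 n ^ 2)) ^ 39 : ℕ) : ℝ) ≤
      Real.exp (59904 ^ 2 + 234) * Real.exp √n := by
  have hn0 : (0 : ℝ) < n := by positivity
  set k := Nat.clog 2 n
  have hL0 : 0 ≤ Real.log n := Real.log_natCast_nonneg n
  have hk : (k : ℝ) ≤ 2 * Real.log n + 1 := by
    have h1 : (2 : ℝ) ^ (k - 1) ≤ n := by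
      exact_mod_cast (Nat.pow_pred_clog_lt_self one_lt_two hn).le
    have h2 := Real.log_le_log (by positivity) h1
    rw [Real.log_pow, Nat.cast_sub (Nat.clog_pos one_lt_two hn)] at h2
    have h3 := Real.log_two_gt_d9
    have h4 : (1 : ℝ) ≤ k := by exact_mod_cast Nat.clog_pos one_lt_two hn
    push_cast at h2
    nlinarith
  have hk2 : (k : ℝ) ^ 2 ≤ 8 * Real.log n ^ 2 + 2 := by
    have : (k : ℝ) ^ 2 ≤ (2 * Real.log n + 1) ^ 2 := by gcongr
    nlinarith [sq_nonneg (2 * Real.log n - 1)]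
  have hu : 936 * Real.log n ^ 2 ≤ √n + 59904 ^ 2 := by
    let u := √(√(√(n : ℝ)))
    have hu0 : 0 < u := by positivity
    have h4 : u ^ 4 = √n := by
      rw [show 4 = 2 * 2 from rfl, pow_mul, Real.sq_sqrt (by positivity),
        Real.sq_sqrt (by positivity)]
    have hlog : Real.log n = 8 * Real.log u := by
      simp only [u, Real.log_sqrt, Real.sqrt_nonneg, Nat.cast_nonneg]
      ring
    have hle : Real.log n ≤ 8 * u := by
      rw [hlog]
      linarith [Real.log_le_sub_one_of_pos hu0]
    have h5 : Real.log n ^ 2 ≤ (8 * u) ^ 2 := by gcongr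
    nlinarith [sq_nonneg (u ^ 2 - 59904)]
  have h2 : (2 : ℝ) ≤ Real.exp 1 := by linarith [Real.add_one_le_exp (1 : ℝ)]
  calc (((2 ^ (3 * k ^ 2)) ^ 39 : ℕ) : ℝ) = 2 ^ (117 * k ^ 2) := by
        push_cast
        rw [← pow_mul]
        congr 1
        ring
    _ ≤ Real.exp 1 ^ (117 * k ^ 2) := by gcongr
    _ = Real.exp (117 * (k : ℝ) ^ 2) := by
        rw [← Real.exp_nat_mul]
        push_cast
        ring_nf
    _ ≤ Real.exp (59904 ^ 2 + 234 + √n) := by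
        gcongr
        linarith
    _ = _ := Real.exp_add _ _

/-- There is a constant `C > 0` such that for every `n ≥ 2`, every `n`-variable positive
definite integral quadratic form that is represented by some `I_r` (`r` a positive integer)
is represented by `I_g` for some positive integer
`g ≤ C·n^{11}·e^{(4+2√2)√n + 2(ln n)²}`. -/
theorem gZ_explicit_bound :
    ∃ C : ℝ, 0 < C ∧ ∀ n : ℕ, 2 ≤ n →
      ∀ M : Matrix (Fin n) (Fin n) ℤ, M.IsSymm →
        (M.map (fun x => (x : ℝ))).PosDef →
        (∃ r : ℕ, 0 < r ∧ RepBySquares n r M) →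
        ∃ g : ℕ, 0 < g ∧
          (g : ℝ) ≤ C * (n : ℝ) ^ 11 *
            Real.exp ((4 + 2 * Real.sqrt 2) * Real.sqrt n + 2 * (Real.log n) ^ 2) ∧
          RepBySquares n g M := by
  let c := Real.exp (59904 ^ 2 + 234)
  refine ⟨1033 * c, by positivity, fun n hn M _ _ ⟨r, _, A, hA⟩ => ?_⟩
  refine ⟨_, ?_, ?_, hA ▸ repBySquares_of_sq (Nat.le_pow_clog one_lt_two n) A⟩
  · positivity
  let E := Real.exp ((4 + 2 * Real.sqrt 2) * Real.sqrt n + 2 * (Real.log n) ^ 2)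
  have hn1 : (1 : ℝ) ≤ n := by exact_mod_cast one_le_two.trans hn
  have hsqrt : √(n : ℝ) ≤ (4 + 2 * Real.sqrt 2) * Real.sqrt n + 2 * (Real.log n) ^ 2 := by
    nlinarith [Real.sqrt_nonneg 2, Real.sqrt_nonneg n, sq_nonneg (Real.log n),
      mul_nonneg (Real.sqrt_nonneg 2) (Real.sqrt_nonneg n)]
  have hT := (two_pow_clog_sq_le hn).trans
    (mul_le_mul_of_nonneg_left (Real.exp_le_exp.2 hsqrt) (Real.exp_pos _).le)
  have hcE : 1 ≤ c * E := one_le_mul_of_one_le_of_one_le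
    (Real.one_le_exp (by norm_num)) (Real.one_le_exp ((Real.sqrt_nonneg _).trans hsqrt))
  have h1 : (n : ℝ) ≤ n ^ 11 := le_self_pow₀ hn1 (by norm_num)
  have h2 : (n : ℝ) ^ 2 ≤ n ^ 11 := pow_le_pow_right₀ hn1 (by norm_num)
  calc ((n * (1024 * (2 ^ (3 * Nat.clog 2 n ^ 2)) ^ 39) + (n + (4 * n ^ 2 + 4 * n)) : ℕ) : ℝ)
      = 1024 * (n * (((2 ^ (3 * Nat.clog 2 n ^ 2)) ^ 39 : ℕ) : ℝ)) + (5 * n + 4 * n ^ 2) := by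
        push_cast
        ring
    _ ≤ 1024 * (n ^ 11 * (c * E)) + 9 * n ^ 11 * (c * E) := by
        refine add_le_add (by gcongr) ?_
        refine le_trans ?_ (le_mul_of_one_le_right (by positivity) hcE)
        linarith
    _ = 1033 * c * n ^ 11 * E := by ring
end

section
/- Suppose 𝓞 is a principal ideal domain (equivalently, E has class number 1). Every n-variable positive definite hermitian form over E is integrally equivalent to a weakly reduced form: for every positive definite hermitian matrix M ∈ Mₙ(E) (M* = M) there exists U ∈ GLₙ(𝓞) such that U*MU = X*HX is the Gram matrix of a weakly reduced hermitian form. -/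
open scoped Matrix ComplexOrder

/-- `ω = √−ℓ` if `ℓ ≡ 1, 2 (mod 4)` and `ω = (1+√−ℓ)/2` if `ℓ ≡ 3 (mod 4)`,
realized inside `ℂ` (with `√−ℓ = √ℓ·i`). -/
noncomputable def omegaC (ℓ : ℕ) : ℂ :=
  if ℓ % 4 = 3 then (1 + Real.sqrt ℓ * Complex.I) / 2 else Real.sqrt ℓ * Complex.I

/-- The ring of integers `𝓞 = ℤ[ω] = ℤ + ℤω` of `ℚ(√−ℓ)`, as a subring of `ℂ`. -/
noncomputable def intO (ℓ : ℕ) : Subring ℂ := Subring.closure {omegaC ℓ}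

/-- `z` lies in the field `E = ℚ(√−ℓ) ⊆ ℂ`, i.e. `z = a + b√−ℓ` with `a, b ∈ ℚ`. -/
def memE (ℓ : ℕ) (z : ℂ) : Prop :=
  ∃ a b : ℚ, z = (a : ℂ) + (b : ℂ) * (Real.sqrt ℓ * Complex.I)

/-- The Gram matrix `M ∈ Mₙ(E)` is that of a weakly reduced hermitian form:
`M = X*HX` with `X ∈ Mₙ(E)` upper triangular unipotent, `H = diag(h₁,…,hₙ)` with `hᵢ`
positive rationals, and for each `i`, `hᵢ` is the minimum of
`Σ_{j≥i} hⱼ·N(xⱼ + Σ_{k>j} tⱼₖxₖ)` over nonzero vectors `(x_i,…,xₙ)` with entries in `𝓞`. -/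
def WeaklyReducedH (ℓ n : ℕ) (M : Matrix (Fin n) (Fin n) ℂ) : Prop :=
  ∃ X : Matrix (Fin n) (Fin n) ℂ, ∃ h : Fin n → ℚ,
    M = Xᴴ * Matrix.diagonal (fun i => (h i : ℂ)) * X ∧
    (∀ i j, memE ℓ (X i j)) ∧
    (∀ i j : Fin n, j < i → X i j = 0) ∧ (∀ i, X i i = 1) ∧
    (∀ i, 0 < h i) ∧
    ∀ i : Fin n,
      IsLeast {q : ℝ | ∃ x : Fin n → ℂ, (∀ j, x j ∈ intO ℓ) ∧ x ≠ 0 ∧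
          (∀ j, j < i → x j = 0) ∧
          q = ∑ j ∈ Finset.univ.filter (fun j => i ≤ j),
                (h j : ℝ) * Complex.normSq (x j +
                  ∑ k ∈ Finset.univ.filter (fun k => j < k), X j k * x k)}
        ((h i : ℝ))

open Matrix Module

section Arithmetic

lemma sqrt_mul_I_sq (ℓ : ℕ) : ((Real.sqrt ℓ : ℂ) * Complex.I) * (Real.sqrt ℓ * Complex.I) = -ℓ := by
  have h : (Real.sqrt ℓ : ℂ) * Real.sqrt ℓ = ℓ := by
    exact_mod_cast Real.mul_self_sqrt (Nat.cast_nonneg ℓ)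
  linear_combination (Complex.I * Complex.I) * h + (ℓ : ℂ) * Complex.I_mul_I

/-- `E = ℚ(√−ℓ)` as a subring of `ℂ`. -/
def ringE (ℓ : ℕ) : Subring ℂ where
  carrier := {z | memE ℓ z}
  zero_mem' := ⟨0, 0, by simp⟩
  one_mem' := ⟨1, 0, by simp⟩
  add_mem' := by
    rintro _ _ ⟨a, b, rfl⟩ ⟨c, d, rfl⟩
    exact ⟨a + c, b + d, by push_cast; ring⟩
  neg_mem' := by
    rintro _ ⟨a, b, rfl⟩
    exact ⟨-a, -b, by push_cast; ring⟩
  mul_mem' := by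
    rintro _ _ ⟨a, b, rfl⟩ ⟨c, d, rfl⟩
    refine ⟨a * c - b * d * ℓ, a * d + b * c, ?_⟩
    push_cast
    linear_combination (b * d : ℂ) * sqrt_mul_I_sq ℓ

lemma ratCast_mem_ringE (ℓ : ℕ) (q : ℚ) : (q : ℂ) ∈ ringE ℓ := ⟨q, 0, by simp⟩

lemma star_mem_ringE {ℓ : ℕ} {z : ℂ} (hz : z ∈ ringE ℓ) : star z ∈ ringE ℓ := by
  obtain ⟨a, b, rfl⟩ := hz
  exact ⟨a, -b, by simp⟩

lemma exists_rat_of_mem_ringE {ℓ : ℕ} (hpos : 0 < ℓ) {z : ℂ} (hz : z ∈ ringE ℓ)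
    (him : z.im = 0) : ∃ q : ℚ, z = q := by
  obtain ⟨a, b, rfl⟩ := hz
  have : b = 0 := by simpa [hpos.ne'] using him
  exact ⟨a, by simp [this]⟩

lemma omegaC_mul_self_and_star (ℓ : ℕ) :
    ∃ t s : ℤ, omegaC ℓ * omegaC ℓ = t * omegaC ℓ + s ∧ star (omegaC ℓ) = t - omegaC ℓ := by
  have h := sqrt_mul_I_sq ℓ
  by_cases hℓ : ℓ % 4 = 3
  · obtain ⟨k, hk⟩ : ∃ k, ℓ = 4 * k + 3 := ⟨ℓ / 4, by omega⟩
    refine ⟨1, -((k : ℤ) + 1), ?_, ?_⟩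
    · have h4 : (ℓ : ℂ) = 4 * (k : ℂ) + 3 := by exact_mod_cast hk
      simp only [omegaC, hℓ, if_true]
      push_cast
      linear_combination h / 4 - h4 / 4
    · simp [omegaC, hℓ]
      ring
  · refine ⟨0, -(ℓ : ℤ), ?_, ?_⟩
    · simp only [omegaC, hℓ, if_false]
      push_cast
      linear_combination h
    · simp [omegaC, hℓ]

lemma omegaC_im_pos {ℓ : ℕ} (hpos : 0 < ℓ) : 0 < (omegaC ℓ).im := by
  have h : 0 < Real.sqrt ℓ := Real.sqrt_pos.2 (by exact_mod_cast hpos)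
  unfold omegaC
  split_ifs <;> simp [h]

lemma omegaC_mem_intO (ℓ : ℕ) : omegaC ℓ ∈ intO ℓ := Subring.subset_closure rfl

lemma exists_int_of_mem_intO {ℓ : ℕ} {z : ℂ} (hz : z ∈ intO ℓ) :
    ∃ a b : ℤ, z = a + b * omegaC ℓ := by
  obtain ⟨t, s, h, -⟩ := omegaC_mul_self_and_star ℓ
  unfold intO at hz
  induction hz using Subring.closure_induction with
  | mem x hx => exact ⟨0, 1, by simpa using hx⟩
  | zero => exact ⟨0, 0, by simp⟩
  | one => exact ⟨1, 0, by simp⟩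
  | add x y _ _ hx hy =>
    obtain ⟨a, b, rfl⟩ := hx
    obtain ⟨c, d, rfl⟩ := hy
    exact ⟨a + c, b + d, by push_cast; ring⟩
  | neg x _ hx =>
    obtain ⟨a, b, rfl⟩ := hx
    exact ⟨-a, -b, by push_cast; ring⟩
  | mul x y _ _ hx hy =>
    obtain ⟨a, b, rfl⟩ := hx
    obtain ⟨c, d, rfl⟩ := hy
    refine ⟨a * c + b * d * s, a * d + b * c + b * d * t, ?_⟩
    push_cast
    linear_combination (b * d : ℂ) * h

lemma star_mem_intO {ℓ : ℕ} {z : ℂ} (hz : z ∈ intO ℓ) : star z ∈ intO ℓ := by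
  obtain ⟨a, b, rfl⟩ := exists_int_of_mem_intO hz
  obtain ⟨t, s, -, h⟩ := omegaC_mul_self_and_star ℓ
  rw [star_add, star_mul, h]
  simpa using add_mem (intCast_mem (intO ℓ) a) (mul_mem
    (sub_mem (intCast_mem (intO ℓ) t) (omegaC_mem_intO ℓ)) (intCast_mem (intO ℓ) b))

lemma intO_le_ringE (ℓ : ℕ) : intO ℓ ≤ ringE ℓ := by
  refine Subring.closure_le.2 (Set.singleton_subset_iff.2 ?_)
  by_cases hℓ : ℓ % 4 = 3
  · exact ⟨1 / 2, 1 / 2, by simp [omegaC, hℓ]; ring⟩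
  · exact ⟨0, 1, by simp [omegaC, hℓ]⟩

lemma exists_int_of_mem_intO_of_im {ℓ : ℕ} (hpos : 0 < ℓ) {z : ℂ} (hz : z ∈ intO ℓ)
    (him : z.im = 0) : ∃ a : ℤ, z = a := by
  obtain ⟨a, b, rfl⟩ := exists_int_of_mem_intO hz
  have : b = 0 := by simpa [(omegaC_im_pos hpos).ne'] using him
  exact ⟨a, by simp [this]⟩

lemma one_le_normSq_of_mem_intO {ℓ : ℕ} (hpos : 0 < ℓ) {z : ℂ} (hz : z ∈ intO ℓ)
    (h0 : z ≠ 0) : 1 ≤ Complex.normSq z := by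
  have hn : (Complex.normSq z : ℂ) ∈ intO ℓ := by
    rw [Complex.normSq_eq_conj_mul_self]
    exact mul_mem (star_mem_intO hz) hz
  obtain ⟨a, ha⟩ := exists_int_of_mem_intO_of_im hpos hn (Complex.ofReal_im _)
  have ha' : Complex.normSq z = a := by exact_mod_cast ha
  have hz0 := Complex.normSq_pos.2 h0
  rw [ha'] at hz0 ⊢
  exact_mod_cast hz0

lemma exists_natCast_mul_mem_intO {ℓ : ℕ} {z : ℂ} (hz : z ∈ ringE ℓ) :
    ∃ D : ℕ, 0 < D ∧ (D : ℂ) * z ∈ intO ℓ := by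
  obtain ⟨a, b, rfl⟩ := hz
  have hs : (Real.sqrt ℓ * Complex.I : ℂ) ∈ intO ℓ := by
    by_cases hℓ : ℓ % 4 = 3
    · have : (Real.sqrt ℓ * Complex.I : ℂ) = omegaC ℓ + omegaC ℓ - 1 := by
        simp [omegaC, hℓ]
      rw [this]
      exact sub_mem (add_mem (omegaC_mem_intO ℓ) (omegaC_mem_intO ℓ)) (one_mem _)
    · have : (Real.sqrt ℓ * Complex.I : ℂ) = omegaC ℓ := by simp [omegaC, hℓ]
      rw [this]
      exact omegaC_mem_intO ℓ
  refine ⟨a.den * b.den, Nat.mul_pos a.den_pos b.den_pos, ?_⟩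
  have ha : (a.den : ℂ) * a = a.num := by exact_mod_cast Rat.den_mul_eq_num a
  have hb : (b.den : ℂ) * b = b.num := by exact_mod_cast Rat.den_mul_eq_num b
  have : ((a.den * b.den : ℕ) : ℂ) * (a + b * (Real.sqrt ℓ * Complex.I)) =
      b.den * a.num + a.den * b.num * (Real.sqrt ℓ * Complex.I) := by
    push_cast
    linear_combination (b.den : ℂ) * ha + (a.den : ℂ) * (Real.sqrt ℓ * Complex.I) * hb
  rw [this]
  exact add_mem (mul_mem (natCast_mem _ _) (intCast_mem _ _))
    (mul_mem (mul_mem (natCast_mem _ _) (intCast_mem _ _)) hs)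

end Arithmetic

section Unimodular

variable {R : Type*} [CommRing R] [IsDomain R] [IsPrincipalIdealRing R]

lemma exists_primitive_of_ne_zero {n : ℕ} {x : Fin n → R} (hx : x ≠ 0) :
    ∃ (g : R) (y a : Fin n → R), g ≠ 0 ∧ x = g • y ∧ a ⬝ᵥ y = 1 := by
  obtain ⟨g, hg⟩ := (IsPrincipalIdealRing.principal (Ideal.span (Set.range x))).principal
  have hmem (i : Fin n) : ∃ c, x i = g * c := by
    have : x i ∈ Ideal.span {g} := by
      rw [← Ideal.submodule_span_eq, ← hg]
      exact Ideal.subset_span ⟨i, rfl⟩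
    exact Ideal.mem_span_singleton'.1 this |>.imp fun c hc => by rw [← hc, mul_comm]
  choose y hy using hmem
  have hgx : g ∈ Submodule.span R (Set.range x) := by
    rw [show Submodule.span R (Set.range x) = _ from hg]
    exact Submodule.mem_span_singleton_self g
  obtain ⟨a, ha⟩ := (Submodule.mem_span_range_iff_exists_fun R).1 hgx
  have hg0 : g ≠ 0 := by
    rintro rfl
    exact hx (funext fun i => by simp [hy i])
  refine ⟨g, y, a, hg0, funext hy, mul_left_cancel₀ hg0 ?_⟩
  calc g * (a ⬝ᵥ y) = ∑ i, a i • x i := by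
        simp only [dotProduct, Finset.mul_sum, hy, smul_eq_mul]
        exact Finset.sum_congr rfl fun i _ => by ring
    _ = g * 1 := by rw [ha, mul_one]

lemma exists_unimodular_of_dotProduct_eq_one {n : ℕ} {y a : Fin (n + 1) → R}
    (h : a ⬝ᵥ y = 1) :
    ∃ A B : Matrix (Fin (n + 1)) (Fin (n + 1)) R, A * B = 1 ∧ B * A = 1 ∧ ∀ i, A i 0 = y i := by
  let N : Submodule R (Fin (n + 1) → R) := LinearMap.ker (dotProductBilin R R a)
  have hN (z : Fin (n + 1) → R) : z ∈ N ↔ a ⬝ᵥ z = 0 := LinearMap.mem_ker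
  obtain ⟨m, ⟨b⟩⟩ := N.nonempty_basis_of_pid (Pi.basisFun R (Fin (n + 1)))
  let b₁ := Basis.mkFinCons y b
    (fun c x hx hc => by
      have := congrArg (a ⬝ᵥ ·) hc
      simpa [dotProduct_add, dotProduct_smul, h, (hN x).1 hx] using this)
    (fun z => ⟨-(a ⬝ᵥ z), (hN _).2 (by simp [dotProduct_add, dotProduct_smul, h])⟩)
  obtain rfl : m = n := by
    simpa using Fintype.card_eq.2 ⟨b₁.indexEquiv (Pi.basisFun R (Fin (n + 1)))⟩
  refine ⟨(Pi.basisFun R _).toMatrix b₁, b₁.toMatrix (Pi.basisFun R _),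
    Basis.toMatrix_mul_toMatrix_flip _ _, Basis.toMatrix_mul_toMatrix_flip _ _, fun i => ?_⟩
  simp [Basis.toMatrix_apply, b₁, Basis.coe_mkFinCons]

end Unimodular

section HermitianForm

variable {n : ℕ}

/-- The value `x* M x` of the hermitian form with Gram matrix `M`. -/
noncomputable def hermValue (M : Matrix (Fin n) (Fin n) ℂ) (x : Fin n → ℂ) : ℝ :=
  (star x ⬝ᵥ M *ᵥ x).re

lemma hermValue_conj (M U : Matrix (Fin n) (Fin n) ℂ) (x : Fin n → ℂ) :
    hermValue (Uᴴ * M * U) x = hermValue M (U *ᵥ x) := by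
  simp only [hermValue, star_mulVec, ← mulVec_mulVec, dotProduct_mulVec, vecMul_vecMul]

lemma hermValue_smul (M : Matrix (Fin n) (Fin n) ℂ) (g : ℂ) (x : Fin n → ℂ) :
    hermValue M (g • x) = Complex.normSq g * hermValue M x := by
  have : star (g • x) ⬝ᵥ M *ᵥ (g • x) = (Complex.normSq g : ℂ) * (star x ⬝ᵥ M *ᵥ x) := by
    rw [star_smul, mulVec_smul, dotProduct_smul, smul_dotProduct, Complex.normSq_eq_conj_mul_self,
      smul_eq_mul, smul_eq_mul, ← mul_assoc, mul_comm g]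
    rfl
  rw [hermValue, this, Complex.re_ofReal_mul, hermValue]

lemma hermValue_diagonal (d : Fin n → ℚ) (x : Fin n → ℂ) :
    hermValue (diagonal fun i => (d i : ℂ)) x = ∑ j, (d j : ℝ) * Complex.normSq (x j) := by
  have : star x ⬝ᵥ (diagonal fun i => (d i : ℂ)) *ᵥ x =
      ((∑ j, (d j : ℝ) * Complex.normSq (x j) : ℝ) : ℂ) := by
    simp only [dotProduct, mulVec_diagonal, Pi.star_apply, Complex.ofReal_sum, Complex.ofReal_mul,
      Complex.normSq_eq_conj_mul_self, Complex.ofReal_ratCast]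
    exact Finset.sum_congr rfl fun j _ => by simp only [Complex.star_def]; ring
  rw [hermValue, this, Complex.ofReal_re]

lemma Matrix.PosDef.hermValue_pos {M : Matrix (Fin n) (Fin n) ℂ} (hM : M.PosDef)
    {x : Fin n → ℂ} (hx : x ≠ 0) : 0 < hermValue M x :=
  (Complex.lt_def.1 (hM.dotProduct_mulVec_pos hx)).1

lemma Matrix.PosDef.exists_isLeast_hermValue {ℓ : ℕ} (hpos : 0 < ℓ)
    {M : Matrix (Fin (n + 1)) (Fin (n + 1)) ℂ} (hM : M.PosDef) (hME : ∀ i j, M i j ∈ ringE ℓ) :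
    ∃ x : Fin (n + 1) → ℂ, (∀ i, x i ∈ intO ℓ) ∧ x ≠ 0 ∧
      ∀ z : Fin (n + 1) → ℂ, (∀ i, z i ∈ intO ℓ) → z ≠ 0 → hermValue M x ≤ hermValue M z := by
  choose d hd0 hd using fun i j => exists_natCast_mul_mem_intO (hME i j)
  let D := ∏ i, ∏ j, d i j
  have hD0 : 0 < D := Finset.prod_pos fun i _ => Finset.prod_pos fun j _ => hd0 i j
  have hD (i j) : (D : ℂ) * M i j ∈ intO ℓ := by
    obtain ⟨c, hc⟩ : d i j ∣ D :=
      (Finset.dvd_prod_of_mem (d i) (Finset.mem_univ j)).trans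
        (Finset.dvd_prod_of_mem (fun i => ∏ j, d i j) (Finset.mem_univ i))
    have : (D : ℂ) * M i j = c * (d i j * M i j) := by rw [hc]; push_cast; ring
    rw [this]
    exact mul_mem (natCast_mem _ _) (hd i j)
  have key (x : Fin (n + 1) → ℂ) (hx : ∀ i, x i ∈ intO ℓ) (hx0 : x ≠ 0) :
      ∃ k : ℕ, D * hermValue M x = k := by
    have hp := Complex.lt_def.1 (hM.dotProduct_mulVec_pos hx0)
    have hmem : (D : ℂ) * (star x ⬝ᵥ M *ᵥ x) ∈ intO ℓ := by
      have : (D : ℂ) * (star x ⬝ᵥ M *ᵥ x) = ∑ i, ∑ j, star (x i) * ((D * M i j) * x j) := by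
        simp only [dotProduct, mulVec, Finset.mul_sum, Pi.star_apply]
        exact Finset.sum_congr rfl fun i _ => Finset.sum_congr rfl fun j _ => by ring
      rw [this]
      exact sum_mem fun i _ => sum_mem fun j _ =>
        mul_mem (star_mem_intO (hx i)) (mul_mem (hD i j) (hx j))
    obtain ⟨a, ha⟩ := exists_int_of_mem_intO_of_im hpos hmem (by simp [← hp.2])
    have ha' : D * hermValue M x = a := by simpa [hermValue] using congrArg Complex.re ha
    have : (0 : ℝ) ≤ a := ha' ▸ mul_nonneg (Nat.cast_nonneg _) (hM.hermValue_pos hx0).le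
    lift a to ℕ using by exact_mod_cast this
    exact ⟨a, by exact_mod_cast ha'⟩
  classical
  have hex : ∃ k : ℕ, ∃ x : Fin (n + 1) → ℂ, (∀ i, x i ∈ intO ℓ) ∧ x ≠ 0 ∧
      D * hermValue M x = k := by
    have h1 : ∀ i : Fin (n + 1), (1 : Fin (n + 1) → ℂ) i ∈ intO ℓ := fun _ => one_mem _
    obtain ⟨k, hk⟩ := key 1 h1 one_ne_zero
    exact ⟨k, 1, h1, one_ne_zero, hk⟩
  obtain ⟨x, hx, hx0, hxk⟩ := Nat.find_spec hex
  refine ⟨x, hx, hx0, fun z hz hz0 => ?_⟩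
  obtain ⟨k, hk⟩ := key z hz hz0
  have hle : (Nat.find hex : ℝ) ≤ k := by exact_mod_cast Nat.find_min' hex ⟨z, hz, hz0, hk⟩
  rw [← hxk, ← hk] at hle
  exact le_of_mul_le_mul_left hle (by exact_mod_cast hD0)

end HermitianForm

section Bordered

variable {n : ℕ}

/-- The block matrix with top left entry `a`, remaining first row `r`, remaining first column `c`
and lower right block `B`. -/
def bordered (a : ℂ) (r c : Fin n → ℂ) (B : Matrix (Fin n) (Fin n) ℂ) :
    Matrix (Fin (n + 1)) (Fin (n + 1)) ℂ :=
  Matrix.of (Fin.cons (Fin.cons a r) fun i => Fin.cons (c i) (B i))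

variable (a a' : ℂ) (r c r' c' : Fin n → ℂ) (B B' : Matrix (Fin n) (Fin n) ℂ)

@[simp] lemma bordered_zero_zero : bordered a r c B 0 0 = a := rfl

@[simp] lemma bordered_zero_succ (j : Fin n) : bordered a r c B 0 j.succ = r j := rfl

@[simp] lemma bordered_succ_zero (i : Fin n) : bordered a r c B i.succ 0 = c i := rfl

@[simp] lemma bordered_succ_succ (i j : Fin n) : bordered a r c B i.succ j.succ = B i j := rfl

lemma bordered_ext {A A' : Matrix (Fin (n + 1)) (Fin (n + 1)) ℂ} (h₀₀ : A 0 0 = A' 0 0)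
    (h₀ : ∀ j : Fin n, A 0 j.succ = A' 0 j.succ) (h₁ : ∀ i : Fin n, A i.succ 0 = A' i.succ 0)
    (h : ∀ i j : Fin n, A i.succ j.succ = A' i.succ j.succ) : A = A' := by
  ext i j
  cases i using Fin.cases <;> cases j using Fin.cases <;> simp [*]

lemma bordered_mul : bordered a r c B * bordered a' r' c' B' =
    bordered (a * a' + r ⬝ᵥ c') (a • r' + r ᵥ* B') (a' • c + B *ᵥ c')
      (vecMulVec c r' + B * B') := by
  apply bordered_ext <;> intros <;>
    simp [Matrix.mul_apply, Fin.sum_univ_succ, dotProduct, vecMul, mulVec, vecMulVec_apply,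
      mul_comm]

lemma bordered_conjTranspose :
    (bordered a r c B)ᴴ = bordered (star a) (star c) (star r) Bᴴ := by
  apply bordered_ext <;> intros <;> simp [conjTranspose_apply]

lemma bordered_one : bordered 1 0 0 (1 : Matrix (Fin n) (Fin n) ℂ) = 1 := by
  apply bordered_ext <;> intros <;> simp [Matrix.one_apply, Fin.ext_iff]

lemma diagonal_cons (q : ℚ) (h : Fin n → ℚ) :
    (diagonal fun i => ((Fin.cons q h : Fin (n + 1) → ℚ) i : ℂ)) =
      bordered q 0 0 (diagonal fun i => (h i : ℂ)) := by
  apply bordered_ext <;> intros <;> simp [diagonal_apply, Fin.ext_iff]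

lemma bordered_mem {S : Subring ℂ} {a : ℂ} {r c : Fin n → ℂ} {B : Matrix (Fin n) (Fin n) ℂ}
    (ha : a ∈ S) (hr : ∀ j, r j ∈ S) (hc : ∀ i, c i ∈ S) (hB : ∀ i j, B i j ∈ S)
    (i j : Fin (n + 1)) : bordered a r c B i j ∈ S := by
  cases i using Fin.cases <;> cases j using Fin.cases <;> simp [*]

end Bordered

section Reduction

lemma dotProduct_mem_subring {n : ℕ} {S : Subring ℂ} {x y : Fin n → ℂ}
    (hx : ∀ i, x i ∈ S) (hy : ∀ i, y i ∈ S) : x ⬝ᵥ y ∈ S :=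
  sum_mem fun i _ => mul_mem (hx i) (hy i)

lemma Matrix.mul_mem_subring {n : ℕ} {S : Subring ℂ} {A B : Matrix (Fin n) (Fin n) ℂ}
    (hA : ∀ i j, A i j ∈ S) (hB : ∀ i j, B i j ∈ S) (i j : Fin n) : (A * B) i j ∈ S :=
  dotProduct_mem_subring (hA i) fun k => hB k j

lemma mulVec_apply_of_unitriangular {n : ℕ} {X : Matrix (Fin n) (Fin n) ℂ}
    (hX : ∀ i j : Fin n, j < i → X i j = 0) (hX1 : ∀ i, X i i = 1) (x : Fin n → ℂ) (j : Fin n) :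
    (X *ᵥ x) j = x j + ∑ k ∈ Finset.univ.filter (fun k => j < k), X j k * x k := by
  rw [mulVec, dotProduct, Finset.sum_filter, ← Finset.add_sum_erase _ _ (Finset.mem_univ j),
    ← Finset.add_sum_erase _ (fun k => if j < k then _ else _) (Finset.mem_univ j), hX1]
  simp only [one_mul, lt_irrefl, if_false, zero_add, add_right_inj]
  refine Finset.sum_congr rfl fun k hk => ?_
  split_ifs with h
  · rfl
  · rw [hX j k (lt_of_le_of_ne (not_lt.1 h) (Finset.ne_of_mem_erase hk)), zero_mul]

/-- The sum minimised in the definition of a weakly reduced form, starting at index `i`. -/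
noncomputable def tailValue {n : ℕ} (X : Matrix (Fin n) (Fin n) ℂ) (h : Fin n → ℚ) (i : Fin n)
    (x : Fin n → ℂ) : ℝ :=
  ∑ j ∈ Finset.univ.filter (fun j => i ≤ j),
    (h j : ℝ) * Complex.normSq (x j + ∑ k ∈ Finset.univ.filter (fun k => j < k), X j k * x k)

lemma tailValue_single {n : ℕ} (X : Matrix (Fin n) (Fin n) ℂ) (h : Fin n → ℚ) (i : Fin n) :
    tailValue X h i (Pi.single i 1) = h i := by
  rw [tailValue, Finset.sum_eq_single_of_mem i (by simp)]
  · rw [Finset.sum_eq_zero]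
    · simp
    · intro k hk
      simp [(Finset.mem_filter.1 hk).2.ne']
  · intro j hj hji
    rw [Finset.sum_eq_zero]
    · simp [hji]
    · intro k hk
      have h1 := (Finset.mem_filter.1 hj).2
      have h2 := (Finset.mem_filter.1 hk).2
      simp [(h1.trans_lt h2).ne']

lemma tailValue_zero {n : ℕ} {X : Matrix (Fin (n + 1)) (Fin (n + 1)) ℂ}
    (hX : ∀ i j : Fin (n + 1), j < i → X i j = 0) (hX1 : ∀ i, X i i = 1) (h : Fin (n + 1) → ℚ)
    (x : Fin (n + 1) → ℂ) :
    tailValue X h 0 x = hermValue (Xᴴ * diagonal (fun i => (h i : ℂ)) * X) x := by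
  rw [hermValue_conj, hermValue_diagonal, tailValue]
  simp [mulVec_apply_of_unitriangular hX hX1]

lemma tailValue_succ {n : ℕ} (r : Fin n → ℂ) (X : Matrix (Fin n) (Fin n) ℂ) (q : ℚ)
    (h : Fin n → ℚ) (i : Fin n) (x : Fin (n + 1) → ℂ) :
    tailValue (bordered 1 r 0 X) (Fin.cons q h) i.succ x = tailValue X h i (Fin.tail x) := by
  simp [tailValue, Finset.sum_filter, Fin.sum_univ_succ, Fin.tail]

/-- A Gram matrix whose first diagonal entry is the minimum of the form can be reduced by reducing
the Schur complement of that entry. -/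
lemma exists_weaklyReduced_of_isLeast_zero {ℓ n : ℕ} (hpos : 0 < ℓ)
    (ih : ∀ M : Matrix (Fin n) (Fin n) ℂ, (∀ i j, M i j ∈ ringE ℓ) → M.PosDef →
      ∃ U W : Matrix (Fin n) (Fin n) ℂ, (∀ i j, U i j ∈ intO ℓ) ∧ (∀ i j, W i j ∈ intO ℓ) ∧
        U * W = 1 ∧ W * U = 1 ∧ WeaklyReducedH ℓ n (Uᴴ * M * U))
    {M : Matrix (Fin (n + 1)) (Fin (n + 1)) ℂ} (hME : ∀ i j, M i j ∈ ringE ℓ) (hM : M.PosDef)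
    (hmin : ∀ z : Fin (n + 1) → ℂ, (∀ i, z i ∈ intO ℓ) → z ≠ 0 → (M 0 0).re ≤ hermValue M z) :
    ∃ U W : Matrix (Fin (n + 1)) (Fin (n + 1)) ℂ,
      (∀ i j, U i j ∈ intO ℓ) ∧ (∀ i j, W i j ∈ intO ℓ) ∧
        U * W = 1 ∧ W * U = 1 ∧ WeaklyReducedH ℓ (n + 1) (Uᴴ * M * U) := by
  have h00 := Complex.lt_def.1 (hM.diag_pos (i := 0))
  obtain ⟨q, hq⟩ := exists_rat_of_mem_ringE hpos (hME 0 0) h00.2.symm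
  have hq0 : 0 < q := by simpa [hq] using h00.1
  have hqC : (q : ℂ) ≠ 0 := by exact_mod_cast hq0.ne'
  let r : Fin n → ℂ := fun j => ((q⁻¹ : ℚ) : ℂ) * M 0 j.succ
  have hr (j) : r j ∈ ringE ℓ := mul_mem (ratCast_mem_ringE ℓ _) (hME _ _)
  have hqr (j) : (q : ℂ) * r j = M 0 j.succ := by
    simp only [r]; push_cast; exact mul_inv_cancel_left₀ hqC _
  let C : Matrix (Fin n) (Fin n) ℂ :=
    Matrix.of fun i j => M i.succ j.succ - star (r i) * (q * r j)
  have hCE (i j) : C i j ∈ ringE ℓ :=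
    sub_mem (hME _ _) (mul_mem (star_mem_ringE (hr i)) (mul_mem (ratCast_mem_ringE ℓ q) (hr j)))
  let T := bordered 1 r 0 1
  let T' := bordered 1 (-r) 0 1
  have hTT' : T * T' = 1 := by
    rw [← bordered_one, bordered_mul]; simp [vecMul_one, mulVec_zero]
  have hT : IsUnit T := IsUnit.of_mul_eq_one _ hTT'
  have hMT : M = Tᴴ * bordered q 0 0 C * T := by
    rw [bordered_conjTranspose, bordered_mul, bordered_mul]
    apply bordered_ext
    · simp [hq]
    · intro j; simp [hqr]
    · intro i
      have := hM.isHermitian.apply i.succ 0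
      rw [← this, ← hqr]
      simp [mul_comm]
    · intro i j
      simp [C, vecMulVec_apply]
      ring
  have hC : C.PosDef := by
    have h1 : (bordered q 0 0 C).PosDef :=
      (Matrix.IsUnit.posDef_star_left_conjugate_iff hT).1 <| by
        rwa [star_eq_conjTranspose, ← hMT]
    exact h1.submatrix (e := Fin.succ) (Fin.succ_injective n)
  obtain ⟨V, W, hV, hW, hVW, hWV, X, h, hCX, hXE, hX, hX1, hh, hleast⟩ := ih C hCE hC
  let Y := bordered 1 (r ᵥ* V) 0 X
  have hY : ∀ i j : Fin (n + 1), j < i → Y i j = 0 := by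
    intro i j hij
    cases i using Fin.cases with
    | zero => exact absurd hij (Fin.not_lt_zero j)
    | succ i =>
      cases j using Fin.cases with
      | zero => simp [Y]
      | succ j => simpa [Y] using hX i j (Fin.succ_lt_succ_iff.1 hij)
  have hY1 : ∀ i, Y i i = 1 := by
    intro i
    cases i using Fin.cases with
    | zero => simp [Y]
    | succ i => simpa [Y] using hX1 i
  let U := bordered 1 0 0 V
  have hU (i j) : U i j ∈ intO ℓ :=
    bordered_mem (one_mem _) (fun _ => zero_mem _) (fun _ => zero_mem _) hV i j
  have hU0 {x : Fin (n + 1) → ℂ} (hx : x ≠ 0) : U *ᵥ x ≠ 0 := by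
    intro h0
    apply hx
    have hWU : bordered 1 0 0 W * U = 1 := by
      rw [bordered_mul, ← bordered_one]; simp [hWV]
    rw [← one_mulVec x, ← hWU, ← mulVec_mulVec, h0, mulVec_zero]
  have hgram : Uᴴ * M * U =
      Yᴴ * diagonal (fun i => ((Fin.cons q h : Fin (n + 1) → ℚ) i : ℂ)) * Y := by
    have hTU : T * U = bordered 1 (r ᵥ* V) 0 V := by
      rw [bordered_mul]; simp
    have h1 : Uᴴ * M * U = (T * U)ᴴ * bordered q 0 0 C * (T * U) := by
      rw [hMT, conjTranspose_mul]; simp only [Matrix.mul_assoc]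
    rw [h1, hTU, diagonal_cons]
    simp only [Y, bordered_conjTranspose, bordered_mul]
    simp [hCX]
  refine ⟨U, bordered 1 0 0 W, hU,
    bordered_mem (one_mem _) (fun _ => zero_mem _) (fun _ => zero_mem _) hW, ?_, ?_,
    Y, Fin.cons q h, hgram, ?_, hY, hY1, ?_, fun i => ⟨?_, ?_⟩⟩
  · rw [bordered_mul, ← bordered_one]; simp [hVW]
  · rw [bordered_mul, ← bordered_one]; simp [hWV]
  · exact bordered_mem (S := ringE ℓ) (one_mem _)
      (fun j => dotProduct_mem_subring hr fun k => intO_le_ringE ℓ (hV k j))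
      (fun _ => zero_mem _) hXE
  · intro i
    cases i using Fin.cases with
    | zero => simpa using hq0
    | succ i => simpa using hh i
  · refine ⟨Pi.single i 1, fun j => ?_, by simp, fun j hj => by simp [hj.ne],
      (tailValue_single _ _ i).symm⟩
    rw [Pi.single_apply]
    split_ifs
    exacts [one_mem _, zero_mem _]
  · rintro _ ⟨x, hx, hx0, hxi, rfl⟩
    change _ ≤ tailValue Y (Fin.cons q h) i x
    cases i using Fin.cases with
    | zero =>
      rw [tailValue_zero hY hY1, ← hgram, hermValue_conj]
      have := hmin (U *ᵥ x) (fun i => dotProduct_mem_subring (hU i) hx) (hU0 hx0)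
      simpa [hq] using this
    | succ i =>
      rw [tailValue_succ, Fin.cons_succ]
      refine (hleast i).2 ⟨Fin.tail x, fun j => hx _, fun h0 => hx0 (funext fun j => ?_),
        fun j hj => hxi _ (Fin.succ_lt_succ_iff.2 hj), rfl⟩
      cases j using Fin.cases with
      | zero => exact hxi 0 (Fin.succ_pos i)
      | succ j => exact congrFun h0 j

/-- A Gram matrix is integrally equivalent to one whose first diagonal entry is the minimum of the
form. -/
lemma exists_conj_isLeast_zero {ℓ n : ℕ} (hpos : 0 < ℓ) (hPID : IsPrincipalIdealRing (intO ℓ))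
    {M : Matrix (Fin (n + 1)) (Fin (n + 1)) ℂ} (hME : ∀ i j, M i j ∈ ringE ℓ) (hM : M.PosDef) :
    ∃ U W : Matrix (Fin (n + 1)) (Fin (n + 1)) ℂ,
      (∀ i j, U i j ∈ intO ℓ) ∧ (∀ i j, W i j ∈ intO ℓ) ∧ U * W = 1 ∧ W * U = 1 ∧
        ∀ z : Fin (n + 1) → ℂ, (∀ i, z i ∈ intO ℓ) → z ≠ 0 →
          ((Uᴴ * M * U) 0 0).re ≤ hermValue (Uᴴ * M * U) z := by
  obtain ⟨x, hx, hx0, hmin⟩ := hM.exists_isLeast_hermValue hpos hME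
  obtain ⟨g, y, a, hg, hxy, hay⟩ := exists_primitive_of_ne_zero
    (x := fun i => (⟨x i, hx i⟩ : intO ℓ))
    (fun h => hx0 (funext fun i => congrArg Subtype.val (congrFun h i)))
  obtain ⟨A, B, hAB, hBA, hA⟩ := exists_unimodular_of_dotProduct_eq_one hay
  let f := (intO ℓ).subtype
  have hAB' : A.map f * B.map f = 1 := by rw [← Matrix.map_mul, hAB]; simp
  have hBA' : B.map f * A.map f = 1 := by rw [← Matrix.map_mul, hBA]; simp
  refine ⟨A.map f, B.map f, fun i j => (A i j).2, fun i j => (B i j).2, hAB', hBA',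
    fun z hz hz0 => ?_⟩
  have hz0' : A.map f *ᵥ z ≠ 0 := fun h0 => hz0 <| by
    rw [← one_mulVec z, ← hBA', ← mulVec_mulVec, h0, mulVec_zero]
  have hcol : A.map f *ᵥ Pi.single 0 1 = fun i => (y i : ℂ) := by
    ext i; simp [hA, f]
  have h00 : (((A.map f)ᴴ * M * A.map f) 0 0).re = hermValue M fun i => (y i : ℂ) := by
    rw [← hcol, ← hermValue_conj, hermValue]
    simp
  have hy0 : (fun i => (y i : ℂ)) ≠ 0 := by
    intro h0
    have : y = 0 := funext fun i => Subtype.ext (congrFun h0 i)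
    simp [this] at hay
  have hxg : x = (g : ℂ) • fun i => (y i : ℂ) :=
    funext fun i => congrArg Subtype.val (congrFun hxy i)
  rw [h00, hermValue_conj]
  refine le_trans ?_ (hmin _ (fun i => dotProduct_mem_subring (fun j => (A i j).2) hz) hz0')
  rw [hxg, hermValue_smul]
  exact le_mul_of_one_le_left (hM.hermValue_pos hy0).le
    (one_le_normSq_of_mem_intO hpos g.2 fun h => hg (Subtype.ext h))

end Reduction

/-- Suppose `𝓞` is a principal ideal domain.  Every positive definite hermitian form over
`E` is integrally equivalent (via some `U ∈ GLₙ(𝓞)`) to a weakly reduced form. -/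
theorem weakly_reduced_exists_hermitian (ℓ : ℕ) (hsf : Squarefree ℓ) (hpos : 0 < ℓ)
    (hPID : IsPrincipalIdealRing (intO ℓ))
    (n : ℕ) (M : Matrix (Fin n) (Fin n) ℂ) (hME : ∀ i j, memE ℓ (M i j))
    (hpd : M.PosDef) :
    ∃ U W : Matrix (Fin n) (Fin n) ℂ,
      (∀ i j, U i j ∈ intO ℓ) ∧ (∀ i j, W i j ∈ intO ℓ) ∧
      U * W = 1 ∧ W * U = 1 ∧
      WeaklyReducedH ℓ n (Uᴴ * M * U) := by
  induction n with
  | zero =>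
    exact ⟨1, 1, fun i => i.elim0, fun i => i.elim0, one_mul 1, one_mul 1, 1, fun _ => 1,
      Subsingleton.elim _ _, fun i => i.elim0, fun i => i.elim0, fun i => i.elim0,
      fun i => i.elim0, fun i => i.elim0⟩
  | succ n ih =>
    obtain ⟨U, W, hU, hW, hUW, hWU, hmin⟩ := exists_conj_isLeast_zero hpos hPID hME hpd
    have hUE (i j) : U i j ∈ ringE ℓ := intO_le_ringE ℓ (hU i j)
    obtain ⟨V, Z, hV, hZ, hVZ, hZV, hred⟩ := exists_weaklyReduced_of_isLeast_zero hpos ih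
      (Matrix.mul_mem_subring
        (Matrix.mul_mem_subring (fun i j => star_mem_ringE (hUE j i)) hME) hUE)
      ((Matrix.IsUnit.posDef_star_left_conjugate_iff (IsUnit.of_mul_eq_one W hUW)).2 hpd) hmin
    refine ⟨U * V, Z * W, Matrix.mul_mem_subring hU hV, Matrix.mul_mem_subring hZ hW, ?_, ?_, ?_⟩
    · rw [Matrix.mul_assoc, ← Matrix.mul_assoc V, hVZ, Matrix.one_mul, hUW]
    · rw [Matrix.mul_assoc, ← Matrix.mul_assoc W, hWU, Matrix.one_mul, hZV]
    · have : (U * V)ᴴ * M * (U * V) = Vᴴ * (Uᴴ * M * U) * V := by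
        simp only [conjTranspose_mul, Matrix.mul_assoc]
      rwa [this]
end

section
/- Suppose 𝓞 is a principal ideal domain (equivalently, E has class number 1). Let M = X*HX be the Gram matrix of a weakly reduced positive definite hermitian form over E in n variables, with H = diag(h₁,…,hₙ). Then for all 1 ≤ i < j ≤ n, hᵢ/hⱼ ≤ α_E(j−i). -/
open scoped Matrix ComplexOrder

/-- The discriminant of `E = ℚ(√−ℓ)`: `−ℓ` if `ℓ ≡ 3 (mod 4)`, `−4ℓ` otherwise. -/
def discE (ℓ : ℕ) : ℤ := if ℓ % 4 = 3 then -(ℓ : ℤ) else -(4 * (ℓ : ℤ))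

/-- `ω_m = π^{m/2}/Γ(m/2+1)`, the volume of the unit ball in `ℝ^m`. -/
noncomputable def unitBallVol (m : ℕ) : ℝ :=
  Real.pi ^ ((m : ℝ) / 2) / Real.Gamma ((m : ℝ) / 2 + 1)

/-- `σ_{k,E} = 2·ω_{2k}^{−1/k}·|d_E|^{1/2}`. -/
noncomputable def sigmaE (ℓ k : ℕ) : ℝ :=
  2 * unitBallVol (2 * k) ^ (-(1 : ℝ) / k) * Real.sqrt |(discE ℓ : ℝ)|

/-- `α_E(m) = σ_{m+1,E}·∏_{k=2}^{m+1} σ_{k,E}^{1/(k−1)}`. -/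
noncomputable def alphaE (ℓ m : ℕ) : ℝ :=
  sigmaE ℓ (m + 1) * ∏ k ∈ Finset.Icc 2 (m + 1), sigmaE ℓ k ^ ((1 : ℝ) / ((k : ℝ) - 1))

open MeasureTheory Module

/-- If `Im w ≠ 0`, then `{1, w}` is a real basis of `ℂ` whose fundamental domain has area
`|Im w|`. -/
lemma Complex.exists_basis_one_pair (w : ℂ) (hw : w.im ≠ 0) :
    ∃ b : Basis (Fin 2) ℝ ℂ, ⇑b = ![1, w] ∧
      volume (ZSpan.fundamentalDomain b) = ENNReal.ofReal |w.im| := by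
  have hli : LinearIndependent ℝ ![(1 : ℂ), w] := by
    rw [LinearIndependent.pair_iff]
    intro s t hst
    have him := congrArg Complex.im hst
    have hre := congrArg Complex.re hst
    simp at him hre
    have ht : t = 0 := him.resolve_right hw
    simp [ht] at hre
    exact ⟨hre, ht⟩
  let b := basisOfLinearIndependentOfCardEqFinrank hli (by simp [Complex.finrank_real_complex])
  have hb : ⇑b = ![1, w] := coe_basisOfLinearIndependentOfCardEqFinrank _ _
  refine ⟨b, hb, ?_⟩
  rw [ZSpan.measure_fundamentalDomain b volume Complex.basisOneI]
  have h1 : volume (ZSpan.fundamentalDomain Complex.basisOneI) = 1 := by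
    rw [measure_congr (ZSpan.fundamentalDomain_ae_parallelepiped Complex.basisOneI volume),
      ← Complex.toBasis_orthonormalBasisOneI, OrthonormalBasis.coe_toBasis]
    exact Complex.orthonormalBasisOneI.volume_parallelepiped
  rw [h1, mul_one, hb, Basis.det_apply, Matrix.det_fin_two]
  simp [Basis.toMatrix_apply]

/-- Minkowski's convex body theorem for hermitian forms `x ↦ ‖A x‖²` on the lattice
`(ℤ + ℤw)^m`. -/
lemma minkowski_hermitian {ι : Type*} [Fintype ι] [DecidableEq ι] [Nonempty ι] (w : ℂ)
    (hw : w.im ≠ 0) (A : Matrix ι ι ℂ) (hA : A.det ≠ 0) (c : ℝ) (hc : 0 < c)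
    (hmin : ∀ x : ι → ℂ, x ≠ 0 → (∀ i, ∃ a b : ℤ, x i = a + b * w) →
      c ≤ ∑ i, Complex.normSq ((A.mulVec x) i)) :
    c ^ Fintype.card ι * (Real.pi ^ Fintype.card ι / Real.Gamma (Fintype.card ι + 1)) ≤
      Complex.normSq A.det * (|w.im| ^ Fintype.card ι * 4 ^ Fintype.card ι) := by
  obtain ⟨b, hb, hvol⟩ := Complex.exists_basis_one_pair w hw
  let B := Pi.basis (fun _ : ι => b)
  have hdom : ZSpan.fundamentalDomain B =
      Set.pi Set.univ (fun _ : ι => ZSpan.fundamentalDomain b) := by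
    ext x
    simp only [ZSpan.mem_fundamentalDomain, Set.mem_pi, Set.mem_univ, true_imp_iff, B,
      Pi.basis_repr, Sigma.forall]
  have hvolB : volume (ZSpan.fundamentalDomain B) = ENNReal.ofReal (|w.im| ^ Fintype.card ι) := by
    rw [hdom, volume_pi_pi]
    simp [hvol, ENNReal.ofReal_pow]
  let f : (ι → ℂ) →ₗ[ℝ] (ι → ℂ) := (Matrix.toLin' A).restrictScalars ℝ
  have hfdet : LinearMap.det f = Complex.normSq A.det := by
    simp only [f]
    rw [LinearMap.det_restrictScalars, LinearMap.det_toLin', Algebra.norm_complex_apply]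
  have hdetpos : 0 < Complex.normSq A.det := Complex.normSq_pos.mpr hA
  let T : Set (ι → ℂ) := {x | (∑ i, ‖x i‖ ^ (2 : ℝ)) ^ (1 / (2 : ℝ)) < √c}
  have hT : ∀ x, x ∈ T ↔ ∑ i, Complex.normSq (x i) < c := by
    intro x
    simp only [T, Set.mem_ofPred_eq, ← Real.sqrt_eq_rpow]
    rw [Real.sqrt_lt_sqrt_iff (by positivity)]
    simp [Complex.normSq_eq_norm_sq]
  have hTvol : volume T = ENNReal.ofReal
      (c ^ Fintype.card ι * (Real.pi ^ Fintype.card ι / Real.Gamma (Fintype.card ι + 1))) := by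
    refine (Complex.volume_sum_rpow_lt ι one_le_two √c).trans ?_
    rw [← ENNReal.ofReal_pow (by positivity),
      ← ENNReal.ofReal_mul (by positivity), pow_mul, Real.sq_sqrt hc.le]
    congr 4
    · norm_num
    · congr 1; ring
  have hTconv : Convex ℝ T := by
    have hball : T = (WithLp.linearEquiv 2 ℝ (ι → ℂ)).symm.toLinearMap ⁻¹'
        Metric.ball 0 (√c) := by
      ext x
      rw [hT, Set.mem_preimage, mem_ball_zero_iff, EuclideanSpace.norm_eq,
        Real.sqrt_lt_sqrt_iff (by positivity)]
      simp [Complex.normSq_eq_norm_sq]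
    rw [hball]
    exact (convex_ball _ _).linear_preimage _
  have hsvol := Measure.addHaar_preimage_linearMap (μ := volume) (f := f)
    (by rw [hfdet]; exact hdetpos.ne') T
  by_contra! hlt
  have : Countable (Submodule.span ℤ (Set.range B)).toAddSubgroup :=
    inferInstanceAs (Countable (Submodule.span ℤ (Set.range B)))
  have key := exists_ne_zero_mem_lattice_of_measure_mul_two_pow_lt_measure
    (L := (Submodule.span ℤ (Set.range B)).toAddSubgroup) (s := f ⁻¹' T)
    (ZSpan.isAddFundamentalDomain' B volume) ?_ ?_ ?_
  · obtain ⟨x, hx0, hxT⟩ := key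
    have hx0' : (x : ι → ℂ) ≠ 0 := fun h => hx0 (Subtype.ext h)
    have hxL : (x : ι → ℂ) ∈ Submodule.span ℤ (Set.range B) := x.2
    have hrep : ∀ i, ∃ a b : ℤ, (x : ι → ℂ) i = a + b * w := by
      intro i
      rw [B.mem_span_iff_repr_mem ℤ] at hxL
      obtain ⟨a0, ha0⟩ := hxL ⟨i, 0⟩
      obtain ⟨a1, ha1⟩ := hxL ⟨i, 1⟩
      refine ⟨a0, a1, ?_⟩
      have := b.sum_repr ((x : ι → ℂ) i)
      rw [Fin.sum_univ_two, hb] at this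
      simp only [B, Pi.basis_repr] at ha0 ha1
      rw [← ha0, ← ha1] at this
      rw [← this]
      simp
    have h3 := hmin x hx0' hrep
    have h4 := (hT _).1 hxT
    exact absurd h4 (not_lt.mpr h3)
  · intro x hx
    simp only [Set.mem_preimage, hT, map_neg, Pi.neg_apply, Complex.normSq_neg] at hx ⊢
    exact hx
  · exact hTconv.linear_preimage f
  · rw [hsvol, hTvol, hvolB, hfdet, ← ENNReal.ofReal_mul (by positivity)]
    have : (2 : ENNReal) ^ finrank ℝ (ι → ℂ) = ENNReal.ofReal (4 ^ Fintype.card ι) := by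
      rw [Module.finrank_pi_fintype]
      simp only [Complex.finrank_real_complex, Finset.sum_const, Finset.card_univ, smul_eq_mul]
      rw [mul_comm, pow_mul, ENNReal.ofReal_pow (by norm_num)]
      norm_num
    rw [this, ← ENNReal.ofReal_mul (by positivity), abs_of_pos (inv_pos.mpr hdetpos),
      inv_mul_eq_div]
    have h5 : |w.im| ^ Fintype.card ι * 4 ^ Fintype.card ι <
        c ^ Fintype.card ι * (Real.pi ^ Fintype.card ι / Real.Gamma (Fintype.card ι + 1)) /
          Complex.normSq A.det := by
      rw [lt_div_iff₀ hdetpos, mul_comm]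
      exact hlt
    exact (ENNReal.ofReal_lt_ofReal_iff (lt_of_le_of_lt (by positivity) h5)).mpr h5

/-- The Korkin–Zolotarev recursion: a bound for `a k / a 0` from Hermite-type inequalities. -/
lemma div_le_mul_prod_rpow_of_pow_le (a s : ℕ → ℝ) (ha : ∀ k, 0 < a k) (hs : ∀ k, 0 < s k)
    (N : ℕ) (h : ∀ k, 1 ≤ k → k ≤ N →
      a k ^ (k + 1) ≤ s (k + 1) ^ (k + 1) * ∏ t ∈ Finset.range (k + 1), a t)
    (hN : 1 ≤ N) :
    a N / a 0 ≤ s (N + 1) *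
      ∏ k ∈ Finset.Icc 2 (N + 1), s k ^ ((1 : ℝ) / ((k : ℝ) - 1)) := by
  have hlog : ∀ k, 1 ≤ k → k ≤ N → ((k : ℝ) + 1) * Real.log (a k) ≤
      (k + 1) * Real.log (s (k + 1)) + ∑ t ∈ Finset.range (k + 1), Real.log (a t) := by
    intro k h1 h2
    have h3 := Real.log_le_log (pow_pos (ha k) _) (h k h1 h2)
    rw [Real.log_mul (pow_pos (hs _) _).ne' (Finset.prod_pos fun t _ => ha t).ne',
      Real.log_pow, Real.log_pow, Real.log_prod (fun t _ => (ha t).ne')] at h3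
    push_cast at h3
    exact h3
  have hmean : ∀ k, k ≤ N → (∑ t ∈ Finset.range (k + 1), Real.log (a t)) / ((k : ℝ) + 1) ≤
      Real.log (a 0) + ∑ t ∈ Finset.Icc 2 (k + 1), (1 / ((t : ℝ) - 1)) * Real.log (s t) := by
    intro k
    induction k with
    | zero => simp
    | succ k ih =>
      intro hk
      have h1 := ih (by omega)
      have h2 := hlog (k + 1) (by omega) hk
      rw [Finset.sum_range_succ] at h2 ⊢
      rw [Finset.sum_Icc_succ_top (by omega)]
      set P := ∑ t ∈ Finset.range (k + 1), Real.log (a t)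
      have h3 : (P + Real.log (a (k + 1))) / ((k + 1 : ℕ) + 1 : ℝ) ≤
          1 / (((k + 1 + 1 : ℕ) : ℝ) - 1) * Real.log (s (k + 1 + 1)) + P / ((k : ℝ) + 1) := by
        push_cast at h2 ⊢
        have hk0 : (0 : ℝ) < k + 1 := by positivity
        have e : 1 / ((k : ℝ) + 1 + 1 - 1) * Real.log (s (k + 1 + 1)) + P / ((k : ℝ) + 1) =
            (Real.log (s (k + 1 + 1)) + P) / ((k : ℝ) + 1) := by
          rw [add_sub_cancel_right]; ring
        rw [e, div_le_div_iff₀ (by positivity) hk0]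
        linarith
      linarith
  have h1 := hlog N hN le_rfl
  have h2 := hmean N le_rfl
  have hN0 : (0 : ℝ) < N + 1 := by positivity
  rw [div_le_iff₀ hN0] at h2
  have h3 : Real.log (a N) ≤ Real.log (s (N + 1)) + (Real.log (a 0) +
      ∑ t ∈ Finset.Icc 2 (N + 1), (1 / ((t : ℝ) - 1)) * Real.log (s t)) :=
    le_of_mul_le_mul_left (by linarith) hN0
  rw [← Real.log_le_log_iff (div_pos (ha _) (ha _))
    (mul_pos (hs _) (Finset.prod_pos fun t _ => Real.rpow_pos_of_pos (hs t) _)),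
    Real.log_div (ha _).ne' (ha _).ne', Real.log_mul (hs _).ne'
    (Finset.prod_pos fun t _ => Real.rpow_pos_of_pos (hs t) _).ne',
    Real.log_prod (fun t _ => (Real.rpow_pos_of_pos (hs t) _).ne')]
  simp only [Real.log_rpow (hs _)]
  linarith

lemma abs_omegaC_im (ℓ : ℕ) : |(omegaC ℓ).im| = √|(discE ℓ : ℝ)| / 2 := by
  unfold omegaC discE
  split_ifs
  · have : 0 ≤ √(ℓ : ℝ) / 2 := by positivity
    simp [abs_of_nonneg this]
  · have : √(4 * (ℓ : ℝ)) = 2 * √ℓ := by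
      rw [Real.sqrt_mul (by norm_num), show (4 : ℝ) = 2 ^ 2 by norm_num,
        Real.sqrt_sq (by norm_num)]
    simp [abs_of_nonneg, this]

lemma unitBallVol_two_mul (m : ℕ) :
    unitBallVol (2 * m) = Real.pi ^ m / Real.Gamma (m + 1) := by
  have : ((2 * m : ℕ) : ℝ) / 2 = m := by push_cast; ring
  rw [unitBallVol, this, Real.rpow_natCast]

lemma unitBallVol_two_mul_pos (m : ℕ) : 0 < unitBallVol (2 * m) := by
  rw [unitBallVol_two_mul]
  positivity

lemma sigmaE_pos {ℓ : ℕ} (hpos : 0 < ℓ) (k : ℕ) : 0 < sigmaE ℓ k := by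
  have h1 := Real.rpow_pos_of_pos (unitBallVol_two_mul_pos k) (-(1 : ℝ) / k)
  have h2 : (discE ℓ : ℝ) ≠ 0 := by
    unfold discE
    split_ifs <;> simp [hpos.ne']
  unfold sigmaE
  positivity

lemma sigmaE_pow (ℓ : ℕ) {k : ℕ} (hk : k ≠ 0) :
    sigmaE ℓ k ^ k = 2 ^ k * (unitBallVol (2 * k))⁻¹ * √|(discE ℓ : ℝ)| ^ k := by
  rw [sigmaE, mul_pow, mul_pow, ← Real.rpow_natCast (_ ^ _),
    ← Real.rpow_mul (unitBallVol_two_mul_pos k).le,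
    div_mul_cancel₀ _ (by exact_mod_cast hk), Real.rpow_neg_one]

/-- Hermite's inequality for hermitian forms over `ℤ[ω]`, with Minkowski's constant. -/
lemma hermite_hermitian {ℓ : ℕ} (hpos : 0 < ℓ) {k : ℕ} (A : Matrix (Fin (k + 1)) (Fin (k + 1)) ℂ)
    (hA : A.det ≠ 0) (c : ℝ) (hc : 0 < c)
    (hmin : ∀ x : Fin (k + 1) → ℂ, x ≠ 0 → (∀ i, x i ∈ intO ℓ) →
      c ≤ ∑ i, Complex.normSq ((A.mulVec x) i)) :
    c ^ (k + 1) ≤ sigmaE ℓ (k + 1) ^ (k + 1) * Complex.normSq A.det := by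
  have hd : (discE ℓ : ℝ) ≠ 0 := by
    unfold discE
    split_ifs <;> simp [hpos.ne']
  have hw : (omegaC ℓ).im ≠ 0 := by
    rw [← abs_pos, abs_omegaC_im]
    positivity
  have h1 := minkowski_hermitian (omegaC ℓ) hw A hA c hc (by
    intro x hx hxO
    refine hmin x hx fun i => ?_
    obtain ⟨a, b, hab⟩ := hxO i
    rw [hab]
    exact add_mem (intCast_mem _ a)
      (mul_mem (intCast_mem _ b) (Subring.subset_closure (Set.mem_singleton _))))
  rw [Fintype.card_fin, ← unitBallVol_two_mul, abs_omegaC_im, ← mul_pow,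
    ← le_div_iff₀ (unitBallVol_two_mul_pos _)] at h1
  refine h1.trans_eq ?_
  rw [sigmaE_pow ℓ k.add_one_ne_zero, div_eq_mul_inv,
    show √|(discE ℓ : ℝ)| / 2 * 4 = 2 * √|(discE ℓ : ℝ)| by ring, mul_pow]
  ring

/-- Hermite's inequality for the diagonal blocks of a weakly reduced form. -/
lemma pow_le_sigmaE_pow_mul_prod {ℓ : ℕ} (hpos : 0 < ℓ) {n : ℕ}
    (X : Matrix (Fin n) (Fin n) ℂ) (h : Fin n → ℝ)
    (hXlt : ∀ i j : Fin n, j < i → X i j = 0) (hXdiag : ∀ i, X i i = 1)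
    (hhpos : ∀ i, 0 < h i) {i k : ℕ} (hik : i + k < n)
    (hmin : ∀ x : Fin n → ℂ, (∀ j, x j ∈ intO ℓ) → x ≠ 0 → (∀ j : Fin n, (j : ℕ) < i → x j = 0) →
      h ⟨i, by omega⟩ ≤ ∑ j ∈ Finset.univ.filter (fun j : Fin n => i ≤ (j : ℕ)),
        h j * Complex.normSq (x j + ∑ t ∈ Finset.univ.filter (fun t => j < t), X j t * x t)) :
    h ⟨i, by omega⟩ ^ (k + 1) ≤
      sigmaE ℓ (k + 1) ^ (k + 1) * ∏ t : Fin (k + 1), h ⟨i + t, by omega⟩ := by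
  let e : Fin (k + 1) → Fin n := fun t => ⟨i + t, by omega⟩
  have he : Function.Injective e := fun s t hst => by
    simp only [e, Fin.mk.injEq] at hst
    exact Fin.ext (by omega)
  let A : Matrix (Fin (k + 1)) (Fin (k + 1)) ℂ :=
    Matrix.of fun s t => (√(h (e s)) : ℂ) * X (e s) (e t)
  have hdet : A.det = ∏ s, (√(h (e s)) : ℂ) := by
    rw [Matrix.det_of_isUpperTriangular]
    · simp [A, hXdiag]
    · intro s t hst
      have : e t < e s := by
        simp only [e, Fin.mk_lt_mk]
        exact Nat.add_lt_add_left hst i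
      simp [A, hXlt _ _ this]
  have hnorm : Complex.normSq A.det = ∏ t, h (e t) := by
    rw [hdet, map_prod]
    refine Finset.prod_congr rfl fun t _ => ?_
    rw [Complex.normSq_ofReal, Real.mul_self_sqrt (hhpos _).le]
  have hA : A.det ≠ 0 := by
    rw [hdet]
    refine Finset.prod_ne_zero_iff.mpr fun t _ => ?_
    exact_mod_cast (Real.sqrt_pos.mpr (hhpos _)).ne'
  rw [show (∏ t : Fin (k + 1), h ⟨i + t, by omega⟩) = ∏ t, h (e t) from rfl, ← hnorm]
  refine hermite_hermitian hpos A hA _ (hhpos _) fun y hy hyO => ?_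
  let x : Fin n → ℂ := Function.extend e y (fun _ => 0)
  have hxe : ∀ t, x (e t) = y t := fun t => he.extend_apply y _ t
  have hx0 : ∀ j, j ∉ Set.range e → x j = 0 := fun j hj =>
    Function.extend_apply' y _ j hj
  have hrow : ∀ j, x j + ∑ t ∈ Finset.univ.filter (fun t => j < t), X j t * x t =
      ∑ s, X j (e s) * y s := by
    intro j
    have h1 : ∑ t, X j t * x t = ∑ s, X j (e s) * y s := by
      rw [← Finset.sum_subset (Finset.subset_univ (Finset.univ.image e)),
        Finset.sum_image he.injOn]
      · simp [hxe]
      · intro t _ ht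
        rw [hx0 t (by simpa using ht), mul_zero]
    rw [← h1, ← Finset.sum_subset (Finset.subset_univ (insert j (Finset.univ.filter (j < ·)))),
      Finset.sum_insert (by simp), hXdiag, one_mul]
    intro t _ ht
    simp only [Finset.mem_insert, Finset.mem_filter, Finset.mem_univ, true_and, not_or,
      not_lt] at ht
    rw [hXlt j t (lt_of_le_of_ne ht.2 ht.1), zero_mul]
  refine (hmin x ?_ ?_ ?_).trans_eq ?_
  · intro j
    by_cases hj : j ∈ Set.range e
    · obtain ⟨t, rfl⟩ := hj
      rw [hxe]
      exact hyO t
    · rw [hx0 j hj]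
      exact zero_mem _
  · intro hx
    exact hy (funext fun t => by rw [← hxe, hx]; rfl)
  · intro j hj
    refine hx0 j ?_
    rintro ⟨t, rfl⟩
    simp [e] at hj
  · rw [← Finset.sum_subset (s₁ := Finset.univ.image e), Finset.sum_image he.injOn]
    · refine Finset.sum_congr rfl fun t _ => ?_
      have : A.mulVec y t = (√(h (e t)) : ℂ) * ∑ s, X (e t) (e s) * y s := by
        simp [A, Matrix.mulVec, dotProduct, Finset.mul_sum, mul_assoc]
      rw [hrow, this, Complex.normSq_mul, Complex.normSq_ofReal, Real.mul_self_sqrt (hhpos _).le]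
    · intro j hj
      obtain ⟨t, -, rfl⟩ := Finset.mem_image.mp hj
      simp [e]
    · intro j hj hj'
      rw [hrow, Finset.sum_eq_zero, map_zero, mul_zero]
      intro s _
      rw [hXlt, zero_mul]
      simp only [Finset.mem_filter, Finset.mem_univ, true_and] at hj
      by_contra hlt
      simp only [e, Fin.lt_def, not_lt] at hlt
      have hs := s.2
      exact hj' (Finset.mem_image.mpr ⟨⟨(j : ℕ) - i, by omega⟩, Finset.mem_univ _,
        Fin.ext (by simp [e]; omega)⟩)

/-- Suppose `𝓞` is a principal ideal domain.  If `M = X*HX` is the Gram matrix of a weakly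
reduced positive definite hermitian form over `E` in `n` variables, with
`H = diag(h₁,…,hₙ)`, then `hᵢ/hⱼ ≤ α_E(j−i)` for all `1 ≤ i < j ≤ n`. -/
theorem weakly_reduced_ratio_bound_hermitian (ℓ : ℕ) (hsf : Squarefree ℓ) (hpos : 0 < ℓ)
    (hPID : IsPrincipalIdealRing (intO ℓ))
    (n : ℕ) (M X : Matrix (Fin n) (Fin n) ℂ) (h : Fin n → ℚ)
    (hM : M = Xᴴ * Matrix.diagonal (fun i => (h i : ℂ)) * X)
    (hXE : ∀ i j, memE ℓ (X i j))
    (hXlt : ∀ i j : Fin n, j < i → X i j = 0) (hXdiag : ∀ i, X i i = 1)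
    (hhpos : ∀ i, 0 < h i) (hpd : M.PosDef)
    (hmin : ∀ i : Fin n,
      IsLeast {q : ℝ | ∃ x : Fin n → ℂ, (∀ j, x j ∈ intO ℓ) ∧ x ≠ 0 ∧
          (∀ j, j < i → x j = 0) ∧
          q = ∑ j ∈ Finset.univ.filter (fun j => i ≤ j),
                (h j : ℝ) * Complex.normSq (x j +
                  ∑ k ∈ Finset.univ.filter (fun k => j < k), X j k * x k)}
        ((h i : ℝ))) :
    ∀ i j : Fin n, i < j → ((h i / h j : ℚ) : ℝ) ≤ alphaE ℓ ((j : ℕ) - (i : ℕ)) := by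
  intro i j hij
  let hr : Fin n → ℝ := fun t => (h t : ℝ)
  have hrpos : ∀ t, 0 < hr t := fun t => Rat.cast_pos.mpr (hhpos t)
  let g : ℕ → ℝ := fun t => if ht : t < n then hr ⟨t, ht⟩ else 1
  have hg : ∀ t (ht : t < n), g t = hr ⟨t, ht⟩ := fun t ht => dif_pos ht
  have hgpos : ∀ t, 0 < g t := by
    intro t
    simp only [g]
    split_ifs
    exacts [hrpos _, one_pos]
  have hij' : (i : ℕ) < j := hij
  have hj := j.2
  have key := div_le_mul_prod_rpow_of_pow_le (fun t => g (j - t)) (sigmaE ℓ)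
    (fun _ => hgpos _) (sigmaE_pos hpos) ((j : ℕ) - i) ?_ (by omega)
  · rw [alphaE]
    refine le_of_eq_of_le ?_ key
    have e1 : (j : ℕ) - (j - i) = i := by omega
    simp only [e1, Nat.sub_zero, hg _ i.2, hg _ j.2, hr]
    push_cast
    rfl
  · intro k _ hk
    have hlt : (j : ℕ) - k + k < n := by omega
    have hb := pow_le_sigmaE_pow_mul_prod hpos X hr hXlt hXdiag hrpos hlt (by
      intro x hxO hx hx0
      exact (hmin ⟨(j : ℕ) - k, by omega⟩).2 ⟨x, hxO, hx, fun t ht => hx0 t ht, rfl⟩)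
    have e2 : ∏ t ∈ Finset.range (k + 1), g (j - t) =
        ∏ t : Fin (k + 1), hr ⟨(j : ℕ) - k + t, by omega⟩ := by
      rw [← Finset.prod_range_reflect, Finset.prod_range]
      refine Finset.prod_congr rfl fun t _ => ?_
      have ht := t.2
      rw [show (j : ℕ) - (k + 1 - 1 - t) = j - k + t by omega, hg]
    rw [e2]
    simp only [hg _ (show (j : ℕ) - k < n by omega)]
    exact hb
end

section
/- There is an absolute constant D₁ > 0 such that for every integer m ≥ 1: (i) α_ℚ(m) ≤ D₁·e^{(ln m)²/2}; and (ii) for every squarefree positive integer ℓ, with d the discriminant of ℚ(√−ℓ) (d = −ℓ if ℓ ≡ 3 (mod 4), d = −4ℓ otherwise), α_E(m) ≤ D₁·|d|^{(1+Σ(m))/2}·e^{(ln m)²/2}, where Σ(m) = 1 + 1/2 + ⋯ + 1/m is the m-th harmonic number. -/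
/-- `σ_{k,ℚ} = 4·ω_k^{−2/k}`. -/
noncomputable def sigmaQ (k : ℕ) : ℝ := 4 * unitBallVol k ^ (-(2 : ℝ) / k)

/-- `α_ℚ(m) = σ_{m+1,ℚ}·∏_{k=2}^{m+1} σ_{k,ℚ}^{1/(k−1)}`. -/
noncomputable def alphaQ (m : ℕ) : ℝ :=
  sigmaQ (m + 1) * ∏ k ∈ Finset.Icc 2 (m + 1), sigmaQ k ^ ((1 : ℝ) / ((k : ℝ) - 1))

/-- `Σ(m) = 1 + 1/2 + ⋯ + 1/m`, the `m`-th harmonic number. -/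
noncomputable def harmonicSum (m : ℕ) : ℝ := ∑ k ∈ Finset.Icc 1 m, (1 : ℝ) / k

/-- A logarithmic form of Stirling's upper bound. -/
theorem log_factorial_le {n : ℕ} (hn : 1 ≤ n) :
    Real.log (n.factorial : ℝ) ≤ n * Real.log n - n + 1 + Real.log n / 2 := by
  obtain ⟨k, rfl⟩ : ∃ k, n = k + 1 := ⟨n - 1, by omega⟩
  have hanti := Stirling.log_stirlingSeq'_antitone (Nat.zero_le k)
  simp only [Function.comp, Nat.succ_eq_add_one] at hanti
  rw [Stirling.log_stirlingSeq_formula, Stirling.log_stirlingSeq_formula] at hanti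
  have hpos : (0 : ℝ) < ((k + 1 : ℕ) : ℝ) := by positivity
  rw [Real.log_mul (by norm_num) hpos.ne', Real.log_div hpos.ne' (Real.exp_pos 1).ne',
    Real.log_exp] at hanti
  norm_num at hanti
  push_cast at *
  linarith

/-- Log-convexity of `Γ` together with the duplication formula. -/
theorem Gamma_half_add_one_sq_le (k : ℕ) :
    Real.Gamma ((k : ℝ) / 2 + 1) ^ 2 ≤
      k.factorial * 2 ^ (-(k : ℝ)) * √(Real.pi * ((k + 1) / 2)) := by
  set s : ℝ := (k : ℝ) / 2 + 1 / 2 with hs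
  have hs0 : 0 < s := by positivity
  have hdup := Real.Gamma_mul_Gamma_add_half s
  have e1 : s + 1 / 2 = (k : ℝ) / 2 + 1 := by rw [hs]; ring
  have e2 : 2 * s = (k : ℝ) + 1 := by rw [hs]; ring
  rw [e1, e2, Real.Gamma_nat_eq_factorial] at hdup
  have hconv := Real.Gamma_mul_add_mul_le_rpow_Gamma_mul_rpow_Gamma (s := s) (t := s + 1)
    (a := 1 / 2) (b := 1 / 2) hs0 (by positivity) (by norm_num) (by norm_num) (by norm_num)
  have e3 : 1 / 2 * s + 1 / 2 * (s + 1) = (k : ℝ) / 2 + 1 := by rw [hs]; ring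
  have hG := Real.Gamma_pos_of_pos hs0
  rw [e3, Real.Gamma_add_one hs0.ne', Real.mul_rpow hs0.le hG.le,
    ← Real.sqrt_eq_rpow, ← Real.sqrt_eq_rpow] at hconv
  have hconv' : Real.Gamma ((k : ℝ) / 2 + 1) ≤ Real.Gamma s * √s := by
    refine hconv.trans_eq ?_
    rw [mul_left_comm, Real.mul_self_sqrt hG.le, mul_comm]
  have hG1 : 0 < Real.Gamma ((k : ℝ) / 2 + 1) := Real.Gamma_pos_of_pos (by positivity)
  have e4 : (1 : ℝ) - (k + 1) = -k := by ring
  rw [e4] at hdup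
  have e5 : ((k : ℝ) + 1) / 2 = s := by rw [hs]; ring
  rw [Real.sqrt_mul Real.pi_pos.le, e5, ← mul_assoc,
    mul_right_comm _ (√Real.pi) (√s), mul_right_comm _ (√s) (√Real.pi), ← hdup]
  nlinarith

theorem unitBallVol_pos (k : ℕ) : 0 < unitBallVol k :=
  div_pos (Real.rpow_pos_of_pos Real.pi_pos _) (Real.Gamma_pos_of_pos (by positivity))

theorem sigmaQ_pos (k : ℕ) : 0 < sigmaQ k :=
  mul_pos (by norm_num) (Real.rpow_pos_of_pos (unitBallVol_pos k) _)

theorem log_sigmaQ {k : ℕ} (hk : 1 ≤ k) :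
    Real.log (sigmaQ k) =
      Real.log 4 - Real.log Real.pi + 2 / k * Real.log (Real.Gamma ((k : ℝ) / 2 + 1)) := by
  have hk0 : (k : ℝ) ≠ 0 := by positivity
  have hG : 0 < Real.Gamma ((k : ℝ) / 2 + 1) := Real.Gamma_pos_of_pos (by positivity)
  rw [sigmaQ, Real.log_mul (by norm_num) (Real.rpow_pos_of_pos (unitBallVol_pos k) _).ne',
    Real.log_rpow (unitBallVol_pos k), unitBallVol,
    Real.log_div (Real.rpow_pos_of_pos Real.pi_pos _).ne' hG.ne', Real.log_rpow Real.pi_pos]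
  field_simp
  ring

theorem log_sigmaQ_le {k : ℕ} (hk : 1 ≤ k) :
    Real.log (sigmaQ k) ≤ Real.log k - 1 + 4 / √k := by
  have hk1 : (1 : ℝ) ≤ k := by exact_mod_cast hk
  have hk0 : (0 : ℝ) < k := by linarith
  have hG : 0 < Real.Gamma ((k : ℝ) / 2 + 1) := Real.Gamma_pos_of_pos (by positivity)
  have hlog := Real.log_le_log (by positivity) (Gamma_half_add_one_sq_le k)
  rw [Real.log_pow, Real.log_mul (by positivity) (by positivity),
    Real.log_mul (by positivity) (by positivity), Real.log_rpow (by norm_num),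
    Real.log_sqrt (by positivity)] at hlog
  have hfac := log_factorial_le hk
  have hpi : Real.log (Real.pi * ((k + 1) / 2)) ≤ 2 * Real.log 2 + Real.log k := by
    have h4 : 2 * Real.log 2 + Real.log k = Real.log (2 ^ 2 * k) := by
      rw [Real.log_mul (by norm_num) hk0.ne', Real.log_pow]; norm_num
    rw [h4]
    apply Real.log_le_log (by positivity)
    nlinarith [Real.pi_pos, Real.pi_lt_four]
  have hlog2 : Real.log 2 < 1 := by linarith [Real.log_two_lt_d9]
  have hlogpi : Real.log 2 ≤ Real.log Real.pi :=
    Real.log_le_log (by norm_num) Real.two_le_pi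
  have hlog4 : Real.log 4 = 2 * Real.log 2 := by
    rw [show (4 : ℝ) = 2 ^ 2 by norm_num, Real.log_pow]; norm_num
  have hsq : √(k : ℝ) * √k = k := Real.mul_self_sqrt hk0.le
  have hs1 : 1 ≤ √(k : ℝ) := Real.one_le_sqrt.mpr hk1
  have hlogk : Real.log k ≤ 2 * √(k : ℝ) - 2 := by
    have h := Real.log_le_sub_one_of_pos (show 0 < √(k : ℝ) by positivity)
    rw [Real.log_sqrt hk0.le] at h
    linarith
  have hmain : 2 * Real.log (Real.Gamma ((k : ℝ) / 2 + 1)) ≤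
      k * (Real.log k - 1 - Real.log 2 + 4 / √k) := by
    have hd : (k : ℝ) * (4 / √k) = 4 * √k := by
      field_simp
      nlinarith
    push_cast at hlog
    nlinarith
  rw [log_sigmaQ hk, div_mul_eq_mul_div]
  have := (div_le_iff₀' hk0).mpr hmain
  linarith

theorem sigmaE_eq (ℓ : ℕ) {k : ℕ} (hk : 1 ≤ k) :
    sigmaE ℓ k = sigmaQ (2 * k) / 2 * √|(discE ℓ : ℝ)| := by
  have hk0 : (k : ℝ) ≠ 0 := by positivity
  have he : -(2 : ℝ) / ((2 * k : ℕ) : ℝ) = -1 / k := by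
    push_cast
    field_simp
  rw [sigmaE, sigmaQ, he]
  ring

theorem log_sigmaQ_two_mul_half_le {k : ℕ} (hk : 1 ≤ k) :
    Real.log (sigmaQ (2 * k) / 2) ≤ Real.log k - 1 + 4 / √k := by
  have hk0 : (0 : ℝ) < k := by exact_mod_cast hk
  have h := log_sigmaQ_le (show 1 ≤ 2 * k by omega)
  rw [Real.log_div (sigmaQ_pos _).ne' (by norm_num)]
  push_cast at h
  rw [Real.log_mul (by norm_num) hk0.ne'] at h
  have : 4 / √(2 * (k : ℝ)) ≤ 4 / √k := by
    gcongr
    linarith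
  linarith

theorem log_add_one_sub_log_le {n : ℝ} (hn : 0 < n) :
    Real.log (n + 1) - Real.log n ≤ 1 / n := by
  rw [← Real.log_div (by positivity) hn.ne']
  have := Real.log_le_sub_one_of_pos (show 0 < (n + 1) / n by positivity)
  calc _ ≤ _ := this
    _ = _ := by field_simp; ring

theorem one_div_add_one_le_log_sub {n : ℝ} (hn : 0 < n) :
    1 / (n + 1) ≤ Real.log (n + 1) - Real.log n := by
  have := Real.log_le_sub_one_of_pos (show 0 < n / (n + 1) by positivity)
  rw [Real.log_div hn.ne' (by positivity)] at this
  have h : n / (n + 1) - 1 = -(1 / (n + 1)) := by field_simp; ring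
  linarith

/-- The increment of `log² / 2 + 6 ∑ j ^ (-3/2)` dominates that of
`∑ (log (j + 1) - 1 + 4 / √(j + 1)) / j + log (m + 1)`. -/
theorem log_increment_le {x : ℝ} (hx : 1 ≤ x) :
    (Real.log (x + 1 + 1) - 1 + 4 / √(x + 1 + 1)) / (x + 1) +
        Real.log (x + 1 + 1) - Real.log (x + 1) ≤
      Real.log (x + 1) ^ 2 / 2 - Real.log x ^ 2 / 2 + 6 * (1 / ((x + 1) * √(x + 1))) := by
  set n := x + 1 with hn
  have hx0 : 0 < x := by linarith
  have hn0 : 0 < n := by linarith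
  have h1 := log_add_one_sub_log_le hn0
  have h2 := log_add_one_sub_log_le hx0
  have h3 := one_div_add_one_le_log_sub hx0
  rw [← hn] at h2 h3
  have hlx : 0 ≤ Real.log x := Real.log_nonneg hx
  have hs0 : 0 < √n := by positivity
  have hsn : √n ≤ n := by
    rw [Real.sqrt_le_left hn0.le]
    nlinarith
  have hq : 4 / √(n + 1) ≤ 4 / √n := by
    gcongr
    linarith
  have h4 : (Real.log (n + 1) - 1 + 4 / √(n + 1)) / n ≤
      (Real.log n + 1 / n - 1 + 4 / √n) / n := by
    gcongr
    linarith
  have h5 : (Real.log n + 1 / n - 1 + 4 / √n) / n =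
      Real.log n / n + 1 / (n * n) - 1 / n + 4 * (1 / (n * √n)) := by
    field_simp
  have h6 : 1 / (n * n) ≤ 1 / (n * √n) := by gcongr
  have h7 : Real.log n / n - 1 / (n * n) ≤ Real.log n ^ 2 / 2 - Real.log x ^ 2 / 2 := by
    have hb : 1 / x ≤ 2 / n := by
      rw [div_le_div_iff₀ hx0 hn0]; linarith
    have hsum : 0 ≤ Real.log n + Real.log x := by
      have : 0 < 1 / n := by positivity
      linarith
    have hmul := mul_le_mul_of_nonneg_right h3 hsum
    have hlow : 1 / n * (2 * Real.log n - 2 / n) ≤ 1 / n * (Real.log n + Real.log x) := by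
      gcongr
      linarith
    have he : 1 / n * (2 * Real.log n - 2 / n) = 2 * (Real.log n / n - 1 / (n * n)) := by
      field_simp
    nlinarith
  linarith

/-- Products of the shape of `alphaQ` and `alphaE`, with factors of size about `k / e`. -/
theorem prod_rpow_le (s : ℕ → ℝ) (hpos : ∀ k, 1 ≤ k → 0 < s k)
    (hs : ∀ k, 1 ≤ k → Real.log (s k) ≤ Real.log k - 1 + 4 / √k) {m : ℕ} (hm : 1 ≤ m) :
    ∏ k ∈ Finset.Icc 2 (m + 1), s k ^ ((1 : ℝ) / ((k : ℝ) - 1)) ≤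
      Real.exp (Real.log m ^ 2 / 2 - Real.log (m + 1) +
        6 * ∑ j ∈ Finset.range (m + 1), 1 / ((j : ℝ) * √j)) := by
  have hfactor : ∀ m : ℕ, 1 ≤ m → s (m + 1) ^ ((1 : ℝ) / (((m + 1 : ℕ) : ℝ) - 1)) ≤
      Real.exp ((Real.log ((m : ℝ) + 1) - 1 + 4 / √((m : ℝ) + 1)) / m) := by
    intro m hm
    have hm0 : (0 : ℝ) < m := by exact_mod_cast hm
    have h := hs (m + 1) (by omega)
    rw [← Real.log_le_iff_le_exp (Real.rpow_pos_of_pos (hpos _ (by omega)) _),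
      Real.log_rpow (hpos _ (by omega))]
    push_cast at h ⊢
    rw [add_sub_cancel_right, one_div_mul_eq_div]
    gcongr
  induction m, hm using Nat.le_induction with
  | base =>
    have h := hfactor 1 le_rfl
    rw [Finset.Icc_self, Finset.prod_singleton]
    refine h.trans (Real.exp_le_exp.mpr ?_)
    have h2 : 4 / √(2 : ℝ) ≤ 4 := by
      apply div_le_self (by norm_num)
      rw [Real.one_le_sqrt]; norm_num
    have := Real.log_two_lt_d9
    norm_num [Finset.sum_range_succ]
    linarith
  | succ m hm ih =>
    have hm1 : (1 : ℝ) ≤ m := by exact_mod_cast hm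
    rw [Finset.prod_Icc_succ_top (by omega), Finset.sum_range_succ]
    have h := hfactor (m + 1) (by omega)
    have hinc := log_increment_le hm1
    refine (mul_le_mul ih h (Real.rpow_nonneg (hpos _ (by omega)).le _)
      (Real.exp_pos _).le).trans ?_
    rw [← Real.exp_add, Real.exp_le_exp]
    push_cast at *
    linarith

theorem summable_one_div_mul_sqrt : Summable fun j : ℕ => 1 / ((j : ℝ) * √j) := by
  refine (Real.summable_one_div_nat_rpow.mpr (show (1 : ℝ) < 3 / 2 by norm_num)).congr ?_
  intro j
  congr 1
  rcases Nat.eq_zero_or_pos j with rfl | hj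
  · norm_num
  · have hj0 : (0 : ℝ) < j := by exact_mod_cast hj
    rw [Real.sqrt_eq_rpow, show (3 / 2 : ℝ) = 1 + 1 / 2 by norm_num, Real.rpow_add hj0,
      Real.rpow_one]

theorem mul_prod_rpow_le (s : ℕ → ℝ) (hpos : ∀ k, 1 ≤ k → 0 < s k)
    (hs : ∀ k, 1 ≤ k → Real.log (s k) ≤ Real.log k - 1 + 4 / √k) {m : ℕ} (hm : 1 ≤ m) :
    s (m + 1) * ∏ k ∈ Finset.Icc 2 (m + 1), s k ^ ((1 : ℝ) / ((k : ℝ) - 1)) ≤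
      Real.exp (3 + 6 * ∑' j : ℕ, 1 / ((j : ℝ) * √j)) * Real.exp (Real.log m ^ 2 / 2) := by
  have hsum : ∑ j ∈ Finset.range (m + 1), 1 / ((j : ℝ) * √j) ≤
      ∑' j : ℕ, 1 / ((j : ℝ) * √j) :=
    summable_one_div_mul_sqrt.sum_le_tsum _ fun j _ => by positivity
  have hfirst : s (m + 1) ≤ Real.exp (Real.log (m + 1) + 3) := by
    rw [← Real.log_le_iff_le_exp (hpos _ (by omega))]
    have h := hs (m + 1) (by omega)
    have h4 : 4 / √((m : ℝ) + 1) ≤ 4 := by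
      apply div_le_self (by norm_num)
      rw [Real.one_le_sqrt]
      have : (0 : ℝ) ≤ m := by positivity
      linarith
    push_cast at h
    linarith
  refine (mul_le_mul hfirst (prod_rpow_le s hpos hs hm)
    (Finset.prod_nonneg fun k hk => Real.rpow_nonneg (hpos k ?_).le _)
    (Real.exp_pos _).le).trans ?_
  · have := (Finset.mem_Icc.mp hk).1
    omega
  · rw [← Real.exp_add, ← Real.exp_add, Real.exp_le_exp]
    linarith

theorem prod_rpow_one_div_sub_one {c : ℝ} (hc : 0 < c) (m : ℕ) :
    ∏ k ∈ Finset.Icc 2 (m + 1), c ^ ((1 : ℝ) / ((k : ℝ) - 1)) = c ^ harmonicSum m := by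
  induction m with
  | zero => simp [harmonicSum]
  | succ m ih =>
    have hH : harmonicSum (m + 1) = harmonicSum m + 1 / ((m + 1 : ℕ) : ℝ) :=
      Finset.sum_Icc_succ_top (by omega) _
    rw [Finset.prod_Icc_succ_top (by omega), ih, hH, Real.rpow_add hc]
    push_cast
    rw [add_sub_cancel_right]

theorem discE_ne_zero {ℓ : ℕ} (hℓ : 0 < ℓ) : discE ℓ ≠ 0 := by
  unfold discE
  split <;> omega

theorem alphaE_eq {ℓ : ℕ} (hℓ : 0 < ℓ) (m : ℕ) :
    alphaE ℓ m = sigmaQ (2 * (m + 1)) / 2 *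
      (∏ k ∈ Finset.Icc 2 (m + 1), (sigmaQ (2 * k) / 2) ^ ((1 : ℝ) / ((k : ℝ) - 1))) *
      |(discE ℓ : ℝ)| ^ ((1 + harmonicSum m) / 2) := by
  have hd : 0 < |(discE ℓ : ℝ)| := abs_pos.mpr (by exact_mod_cast discE_ne_zero hℓ)
  have hsd : 0 < √|(discE ℓ : ℝ)| := Real.sqrt_pos.mpr hd
  have hprod : ∏ k ∈ Finset.Icc 2 (m + 1), sigmaE ℓ k ^ ((1 : ℝ) / ((k : ℝ) - 1)) =
      (∏ k ∈ Finset.Icc 2 (m + 1), (sigmaQ (2 * k) / 2) ^ ((1 : ℝ) / ((k : ℝ) - 1))) *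
        √|(discE ℓ : ℝ)| ^ harmonicSum m := by
    rw [← prod_rpow_one_div_sub_one hsd, ← Finset.prod_mul_distrib]
    refine Finset.prod_congr rfl fun k hk => ?_
    have := (Finset.mem_Icc.mp hk).1
    rw [sigmaE_eq ℓ (by omega), Real.mul_rpow (half_pos (sigmaQ_pos _)).le hsd.le]
  have hpow : |(discE ℓ : ℝ)| ^ ((1 + harmonicSum m) / 2) =
      √|(discE ℓ : ℝ)| * √|(discE ℓ : ℝ)| ^ harmonicSum m := by
    rw [← Real.rpow_one_add' hsd.le, Real.sqrt_eq_rpow, ← Real.rpow_mul hd.le]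
    · congr 1
      ring
    · have : 0 ≤ harmonicSum m := Finset.sum_nonneg fun k _ => by positivity
      linarith
  rw [alphaE, hprod, sigmaE_eq ℓ (by omega), hpow]
  ring

/-- There is an absolute constant `D₁ > 0` such that for every `m ≥ 1`:
(i) `α_ℚ(m) ≤ D₁·e^{(ln m)²/2}`; and (ii) for every squarefree positive integer `ℓ`, with
`d` the discriminant of `ℚ(√−ℓ)`, `α_E(m) ≤ D₁·|d|^{(1+Σ(m))/2}·e^{(ln m)²/2}`. -/
theorem alpha_upper_bound :
    ∃ D₁ : ℝ, 0 < D₁ ∧ ∀ m : ℕ, 1 ≤ m →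
      alphaQ m ≤ D₁ * Real.exp ((Real.log m) ^ 2 / 2) ∧
      ∀ ℓ : ℕ, Squarefree ℓ → 0 < ℓ →
        alphaE ℓ m ≤
          D₁ * |(discE ℓ : ℝ)| ^ ((1 + harmonicSum m) / 2) *
            Real.exp ((Real.log m) ^ 2 / 2) := by
  refine ⟨Real.exp (3 + 6 * ∑' j : ℕ, 1 / ((j : ℝ) * √j)), Real.exp_pos _, fun m hm => ⟨?_, ?_⟩⟩
  · exact mul_prod_rpow_le sigmaQ (fun k _ => sigmaQ_pos k) (fun k hk => log_sigmaQ_le hk) hm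
  · intro ℓ _ hℓ
    rw [alphaE_eq hℓ, mul_right_comm (Real.exp _)]
    refine mul_le_mul_of_nonneg_right ?_ (by positivity)
    exact mul_prod_rpow_le (fun k => sigmaQ (2 * k) / 2) (fun k _ => half_pos (sigmaQ_pos _))
      (fun k hk => log_sigmaQ_two_mul_half_le hk) hm
end

section
/- For every real β > 0 there exists a constant D₂ > 0 such that c_β(m) ≤ D₂·e^{2√(βm)} for all integers m ≥ 1, where c_β(m) is the m-th Maclaurin coefficient of exp(βx/(1−x)). -/
/-- `c_β(m)`, the `m`-th Maclaurin coefficient of `exp(βx/(1−x))`: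
`c_β(0) = 1` and `c_β(m) = Σ_{k=1}^m binom(m−1, k−1)·β^k/k!` for `m ≥ 1`. -/
noncomputable def cCoeff (β : ℝ) (m : ℕ) : ℝ :=
  if m = 0 then 1
  else ∑ k ∈ Finset.Icc 1 m, (Nat.choose (m - 1) (k - 1) : ℝ) * β ^ k / (Nat.factorial k : ℝ)

/-- `x ^ (2j+1) / (j! (j+1)!)` is at most the corresponding term of the series of `sinh (2x)`. -/
lemma pow_div_factorial_mul_factorial_succ_le {x : ℝ} (hx : 0 ≤ x) (j : ℕ) :
    x ^ (2 * j + 1) / ((j.factorial : ℝ) * (j + 1).factorial) ≤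
      (2 * x) ^ (2 * j + 1) / ((2 * j + 1).factorial : ℝ) := by
  have hchoose : ((2 * j + 1).factorial : ℝ) ≤
      2 ^ (2 * j + 1) * ((j.factorial : ℝ) * (j + 1).factorial) := by
    have h := Nat.add_choose_mul_factorial_mul_factorial j (j + 1)
    rw [show j + (j + 1) = 2 * j + 1 by ring, mul_assoc] at h
    rw [← h]
    push_cast
    gcongr
    exact_mod_cast Nat.choose_le_two_pow (2 * j + 1) (j + 1)
  rw [div_le_div_iff₀ (by positivity) (by positivity), mul_pow]
  calc x ^ (2 * j + 1) * ((2 * j + 1).factorial : ℝ)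
      ≤ x ^ (2 * j + 1) * (2 ^ (2 * j + 1) * ((j.factorial : ℝ) * (j + 1).factorial)) := by
        gcongr
    _ = _ := by ring

/-- Each term of `cCoeff β m` is at most `√β` times a term of the series of `sinh (2 √(β m))`. -/
lemma choose_mul_pow_div_factorial_le {β : ℝ} (hβ : 0 ≤ β) {m : ℕ} (hm : 1 ≤ m) (j : ℕ) :
    (Nat.choose (m - 1) j : ℝ) * β ^ (j + 1) / ((j + 1).factorial : ℝ) ≤
      √β * ((2 * √(β * m)) ^ (2 * j + 1) / ((2 * j + 1).factorial : ℝ)) := by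
  have hone : 1 ≤ √(m : ℝ) := Real.one_le_sqrt.mpr (by exact_mod_cast hm)
  have hchoose : (Nat.choose (m - 1) j : ℝ) ≤ (m : ℝ) ^ j / (j.factorial : ℝ) :=
    (Nat.choose_le_pow_div j (m - 1)).trans (by gcongr; exact Nat.sub_le m 1)
  have hpow : √β * √(β * m) ^ (2 * j + 1) = (m : ℝ) ^ j * β ^ (j + 1) * √(m : ℝ) := by
    rw [pow_succ, pow_mul, Real.sq_sqrt (by positivity), Real.sqrt_mul hβ, mul_pow, pow_succ β]
    linear_combination (β ^ j * (m : ℝ) ^ j * √(m : ℝ)) * Real.mul_self_sqrt hβ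
  calc (Nat.choose (m - 1) j : ℝ) * β ^ (j + 1) / ((j + 1).factorial : ℝ)
      ≤ (m : ℝ) ^ j / (j.factorial : ℝ) * β ^ (j + 1) / ((j + 1).factorial : ℝ) := by gcongr
    _ = (m : ℝ) ^ j * β ^ (j + 1) * 1 / ((j.factorial : ℝ) * (j + 1).factorial) := by
        field_simp
    _ ≤ (m : ℝ) ^ j * β ^ (j + 1) * √(m : ℝ) / ((j.factorial : ℝ) * (j + 1).factorial) := by
        gcongr
    _ = √β * (√(β * m) ^ (2 * j + 1) / ((j.factorial : ℝ) * (j + 1).factorial)) := by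
        rw [← hpow, mul_div_assoc]
    _ ≤ _ := by
        exact mul_le_mul_of_nonneg_left
          (pow_div_factorial_mul_factorial_succ_le (Real.sqrt_nonneg _) j) (Real.sqrt_nonneg β)

/-- For every `β > 0` there is a constant `D₂ > 0` such that
`c_β(m) ≤ D₂·e^{2√(βm)}` for all `m ≥ 1`. -/
theorem cCoeff_upper_bound (β : ℝ) (hβ : 0 < β) :
    ∃ D₂ : ℝ, 0 < D₂ ∧ ∀ m : ℕ, 1 ≤ m →
      cCoeff β m ≤ D₂ * Real.exp (2 * Real.sqrt (β * m)) := by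
  refine ⟨√β, Real.sqrt_pos.mpr hβ, fun m hm => ?_⟩
  set y := 2 * √(β * m)
  have hy : 0 ≤ y := by positivity
  have hsinh : ∑ j ∈ Finset.range m, y ^ (2 * j + 1) / ((2 * j + 1).factorial : ℝ) ≤
      Real.sinh y :=
    sum_le_hasSum _ (fun j _ => by positivity) (Real.hasSum_sinh y)
  have hexp : Real.sinh y ≤ Real.exp y := by
    rw [← Real.cosh_add_sinh]
    linarith [Real.cosh_pos y]
  rw [cCoeff, if_neg (by lia), ← Finset.Ico_add_one_right_eq_Icc, Finset.sum_Ico_eq_sum_range]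
  simp only [Nat.add_sub_cancel, Nat.add_comm 1]
  calc _ ≤ ∑ j ∈ Finset.range m, √β * (y ^ (2 * j + 1) / ((2 * j + 1).factorial : ℝ)) :=
        Finset.sum_le_sum fun j _ => choose_mul_pow_div_factorial_le hβ.le hm j
    _ ≤ √β * Real.exp y := by
        rw [← Finset.mul_sum]
        gcongr
        exact hsinh.trans hexp
end

section
/- Let n ≥ 2, let A = diag(a₁,…,aₙ) be a real diagonal matrix, and let S = (sᵢⱼ) ∈ Mₙ(ℂ) be hermitian (S* = S). Suppose there are real numbers tᵢⱼ > 0 (1 ≤ i, j ≤ n) such that aᵢ = Σ_{j=1}^n tᵢⱼ for each i, and tᵢⱼ·tⱼᵢ ≥ |sᵢⱼ|² for all i, j. Then the hermitian matrix A + S is positive semidefinite. -/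
open scoped Matrix ComplexOrder

theorem two_mul_mul_mul_le_of_sq_le_mul {p q s u v : ℝ} (hp : 0 ≤ p) (hq : 0 ≤ q)
    (h : s ^ 2 ≤ p * q) : 2 * (s * u * v) ≤ p * u ^ 2 + q * v ^ 2 := by
  refine le_of_sq_le_sq ?_ (by positivity)
  nlinarith [sq_nonneg (p * u ^ 2 - q * v ^ 2),
    mul_le_mul_of_nonneg_right h (by positivity : 0 ≤ u ^ 2 * v ^ 2)]

theorem re_star_dotProduct_diagonal_add_mulVec {ι : Type*} [Fintype ι] [DecidableEq ι]
    (t : ι → ι → ℝ) (S : Matrix ι ι ℂ) (x : ι → ℂ) :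
    (star x ⬝ᵥ ((Matrix.diagonal (fun i => ((∑ j, t i j : ℝ) : ℂ)) + S) *ᵥ x)).re =
      ∑ i, ∑ j, (t i j * ‖x i‖ ^ 2 + (star (x i) * S i j * x j).re) := by
  rw [dotProduct, Complex.re_sum]
  refine Finset.sum_congr rfl fun i _ => ?_
  have hx : (star (x i) * (((∑ j, t i j : ℝ) : ℂ) * x i)).re = (∑ j, t i j) * ‖x i‖ ^ 2 := by
    rw [mul_left_comm, Complex.re_ofReal_mul, Complex.star_def, Complex.conj_mul']
    norm_cast
  rw [Matrix.add_mulVec, Pi.add_apply, Matrix.mulVec_diagonal, Pi.star_apply, mul_add,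
    Complex.add_re, hx, Finset.sum_add_distrib, Finset.sum_mul, Matrix.mulVec, dotProduct,
    Finset.mul_sum, Complex.re_sum]
  simp only [mul_assoc]

/-- Let `n ≥ 2`, `A = diag(a₁,…,aₙ)` real diagonal, and `S ∈ Mₙ(ℂ)` hermitian.  If there
are reals `tᵢⱼ > 0` with `aᵢ = Σⱼ tᵢⱼ` and `tᵢⱼ·tⱼᵢ ≥ |sᵢⱼ|²` for all `i, j`, then `A + S`
is positive semidefinite. -/
theorem diagonal_add_hermitian_posSemidef (n : ℕ) (hn : 2 ≤ n)
    (a : Fin n → ℝ) (t : Fin n → Fin n → ℝ) (S : Matrix (Fin n) (Fin n) ℂ)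
    (hS : S.IsHermitian) (ht : ∀ i j, 0 < t i j) (ha : ∀ i, a i = ∑ j, t i j)
    (hts : ∀ i j, Complex.normSq (S i j) ≤ t i j * t j i) :
    (Matrix.diagonal (fun i => (a i : ℂ)) + S).PosSemidef := by
  obtain rfl : a = fun i => ∑ j, t i j := funext ha
  have hH : (Matrix.diagonal (fun i => ((∑ j, t i j : ℝ) : ℂ)) + S).IsHermitian :=
    (Matrix.isHermitian_diagonal_of_self_adjoint _
      (funext fun i => Complex.conj_ofReal _)).add hS
  refine .of_dotProduct_mulVec_nonneg hH fun x => ?_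
  refine Complex.nonneg_iff.mpr ⟨?_, (hH.im_star_dotProduct_mulVec_self x).symm⟩
  rw [re_star_dotProduct_diagonal_add_mulVec]
  have hpair (i j : Fin n) : 0 ≤ (t i j * ‖x i‖ ^ 2 + (star (x i) * S i j * x j).re) +
      (t j i * ‖x j‖ ^ 2 + (star (x j) * S j i * x i).re) := by
    have hbound := two_mul_mul_mul_le_of_sq_le_mul (u := ‖x i‖) (v := ‖x j‖)
      (ht i j).le (ht j i).le (Complex.normSq_eq_norm_sq (S i j) ▸ hts i j)
    have hre (k l : Fin n) : -(‖x k‖ * ‖S k l‖ * ‖x l‖) ≤ (star (x k) * S k l * x l).re := by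
      simpa using (abs_le.mp (Complex.abs_re_le_norm (star (x k) * S k l * x l))).1
    have hnorm : ‖S j i‖ = ‖S i j‖ := by rw [← hS.apply i j, norm_star]
    have hij := hre i j
    have hji := hre j i
    rw [hnorm] at hji
    linarith
  have hsum := Finset.sum_nonneg fun i (_ : i ∈ Finset.univ) =>
    Finset.sum_nonneg fun j (_ : j ∈ Finset.univ) => hpair i j
  rw [Finset.sum_congr rfl fun i _ => Finset.sum_add_distrib, Finset.sum_add_distrib] at hsum
  rw [Finset.sum_comm (f := fun i j => t j i * ‖x j‖ ^ 2 + (star (x j) * S j i * x i).re)]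
    at hsum
  linarith
end

section
/- Let n ≥ 2, let tᵢⱼ (1 ≤ i, j ≤ n) be positive integers, and let S = (sᵢⱼ) ∈ Mₙ(ℤ) be symmetric. Suppose tᵢⱼ·tⱼᵢ ≥ sᵢⱼ² for all i, j, and tᵢᵢ + sᵢᵢ ≥ 5(n−1) for all i. Let A = diag(a₁,…,aₙ) with aᵢ = Σ_{j=1}^n tᵢⱼ. Then A + S is represented by I_{4n²}, i.e., A + S = BᵀB for some 4n² × n matrix B with entries in ℤ. -/
open scoped Matrix

open Quaternion in
/-- The Hermitian matrix `[a, β; star β, c]` over the Lipschitz quaternions is `Xᴴ X` for a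
`2 × 2` Lipschitz matrix `X` with columns `(x, y)` and `(z, w)`. -/
def IsHermitianGram (a : ℤ) (β : ℍ[ℤ]) (c : ℤ) : Prop :=
  ∃ x y z w : ℍ[ℤ], normSq x + normSq y = a ∧ normSq z + normSq w = c ∧
    star x * z + star y * w = β

namespace IsHermitianGram

open Quaternion

variable {a c : ℤ} {β : ℍ[ℤ]}

theorem star_mul_self_eq_intCast (x : ℍ[ℤ]) : star x * x = ((normSq x : ℤ) : ℍ[ℤ]) :=
  star_mul_self x

theorem self_mul_star_eq_intCast (x : ℍ[ℤ]) : x * star x = ((normSq x : ℤ) : ℍ[ℤ]) :=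
  self_mul_star x

theorem normSq_intCast_eq (m : ℤ) : normSq (m : ℍ[ℤ]) = m ^ 2 := by
  rw [normSq_intCast, Int.cast_id]

theorem swap (h : IsHermitianGram a β c) : IsHermitianGram c (star β) a := by
  obtain ⟨x, y, z, w, h₁, h₂, rfl⟩ := h
  exact ⟨z, w, x, y, h₂, h₁, by simp⟩

theorem normSq_add_mul (x z k : ℍ[ℤ]) :
    normSq (z + x * k) = normSq z + 2 * (star (star x * z) * k).re + normSq x * normSq k := by
  simp only [normSq_def', re_add, imI_add, imJ_add, imK_add, re_mul, imI_mul, imJ_mul, imK_mul,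
    re_star, imI_star, imJ_star, imK_star]
  ring

theorem shift (h : IsHermitianGram a β c) (k : ℍ[ℤ]) :
    IsHermitianGram a (β + (a : ℍ[ℤ]) * k) (c + 2 * (star β * k).re + a * normSq k) := by
  obtain ⟨x, y, z, w, rfl, rfl, rfl⟩ := h
  refine ⟨x, y, z + x * k, w + y * k, rfl, ?_, ?_⟩
  · rw [normSq_add_mul, normSq_add_mul, star_add, add_mul, re_add]
    ring
  · rw [Int.cast_add, ← star_mul_self_eq_intCast, ← star_mul_self_eq_intCast]
    noncomm_ring

theorem of_shift (k : ℍ[ℤ])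
    (h : IsHermitianGram a (β + (a : ℍ[ℤ]) * k) (c + 2 * (star β * k).re + a * normSq k)) :
    IsHermitianGram a β c := by
  convert h.shift (-k) using 1
  · noncomm_ring
  · simp only [normSq_def', re_add, imI_add, imJ_add, imK_add, re_mul, imI_mul, imJ_mul, imK_mul,
      re_star, imI_star, imJ_star, imK_star, re_neg, imI_neg, imJ_neg, imK_neg,
      star_add, star_mul, re_intCast, imI_intCast, imJ_intCast, imK_intCast, Int.cast_id]
    ring

theorem exists_normSq_eq {d : ℤ} (hd : 0 ≤ d) : ∃ q : ℍ[ℤ], normSq q = d := by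
  obtain ⟨d, rfl⟩ := Int.eq_ofNat_of_zero_le hd
  obtain ⟨p, q, r, s, h⟩ := Nat.sum_four_squares d
  refine ⟨⟨p, q, r, s⟩, (normSq_def' _).trans ?_⟩
  dsimp only
  exact_mod_cast h

/-- Multiplying all entries of the factor by a quaternion of norm `g` scales the matrix by `g`. -/
theorem smul {g : ℤ} (hg : 0 ≤ g) (h : IsHermitianGram a β c) :
    IsHermitianGram (g * a) (g * β) (g * c) := by
  obtain ⟨q, rfl⟩ := exists_normSq_eq hg
  obtain ⟨x, y, z, w, rfl, rfl, rfl⟩ := h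
  refine ⟨q * x, q * y, q * z, q * w, by simp [mul_add], by simp [mul_add], ?_⟩
  have key (u v : ℍ[ℤ]) : star (q * u) * (q * v) = ((normSq q : ℤ) : ℍ[ℤ]) * (star u * v) := by
    rw [star_mul, mul_assoc, ← mul_assoc (star q), star_mul_self_eq_intCast, ← mul_assoc,
      ← mul_assoc, (Int.cast_commute (normSq q) (star u)).eq]
  rw [key, key, ← mul_add]

theorem mul_right (q : ℍ[ℤ]) (h : IsHermitianGram a β c) :
    IsHermitianGram a (β * q) (c * normSq q) := by
  obtain ⟨x, y, z, w, rfl, rfl, rfl⟩ := h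
  exact ⟨x, y, z * q, w * q, rfl, by simp [add_mul], by simp [add_mul, mul_assoc]⟩

theorem _root_.Int.exists_two_mul_abs_add_mul_le {a : ℤ} (ha : 0 < a) (b : ℤ) :
    ∃ k : ℤ, 2 * |b + a * k| ≤ a := by
  refine ⟨-((2 * b + a) / (2 * a)), ?_⟩
  have h₁ := Int.emod_nonneg (2 * b + a) (by omega : 2 * a ≠ 0)
  have h₂ := Int.emod_lt_of_pos (2 * b + a) (by omega : 0 < 2 * a)
  rw [Int.emod_def] at h₁ h₂
  have : |2 * (b + a * -((2 * b + a) / (2 * a)))| ≤ a := abs_le.2 ⟨by linarith, by linarith⟩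
  rwa [abs_mul, abs_two] at this

/-- Positive definite Hermitian matrices of determinant one are Gram matrices unless they are
even. -/
theorem of_det_eq_one (ha : 0 < a) (hdet : a * c = 1 + normSq β) (hodd : ¬(Even a ∧ Even c)) :
    IsHermitianGram a β c := by
  induction hn : a.toNat using Nat.strong_induction_on generalizing a c β with
  | _ n ih =>
  obtain ⟨k₀, h₀⟩ := Int.exists_two_mul_abs_add_mul_le ha β.re
  obtain ⟨k₁, h₁⟩ := Int.exists_two_mul_abs_add_mul_le ha β.imI
  obtain ⟨k₂, h₂⟩ := Int.exists_two_mul_abs_add_mul_le ha β.imJ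
  obtain ⟨k₃, h₃⟩ := Int.exists_two_mul_abs_add_mul_le ha β.imK
  obtain ⟨k, rfl, rfl, rfl, rfl⟩ : ∃ k : ℍ[ℤ], k.re = k₀ ∧ k.imI = k₁ ∧ k.imJ = k₂ ∧ k.imK = k₃ :=
    ⟨⟨k₀, k₁, k₂, k₃⟩, rfl, rfl, rfl, rfl⟩
  apply of_shift k
  have hc : Even a → (Even (c + 2 * (star β * k).re + a * normSq k) ↔ Even c) := by
    intro h
    simp [Int.even_add, h]
  set c' := c + 2 * (star β * k).re + a * normSq k with hc'
  have hdet' : a * c' = 1 + normSq (β + (a : ℍ[ℤ]) * k) := by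
    have := normSq_add_mul (a : ℍ[ℤ]) β k
    rw [this, hc', mul_add, mul_add, hdet, normSq_intCast_eq]
    simp only [star_mul, star_intCast, re_mul, re_intCast, imI_intCast, imJ_intCast, imK_intCast,
      imI_mul, imJ_mul, imK_mul, Int.cast_id]
    ring
  have hodd' : ¬(Even a ∧ Even c') := fun h => hodd ⟨h.1, (hc h.1).1 h.2⟩
  have e₀ : (β + (a : ℍ[ℤ]) * k).re = β.re + a * k.re := by simp
  have e₁ : (β + (a : ℍ[ℤ]) * k).imI = β.imI + a * k.imI := by simp
  have e₂ : (β + (a : ℍ[ℤ]) * k).imJ = β.imJ + a * k.imJ := by simp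
  have e₃ : (β + (a : ℍ[ℤ]) * k).imK = β.imK + a * k.imK := by simp
  rw [← e₀] at h₀
  rw [← e₁] at h₁
  rw [← e₂] at h₂
  rw [← e₃] at h₃
  clear_value c'
  generalize β + (a : ℍ[ℤ]) * k = β' at *
  have hc'pos : 0 < c' := by
    have : 0 ≤ normSq β' := by rw [normSq_def']; positivity
    by_contra! h
    nlinarith
  rcases lt_or_ge c' a with hlt | hge
  · have := ih c'.toNat (by omega) (a := c') (c := a) (β := star β') hc'pos
      (by rw [normSq_star]; linarith) (fun h => hodd' ⟨h.2, h.1⟩) rfl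
    simpa using this.swap
  have hsq {B u : ℤ} (h : |u| ≤ B) : u ^ 2 ≤ B ^ 2 := sq_le_sq.2 (h.trans (le_abs_self B))
  have hN := normSq_def' (a := β')
  rcases Int.even_or_odd' a with ⟨b, rfl | rfl⟩
  · have s₀ := hsq (by linarith : |β'.re| ≤ b)
    have s₁ := hsq (by linarith : |β'.imI| ≤ b)
    have s₂ := hsq (by linarith : |β'.imJ| ≤ b)
    have s₃ := hsq (by linarith : |β'.imK| ≤ b)
    refine absurd ⟨⟨b, by ring⟩, ⟨b, ?_⟩⟩ hodd'
    by_contra hne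
    have : 2 * b + 1 ≤ c' := by omega
    have hb : 1 ≤ b := by omega
    nlinarith
  · have s₀ := hsq (by omega : |β'.re| ≤ b)
    have s₁ := hsq (by omega : |β'.imI| ≤ b)
    have s₂ := hsq (by omega : |β'.imJ| ≤ b)
    have s₃ := hsq (by omega : |β'.imK| ≤ b)
    have hb : b = 0 := by nlinarith
    subst hb
    exact ⟨1, 0, β', 1, by simp, by rw [map_one]; linarith, by simp⟩

theorem of_isCoprime {b : ℤ} (ha : 0 < a) (hab : IsCoprime a b) (hdet : 0 < a * c - b ^ 2)
    (hodd : ¬(Even a ∧ Even c)) : IsHermitianGram a b c := by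
  obtain ⟨d, hd⟩ : ∃ d, d = a * c - b ^ 2 := ⟨_, rfl⟩
  have had : IsCoprime a d := by
    have : d = -b ^ 2 + a * c := by rw [hd]; ring
    rw [this, IsCoprime.add_mul_left_right_iff, IsCoprime.neg_right_iff]
    exact hab.pow_right
  obtain ⟨u, v, huv⟩ := had
  have hm : b + a * (-b * u) = d * (b * v) := by linear_combination -b * huv
  obtain ⟨k, hk⟩ : ∃ k, k = -b * u := ⟨_, rfl⟩
  obtain ⟨m, hm'⟩ : ∃ m, m = b * v := ⟨_, rfl⟩
  rw [← hk, ← hm'] at hm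
  have hac : a * (c + 2 * (b * k) + a * k ^ 2) = d * (1 + d * m ^ 2) := by
    linear_combination (b + a * k + d * m) * hm - hd
  obtain ⟨e, he⟩ : d ∣ c + 2 * (b * k) + a * k ^ 2 :=
    IsCoprime.dvd_of_dvd_mul_left ⟨v, u, by linarith⟩ ⟨_, hac⟩
  have hae : a * e = 1 + d * m ^ 2 := by
    refine mul_left_cancel₀ (hd ▸ hdet).ne' ?_
    rw [← hac, he]
    ring
  obtain ⟨π, hπ⟩ := exists_normSq_eq (hd ▸ hdet).le
  have hG : IsHermitianGram a (m * π) e := by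
    refine of_det_eq_one ha ?_ fun h => hodd ⟨h.1, ?_⟩
    · rw [map_mul, normSq_intCast_eq, hae, hπ]
      ring
    · have : Even (c + 2 * (b * k) + a * k ^ 2) := he ▸ h.2.mul_left d
      simpa [Int.even_add, h.1] using this
  apply of_shift (k : ℍ[ℤ])
  convert hG.mul_right (star π) using 1
  · rw [mul_assoc, self_mul_star_eq_intCast, hπ]
    have := congrArg (Int.cast : ℤ → ℍ[ℤ]) hm
    push_cast at this
    rw [this, (Int.cast_commute d (m : ℍ[ℤ])).eq]
  · rw [normSq_star, hπ, mul_comm e, ← he]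
    simp [normSq_intCast_eq]

/-- Translating a primitive binary form makes two adjacent coefficients coprime. -/
theorem _root_.Int.exists_isCoprime_of_isCoprime_gcd {a b c : ℤ} (hdet : 0 < a * c - b ^ 2)
    (hprim : ∀ p : ℤ, Prime p → p ∣ a → p ∣ b → ¬p ∣ c) :
    ∃ k : ℤ, IsCoprime (b + a * k) (c + b * k) := by
  classical
  obtain ⟨d, hd⟩ : ∃ d, d = a * c - b ^ 2 := ⟨_, rfl⟩
  let s : Finset ℕ := d.natAbs.primeFactors.filter fun p => ¬((p : ℤ) ∣ b ∧ (p : ℤ) ∣ c)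
  refine ⟨∏ p ∈ s, (p : ℤ), ?_⟩
  set k := ∏ p ∈ s, (p : ℤ)
  rw [Int.isCoprime_iff_gcd_eq_one]
  by_contra hne
  obtain ⟨p, hp, hpd⟩ := Nat.exists_prime_and_dvd hne
  have hpZ : Prime (p : ℤ) := Nat.prime_iff_prime_int.1 hp
  have h₁ : (p : ℤ) ∣ b + a * k := (Int.natCast_dvd_natCast.2 hpd).trans (Int.gcd_dvd_left ..)
  have h₂ : (p : ℤ) ∣ c + b * k := (Int.natCast_dvd_natCast.2 hpd).trans (Int.gcd_dvd_right ..)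
  have hpd' : (p : ℤ) ∣ d := by
    have : d = a * (c + b * k) - b * (b + a * k) := by rw [hd]; ring
    rw [this]
    exact dvd_sub (h₂.mul_left _) (h₁.mul_left _)
  by_cases hbc : (p : ℤ) ∣ b ∧ (p : ℤ) ∣ c
  · have hak : (p : ℤ) ∣ a * k := (dvd_add_right hbc.1).1 h₁
    rcases hpZ.dvd_or_dvd hak with ha | hk'
    · exact hprim p hpZ ha hbc.1 hbc.2
    · obtain ⟨q, hq, hpq⟩ := hpZ.exists_mem_finset_dvd hk'
      rw [Finset.mem_filter] at hq
      rw [Int.natCast_dvd_natCast,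
        Nat.prime_dvd_prime_iff_eq hp (Nat.prime_of_mem_primeFactors hq.1)] at hpq
      exact hq.2 (hpq ▸ hbc)
  · have hps : p ∈ s := by
      rw [Finset.mem_filter, Nat.mem_primeFactors]
      exact ⟨⟨hp, Int.natCast_dvd.1 hpd', by omega⟩, hbc⟩
    have hpk : (p : ℤ) ∣ k := Finset.dvd_prod_of_mem (fun p : ℕ => (p : ℤ)) hps
    exact hbc ⟨(dvd_add_left (hpk.mul_left a)).1 h₁, (dvd_add_left (hpk.mul_left b)).1 h₂⟩

theorem of_primitive {b : ℤ} (ha : 0 < a) (hprim : ∀ p : ℤ, Prime p → p ∣ a → p ∣ b → ¬p ∣ c)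
    (hdet : 0 < a * c - b ^ 2) (hodd : ¬(Even a ∧ Even c)) : IsHermitianGram a b c := by
  obtain ⟨k, hk⟩ := Int.exists_isCoprime_of_isCoprime_gcd hdet hprim
  apply of_shift (k : ℍ[ℤ])
  have hc : c + 2 * (star (b : ℍ[ℤ]) * (k : ℍ[ℤ])).re + a * normSq (k : ℍ[ℤ]) =
      c + b * k + k * (b + a * k) := by
    simp [normSq_intCast_eq]
    ring
  have hb : (b : ℍ[ℤ]) + (a : ℍ[ℤ]) * (k : ℍ[ℤ]) = ((b + a * k : ℤ) : ℍ[ℤ]) := by push_cast; rfl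
  rw [hc, hb]
  have hdet' : a * (c + b * k + k * (b + a * k)) - (b + a * k) ^ 2 = a * c - b ^ 2 := by ring
  have := of_isCoprime (a := c + b * k + k * (b + a * k)) (b := b + a * k) (c := a) ?_ ?_ ?_ ?_
  · rw [← star_intCast]
    exact this.swap
  · by_contra! h
    nlinarith [sq_nonneg (b + a * k)]
  · rw [IsCoprime.add_mul_right_left_iff]
    exact hk.symm
  · linarith
  · intro h
    refine hodd ⟨h.2, ?_⟩
    have h₁ : c = c + b * k + k * (b + a * k) - 2 * (b * k) - a * k ^ 2 := by ring
    rw [h₁]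
    exact (h.1.sub (even_two_mul _)).sub (h.2.mul_right _)

/-- A positive definite binary form with an odd diagonal entry is a sum of eight squares. -/
theorem of_posDef {b : ℤ} (ha : 0 < a) (hdet : 0 < a * c - b ^ 2) (hodd : ¬(Even a ∧ Even c)) :
    IsHermitianGram a b c := by
  obtain ⟨g, hg⟩ : ∃ g : ℕ, g = Nat.gcd (Int.gcd a b) c.natAbs := ⟨_, rfl⟩
  have hg0 : (0 : ℤ) < g := by
    have : 0 < Int.gcd a b := Int.gcd_pos_of_ne_zero_left b ha.ne'
    exact_mod_cast hg ▸ Nat.gcd_pos_of_pos_left _ this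
  have hgab : (g : ℤ) ∣ (Int.gcd a b : ℤ) := Int.natCast_dvd_natCast.2 (hg ▸ Nat.gcd_dvd_left ..)
  obtain ⟨a', ha'⟩ := hgab.trans (Int.gcd_dvd_left ..)
  obtain ⟨b', hb'⟩ := hgab.trans (Int.gcd_dvd_right ..)
  obtain ⟨c', hc'⟩ : (g : ℤ) ∣ c := Int.natCast_dvd.2 (hg ▸ Nat.gcd_dvd_right ..)
  have h : IsHermitianGram a' b' c' := by
    apply of_primitive
    · exact pos_of_mul_pos_right (ha' ▸ ha) hg0.le
    · intro p hp h₁ h₂ h₃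
      have hpg : g * p ∣ (g : ℤ) := by
        have h₄ : g * p ∣ (Int.gcd a b : ℤ) := Int.dvd_coe_gcd
          (ha' ▸ mul_dvd_mul_left _ h₁) (hb' ▸ mul_dvd_mul_left _ h₂)
        have h₅ : g * p ∣ c := hc' ▸ mul_dvd_mul_left _ h₃
        have := Int.dvd_coe_gcd h₄ h₅
        rwa [Int.gcd, Int.natAbs_natCast, ← hg] at this
      refine hp.not_isUnit (isUnit_of_dvd_one ?_)
      exact (mul_dvd_mul_iff_left hg0.ne').1 (by simpa using hpg)
    · refine pos_of_mul_pos_right (b := a' * c' - b' ^ 2) (a := (g : ℤ) ^ 2) ?_ (by positivity)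
      calc 0 < a * c - b ^ 2 := hdet
        _ = _ := by rw [ha', hb', hc']; ring
    · rintro ⟨h₁, h₂⟩
      exact hodd ⟨ha' ▸ h₁.mul_left _, hc' ▸ h₂.mul_left _⟩
  have := h.smul hg0.le
  rwa [← ha', ← hc', ← Int.cast_mul, ← hb'] at this

end IsHermitianGram

open Quaternion in
theorem exists_fin_eight_gram {a b c : ℤ} (ha : 0 < a) (hc : 0 < c) (hb : b ^ 2 ≤ a * c) :
    ∃ x y z w : Fin 4 → ℤ, ∑ q, x q ^ 2 + ∑ q, y q ^ 2 ≤ a + 2 ∧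
      ∑ q, z q ^ 2 + ∑ q, w q ^ 2 = c ∧ ∑ q, x q * z q + ∑ q, y q * w q = b := by
  obtain ⟨a', hodd, hlt, hle⟩ : ∃ a', Odd a' ∧ a < a' ∧ a' ≤ a + 2 := by
    rcases Int.even_or_odd a with h | h
    · exact ⟨a + 1, h.add_one, by omega, by omega⟩
    · exact ⟨a + 2, h.add_even even_two, by omega, le_rfl⟩
  obtain ⟨x, y, z, w, h₁, h₂, h₃⟩ := IsHermitianGram.of_posDef (a := a') (b := b) (c := c)
    (by omega) (by nlinarith) (fun h => Int.not_even_iff_odd.2 hodd h.1)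
  refine ⟨![x.re, x.imI, x.imJ, x.imK], ![y.re, y.imI, y.imJ, y.imK],
    ![z.re, z.imI, z.imJ, z.imK], ![w.re, w.imI, w.imJ, w.imK], ?_, ?_, ?_⟩
  · rw [normSq_def', normSq_def'] at h₁
    simp [Fin.sum_univ_four]
    linarith
  · rw [normSq_def', normSq_def'] at h₂
    simp [Fin.sum_univ_four]
    linarith
  · have := congrArg QuaternionAlgebra.re h₃
    simp at this
    simp [Fin.sum_univ_four]
    linarith

/-- Rows indexed by ordered pairs `(i, j)`, four per pair, supported on columns `i` and `j`. -/
theorem exists_transpose_mul_self_eq {ι κ R : Type*} [Fintype ι] [DecidableEq ι] [Fintype κ]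
    [CommRing R] (M : Matrix ι ι R) (X Z : ι → ι → κ → R) (hZ : ∀ i, Z i i = 0)
    (hoff : ∀ i j, i ≠ j → M i j = ∑ q, X i j q * Z i j q + ∑ q, X j i q * Z j i q)
    (hdiag : ∀ i, M i i = ∑ j, (∑ q, X i j q ^ 2 + ∑ q, Z j i q ^ 2)) :
    ∃ B : Matrix (ι × ι × κ) ι R, M = Bᵀ * B := by
  refine ⟨Matrix.of fun r k => (if k = r.1 then X r.1 r.2.1 r.2.2 else 0) +
    (if k = r.2.1 then Z r.1 r.2.1 r.2.2 else 0), ?_⟩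
  ext k l
  simp only [Matrix.mul_apply, Matrix.transpose_apply, Matrix.of_apply, Fintype.sum_prod_type,
    add_mul, mul_add, ite_mul, mul_ite, zero_mul, mul_zero, Finset.sum_add_distrib]
  by_cases hkl : k = l
  · subst hkl
    rw [hdiag]
    simp [Finset.sum_add_distrib, hZ, pow_two]
  · simp [hkl, hoff]
    simp only [mul_comm, add_comm]

/-- A pair `(i, j)` with `i < j` contributes eight squares, at a cost of at most two per diagonal
entry. -/
theorem exists_off_diagonal_blocks {ι : Type*} [LinearOrder ι] (t : ι → ι → ℤ) (S : Matrix ι ι ℤ)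
    (hS : S.IsSymm) (ht : ∀ i j, 0 < t i j) (hts : ∀ i j, S i j ^ 2 ≤ t i j * t j i) :
    ∃ X Z : ι → ι → Fin 4 → ℤ, (∀ i, Z i i = 0) ∧
      (∀ i j, i ≠ j → S i j = ∑ q, X i j q * Z i j q + ∑ q, X j i q * Z j i q) ∧
      ∀ i j, i ≠ j → ∑ q, X i j q ^ 2 + ∑ q, Z j i q ^ 2 ≤ t i j + 2 := by
  choose x y z w h₁ h₂ h₃ using fun i j => exists_fin_eight_gram (ht i j) (ht j i) (hts i j)
  refine ⟨fun i j => if i < j then x i j else w j i,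
    fun i j => if i < j then z i j else if j < i then y j i else 0, by simp, ?_, ?_⟩
  · intro i j hij
    rcases lt_or_gt_of_ne hij with h | h
    · simp only [h, h.not_gt, if_true, if_false]
      rw [← h₃ i j]
      simp only [mul_comm]
    · simp only [h, h.not_gt, if_true, if_false]
      rw [← hS.apply i j, ← h₃ j i, add_comm]
      simp only [mul_comm]
  · intro i j hij
    rcases lt_or_gt_of_ne hij with h | h
    · simpa only [h, h.not_gt, if_true, if_false] using h₁ i j
    · simp only [h, h.not_gt, if_true, if_false]
      linarith [h₂ j i]

/-- Let `n ≥ 2`, `tᵢⱼ` positive integers, `S ∈ Mₙ(ℤ)` symmetric with `tᵢⱼ·tⱼᵢ ≥ sᵢⱼ²` for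
all `i, j` and `tᵢᵢ + sᵢᵢ ≥ 5(n−1)` for all `i`.  With `A = diag(a₁,…,aₙ)`,
`aᵢ = Σⱼ tᵢⱼ`, the matrix `A + S` is represented by `I_{4n²}`, i.e. `A + S = BᵀB` for some
`4n² × n` integer matrix `B`. -/
theorem diagonal_add_symm_sum_of_squares (n : ℕ) (hn : 2 ≤ n)
    (t : Fin n → Fin n → ℤ) (S : Matrix (Fin n) (Fin n) ℤ)
    (hS : S.IsSymm) (ht : ∀ i j, 0 < t i j)
    (hts : ∀ i j, (S i j) ^ 2 ≤ t i j * t j i)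
    (hdiag : ∀ i, 5 * ((n : ℤ) - 1) ≤ t i i + S i i) :
    ∃ B : Matrix (Fin (4 * n ^ 2)) (Fin n) ℤ,
      Matrix.diagonal (fun i => ∑ j, t i j) + S = Bᵀ * B := by
  obtain ⟨X, Z, hZ, hoff, hle⟩ := exists_off_diagonal_blocks t S hS ht hts
  have hD (i : Fin n) : ∃ u : Fin 4 → ℤ, ∑ q, u q ^ 2 = t i i + S i i +
      ∑ j ∈ Finset.univ.erase i, (t i j - (∑ q, X i j q ^ 2 + ∑ q, Z j i q ^ 2)) := by
    have hsum : ∑ j ∈ Finset.univ.erase i, (-2 : ℤ) ≤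
        ∑ j ∈ Finset.univ.erase i, (t i j - (∑ q, X i j q ^ 2 + ∑ q, Z j i q ^ 2)) :=
      Finset.sum_le_sum fun j hj => by linarith [hle i j (Finset.ne_of_mem_erase hj).symm]
    rw [Finset.sum_const, Finset.card_erase_of_mem (Finset.mem_univ i), Finset.card_univ,
      Fintype.card_fin, nsmul_eq_mul, Nat.cast_sub (by omega), Nat.cast_one] at hsum
    have hn' : (2 : ℤ) ≤ n := by exact_mod_cast hn
    obtain ⟨m, hm⟩ := Int.eq_ofNat_of_zero_le
      (by linarith [hdiag i] : 0 ≤ t i i + S i i +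
        ∑ j ∈ Finset.univ.erase i, (t i j - (∑ q, X i j q ^ 2 + ∑ q, Z j i q ^ 2)))
    obtain ⟨p, q, r, s, h⟩ := Nat.sum_four_squares m
    refine ⟨![p, q, r, s], ?_⟩
    rw [hm, ← h]
    simp [Fin.sum_univ_four]
  choose D hD using hD
  obtain ⟨B, hB⟩ := exists_transpose_mul_self_eq (Matrix.diagonal (fun i => ∑ j, t i j) + S)
    (fun i j => if i = j then D i else X i j) Z hZ
    (fun i j hij => by simpa [hij, hij.symm] using hoff i j hij)
    (fun i => by
      have hX : ∑ j ∈ Finset.univ.erase i,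
          (∑ q, (if i = j then D i else X i j) q ^ 2 + ∑ q, Z j i q ^ 2) =
          ∑ j ∈ Finset.univ.erase i, (∑ q, X i j q ^ 2 + ∑ q, Z j i q ^ 2) :=
        Finset.sum_congr rfl fun j hj => by rw [if_neg (Finset.ne_of_mem_erase hj).symm]
      have ht' := Finset.add_sum_erase Finset.univ (t i) (Finset.mem_univ i)
      have hZ' : ∑ q, Z i i q ^ 2 = 0 := by simp [hZ]
      rw [← Finset.add_sum_erase _ _ (Finset.mem_univ i), hX, if_pos rfl, hD, hZ',
        Finset.sum_sub_distrib, Matrix.add_apply, Matrix.diagonal_apply_eq, ← ht']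
      ring)
  have hcard : Fintype.card (Fin (4 * n ^ 2)) = Fintype.card (Fin n × Fin n × Fin 4) := by
    simp
    ring
  let e := Fintype.equivOfCardEq hcard
  refine ⟨B.submatrix e id, ?_⟩
  rw [hB, Matrix.transpose_submatrix, Matrix.submatrix_mul_equiv, Matrix.submatrix_id_id]
end
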